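/- arXiv:math/0003129 — 4 statements merged into one kernel-verified Lean document; each statement's English description precedes it below -/
import Mathlib

section
/- Let n ≥ 9 and let T_1, …, T_{n−1} ∈ GL_n(ℂ) be invertible matrices satisfying the braid relations, such that the representation they define is irreducible. Then there exist a scalar y ∈ ℂ with y ≠ 0, a parameter u ∈ ℂ with u ≠ 0 and u ≠ 1, and an invertible matrix P ∈ GL_n(ℂ) such that T_i = y · P · S_i(u) · P⁻¹ for all i = 1, …, n−1. In other words, every irreducible n-dimensional representation of the braid group B_n with n ≥ 9 is the tensor product of a one-dimensional representation and a specialization of the standard representation at some u ≠ 0, 1. -/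
/-- The generators `S_i(u)` of the specialization of the standard representation of `B_n`
at `u ∈ ℂ`: the identity matrix except for the 2×2 block `[[0, u], [1, 0]]` in
(1-based) rows and columns `i, i+1`. -/
def stdGen (n : ℕ) (u : ℂ) (i : ℕ) : Matrix (Fin n) (Fin n) ℂ :=
  Matrix.of fun j k =>
    if j.val + 1 = i ∧ k.val = i then u
    else if j.val = i ∧ k.val + 1 = i then 1
    else if j = k ∧ j.val + 1 ≠ i ∧ j.val ≠ i then 1
    else 0

/-- The matrices `T 1, …, T (n-1)` satisfy the braid relations. -/
def BraidRels {r : ℕ} (n : ℕ) (T : ℕ → Matrix (Fin r) (Fin r) ℂ) : Prop :=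
  (∀ i, 1 ≤ i → i + 1 ≤ n - 1 → T i * T (i + 1) * T i = T (i + 1) * T i * T (i + 1)) ∧
  (∀ i j, 1 ≤ i → i + 2 ≤ j → j ≤ n - 1 → T i * T j = T j * T i)

/-- A subspace of `ℂ^r` invariant under all of `T 1, …, T (n-1)`. -/
def BraidInvariant {r : ℕ} (n : ℕ) (T : ℕ → Matrix (Fin r) (Fin r) ℂ)
    (p : Submodule ℂ (Fin r → ℂ)) : Prop :=
  ∀ i, 1 ≤ i → i ≤ n - 1 → ∀ v ∈ p, (T i).mulVec v ∈ p

/-- The representation of `B_n` given by `T 1, …, T (n-1)` is irreducible. -/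
def BraidIrreducible {r : ℕ} (n : ℕ) (T : ℕ → Matrix (Fin r) (Fin r) ℂ) : Prop :=
  ∀ p : Submodule ℂ (Fin r → ℂ), BraidInvariant n T p → p = ⊥ ∨ p = ⊤

/-- The units `T 0, …, T (N - 1)` of a ring satisfy the braid relations. -/
structure IsBraidFamily {R : Type*} [Ring R] (N : ℕ) (T : ℕ → R) : Prop where
  isUnit : ∀ i, i < N → IsUnit (T i)
  braid : ∀ i, i + 1 < N → T i * T (i + 1) * T i = T (i + 1) * T i * T (i + 1)
  comm : ∀ i j, i + 2 ≤ j → j < N → T i * T j = T j * T i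

namespace IsBraidFamily

section Ring

variable {R : Type*} [Ring R] {N : ℕ} {T : ℕ → R}

theorem drop_two (h : IsBraidFamily N T) : IsBraidFamily (N - 2) (fun i => T (i + 2)) where
  isUnit i hi := h.isUnit _ (by omega)
  braid i hi := h.braid (i + 2) (by omega)
  comm i j hij hj := h.comm _ _ (by omega) (by omega)

theorem comm_of_ne (h : IsBraidFamily N T) {i j : ℕ} (hi : i < N) (hj : j < N)
    (h₁ : i + 1 ≠ j) (h₂ : j + 1 ≠ i) : T i * T j = T j * T i := by
  rcases lt_trichotomy i j with hij | rfl | hij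
  · exact h.comm i j (by omega) hj
  · rfl
  · exact (h.comm j i (by omega) hi).symm

/-- The product `T 0 * T 1 * ⋯ * T (k - 1)`. -/
def ascending (T : ℕ → R) : ℕ → R
  | 0 => 1
  | k + 1 => ascending T k * T k

theorem isUnit_ascending (h : IsBraidFamily N T) {k : ℕ} (hk : k ≤ N) :
    IsUnit (ascending T k) := by
  induction k with
  | zero => exact isUnit_one
  | succ k ih => exact (ih (by omega)).mul (h.isUnit k (by omega))

theorem ascending_comm (h : IsBraidFamily N T) {k j : ℕ} (hkj : k < j) (hj : j < N) :
    ascending T k * T j = T j * ascending T k := by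
  induction k with
  | zero => simp [ascending]
  | succ k ih =>
    rw [ascending, mul_assoc, h.comm k j (by omega) hj, ← mul_assoc, ih (by omega), mul_assoc]

theorem ascending_mul (h : IsBraidFamily N T) {k i : ℕ} (hik : i + 1 < k) (hk : k ≤ N) :
    ascending T k * T i = T (i + 1) * ascending T k := by
  induction k with
  | zero => omega
  | succ k ih =>
    rcases Nat.lt_or_ge (i + 1) k with hlt | hge
    · rw [ascending, mul_assoc, ← h.comm i k (by omega) (by omega), ← mul_assoc,
        ih hlt (by omega), mul_assoc]
    · obtain rfl : k = i + 1 := by omega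
      rw [ascending, ascending, mul_assoc, mul_assoc, ← mul_assoc (T i), h.braid i (by omega),
        ← mul_assoc, ← mul_assoc, h.ascending_comm (by omega) (by omega)]
      simp only [mul_assoc]

theorem ascending_succ (T : ℕ → R) (k : ℕ) :
    ascending T (k + 1) = T 0 * ascending (fun i => T (i + 1)) k := by
  induction k with
  | zero => simp [ascending]
  | succ k ih => rw [ascending, ih, ascending, mul_assoc]

theorem ascending_mul_ascending (h : IsBraidFamily N T) {k : ℕ} (hk : k + 1 ≤ N) :
    ascending T N * ascending T k = ascending (fun i => T (i + 1)) k * ascending T N := by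
  induction k with
  | zero => simp [ascending]
  | succ k ih =>
    rw [ascending, ascending, ← mul_assoc, ih (by omega), mul_assoc,
      h.ascending_mul (by omega) le_rfl, mul_assoc]

/-- Conjugation by the product of all the generators shifts them cyclically, with one further
conjugate between the last and the first. -/
theorem exists_shift (h : IsBraidFamily N T) :
    ∃ s : Rˣ, (∀ i, i + 1 < N → s * T i = T (i + 1) * s) ∧
      (0 < N → (s * s : R) * T (N - 1) = T 0 * (s * s)) := by
  obtain ⟨s, hs⟩ := h.isUnit_ascending le_rfl
  refine ⟨s, fun i hi => ?_, fun hN => ?_⟩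
  · rw [hs, h.ascending_mul hi le_rfl]
  · obtain ⟨M, rfl⟩ : ∃ M, N = M + 1 := ⟨N - 1, by omega⟩
    rw [hs]
    have h1 := h.ascending_mul_ascending (k := M) le_rfl
    have h2 : ascending T (M + 1) * ascending T (M + 1)
        = ascending (fun i => T (i + 1)) M * ascending T (M + 1) * T M := by
      rw [← h1, mul_assoc, ← ascending]
    rw [Nat.add_sub_cancel]
    conv_rhs => rw [h2, ← mul_assoc, ← mul_assoc, ← ascending_succ]

theorem eq_of_commute (h : IsBraidFamily N T) {i : ℕ} (hi : i + 1 < N)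
    (hc : T i * T (i + 1) = T (i + 1) * T i) : T i = T (i + 1) := by
  have hb := h.braid i hi
  rw [hc] at hb
  exact ((h.isUnit _ hi).mul (h.isUnit i (by omega))).mul_left_cancel hb

theorem eq_iff_eq_shift (h : IsBraidFamily N T) {i : ℕ} (hi : i + 1 < N) :
    T i = T (i + 1) ↔ T 0 = T 1 := by
  obtain ⟨s, hs, -⟩ := h.exists_shift
  induction i with
  | zero => rfl
  | succ i ih =>
    rw [← ih (by omega), ← s.mul_left_inj, ← hs i (by omega), ← hs (i + 1) hi, s.mul_right_inj]

theorem all_eq_of_eq (h : IsBraidFamily N T) {i : ℕ} (hi : i + 1 < N)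
    (heq : T i = T (i + 1)) : ∀ j, j < N → T j = T 0 := by
  intro j hj
  induction j with
  | zero => rfl
  | succ j ih => rw [← ih (by omega), (h.eq_iff_eq_shift hj).2 ((h.eq_iff_eq_shift hi).1 heq)]

/-- A family of at least four generators that is constant up to a square-zero extension is
constant. -/
theorem all_eq_of_sub_mul_sub (h : IsBraidFamily N T) (hN : 4 ≤ N)
    (h0 : ∀ i j k l, i < N → j < N → k < N → l < N → (T i - T j) * (T k - T l) = 0) :
    ∀ j, j < N → T j = T 0 := by
  have h03 := h.comm 0 3 (by omega) (by omega)
  have h13 := h.comm 1 3 (by omega) (by omega)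
  have e1 := h0 1 0 3 0 (by omega) (by omega) (by omega) (by omega)
  have e2 := h0 3 0 1 0 (by omega) (by omega) (by omega) (by omega)
  refine h.all_eq_of_eq (i := 0) (by omega) (h.eq_of_commute (by omega) ?_)
  simp only [sub_mul, mul_sub] at e1 e2
  rw [h13] at e1
  rw [h03] at e1
  have e3 := e1.trans e2.symm
  have e4 : T 0 * T 1 - T 1 * T 0 =
      (T 3 * T 1 - T 3 * T 0 - (T 1 * T 0 - T 0 * T 0)) -
        (T 3 * T 1 - T 0 * T 1 - (T 3 * T 0 - T 0 * T 0)) := by abel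
  rwa [e3, sub_self, sub_eq_zero] at e4

end Ring

open Module

universe u

section Linear

variable {K : Type*} {V : Type u} [Field K] [AddCommGroup V] [Module K V]
  {N : ℕ} {T : ℕ → End K V}

/-- The subspace `p` is stable under `T 0, …, T (N - 1)`. -/
def IsStable (N : ℕ) (T : ℕ → End K V) (p : Submodule K V) : Prop :=
  ∀ i, i < N → ∀ v ∈ p, T i v ∈ p

/-- There is no proper nonzero subspace stable under `T 0, …, T (N - 1)`. -/
def IsIrreducibleFamily (N : ℕ) (T : ℕ → End K V) : Prop :=
  ∀ p : Submodule K V, IsStable N T p → p = ⊥ ∨ p = ⊤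

/-- In dimension at most `d`, braid families with `N` generators are constant. -/
def ConstantUpTo (K : Type*) [Field K] (N d : ℕ) : Prop :=
  ∀ (W : Type u) [AddCommGroup W] [Module K W] [FiniteDimensional K W] (S : ℕ → End K W),
    finrank K W ≤ d → IsBraidFamily N S → ∀ j, j < N → S j = S 0

theorem smul (h : IsBraidFamily N T) {c : K} (hc : c ≠ 0) :
    IsBraidFamily N (fun i => c • T i) where
  isUnit i hi := (Units.mk0 c hc • (h.isUnit i hi).unit).isUnit
  braid i hi := by simp only [smul_mul_assoc, mul_smul_comm, h.braid i hi]
  comm i j hij hj := by simp only [smul_mul_assoc, mul_smul_comm, h.comm i j hij hj]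

variable [FiniteDimensional K V]

theorem exists_restrict (h : IsBraidFamily N T) {p : Submodule K V} (hp : IsStable N T p) :
    ∃ S : ℕ → End K p, IsBraidFamily N S ∧ ∀ i, i < N → ∀ x : p, (S i x : V) = T i x := by
  classical
  let S : ℕ → End K p := fun i => if hi : i < N then (T i).restrict (hp i hi) else 1
  have hS : ∀ i, i < N → ∀ x : p, (S i x : V) = T i x := fun i hi x => by
    simp [S, hi]
  refine ⟨S, ⟨fun i hi => ?_, fun i hi => ?_, fun i j hij hj => ?_⟩, hS⟩
  · rw [LinearMap.isUnit_iff_ker_eq_bot, LinearMap.ker_eq_bot']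
    intro x hx
    have h1 : T i x = 0 := by rw [← hS i hi, hx]; rfl
    have h2 := (LinearMap.isUnit_iff_ker_eq_bot (T i)).1 (h.isUnit i hi)
    exact Subtype.ext (LinearMap.ker_eq_bot'.1 h2 x h1)
  · ext x
    simp only [End.mul_apply, hS i (by omega), hS (i + 1) hi]
    exact LinearMap.congr_fun (h.braid i hi) x
  · ext x
    simp only [End.mul_apply, hS i (by omega), hS j hj]
    exact LinearMap.congr_fun (h.comm i j hij hj) x

theorem exists_quotient (h : IsBraidFamily N T) {p : Submodule K V} (hp : IsStable N T p) :
    ∃ S : ℕ → End K (V ⧸ p), IsBraidFamily N S ∧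
      ∀ i, i < N → ∀ x : V, S i (p.mkQ x) = p.mkQ (T i x) := by
  classical
  let S : ℕ → End K (V ⧸ p) := fun i =>
    if hi : i < N then p.mapQ p (T i) (fun v hv => hp i hi v hv) else 1
  have hS : ∀ i, i < N → ∀ x : V, S i (p.mkQ x) = p.mkQ (T i x) := fun i hi x => by
    simp [S, hi]
  refine ⟨S, ⟨fun i hi => ?_, fun i hi => ?_, fun i j hij hj => ?_⟩, hS⟩
  · rw [LinearMap.isUnit_iff_range_eq_top, LinearMap.range_eq_top]
    intro x
    obtain ⟨y, rfl⟩ := p.mkQ_surjective x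
    have h2 := (LinearMap.isUnit_iff_range_eq_top (T i)).1 (h.isUnit i hi)
    obtain ⟨z, rfl⟩ := LinearMap.range_eq_top.1 h2 y
    exact ⟨p.mkQ z, hS i hi z⟩
  · refine LinearMap.ext fun x => ?_
    obtain ⟨y, rfl⟩ := p.mkQ_surjective x
    simp only [End.mul_apply, hS i (by omega), hS (i + 1) hi]
    exact congrArg p.mkQ (LinearMap.congr_fun (h.braid i hi) y)
  · refine LinearMap.ext fun x => ?_
    obtain ⟨y, rfl⟩ := p.mkQ_surjective x
    simp only [End.mul_apply, hS i (by omega), hS j hj]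
    exact congrArg p.mkQ (LinearMap.congr_fun (h.comm i j hij hj) y)

/-- A subquotient of small dimension has a constant action. -/
theorem sub_mem_of_subquotient (h : IsBraidFamily N T) {d : ℕ}
    (hd : ConstantUpTo.{u} K N d) {p q : Submodule K V} (hp : IsStable N T p)
    (hq : IsStable N T q) (hqp : q ≤ p) (hdim : finrank K p ≤ finrank K q + d)
    {i : ℕ} (hi : i < N) {v : V} (hv : v ∈ p) : T i v - T 0 v ∈ q := by
  obtain ⟨S, hS, hST⟩ := h.exists_restrict hp
  have hq' : IsStable N S (q.comap p.subtype) := fun j hj x hx => by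
    rw [Submodule.mem_comap, Submodule.subtype_apply] at hx ⊢
    rw [hST j hj]
    exact hq j hj _ hx
  obtain ⟨S', hS', hSS'⟩ := hS.exists_quotient hq'
  have h1 := (q.comap p.subtype).finrank_quotient_add_finrank
  have h2 := (Submodule.comapSubtypeEquivOfLe hqp).finrank_eq
  have h3 := hd _ S' (by omega) hS' i hi
  have h4 := LinearMap.congr_fun h3 ((q.comap p.subtype).mkQ ⟨v, hv⟩)
  rw [hSS' i hi, hSS' 0 (by omega), ← sub_eq_zero, ← map_sub, Submodule.mkQ_apply,
    Submodule.Quotient.mk_eq_zero, Submodule.mem_comap, map_sub, Submodule.subtype_apply,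
    Submodule.subtype_apply, hST i hi, hST 0 (by omega)] at h4
  exact h4

/-- If all products of two differences of generators map into a stable subspace `q`, then
so do the differences themselves. -/
theorem sub_mem_of_sub_mul_sub (h : IsBraidFamily N T) (hN : 4 ≤ N) {q : Submodule K V}
    (hq : IsStable N T q)
    (h0 : ∀ i j k l, i < N → j < N → k < N → l < N →
      ∀ v, (T i - T j) ((T k - T l) v) ∈ q)
    {i : ℕ} (hi : i < N) (v : V) : T i v - T 0 v ∈ q := by
  obtain ⟨S, hS, hST⟩ := h.exists_quotient hq
  have h1 := hS.all_eq_of_sub_mul_sub hN (fun i j k l hi hj hk hl => by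
    refine LinearMap.ext fun x => ?_
    obtain ⟨y, rfl⟩ := q.mkQ_surjective x
    have := h0 i j k l hi hj hk hl y
    rw [← Submodule.Quotient.mk_eq_zero, ← Submodule.mkQ_apply] at this
    simpa [hST, hi, hj, hk, hl, -Submodule.mkQ_apply] using this) i hi
  have h2 := LinearMap.congr_fun h1 (q.mkQ v)
  rwa [hST i hi, hST 0 (by omega), ← sub_eq_zero, ← map_sub, Submodule.mkQ_apply,
    Submodule.Quotient.mk_eq_zero] at h2

theorem commute_family_range (h : IsBraidFamily N T) (hN : 4 ≤ N) {f : End K V}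
    (hf : ∀ i, i < N → f * T i = T i * f)
    (h0 : ∀ i j k l, i < N → j < N → k < N → l < N →
      (T i - T j) * f * (T k - T l) = 0) :
    ∀ i, i < N → (T i - T 0) * f = 0 := by
  have hst : IsStable N T (LinearMap.range f) := by
    rintro i hi _ ⟨v, rfl⟩
    exact ⟨T i v, LinearMap.congr_fun (hf i hi) v⟩
  obtain ⟨S, hS, hST⟩ := h.exists_restrict hst
  intro i hi
  have h1 := hS.all_eq_of_sub_mul_sub hN (fun i j k l hi hj hk hl => by
    refine LinearMap.ext fun x => ?_
    obtain ⟨_, v, rfl⟩ := x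
    apply Subtype.ext
    have hkl : f * (T k - T l) = (T k - T l) * f := by rw [mul_sub, sub_mul, hf k hk, hf l hl]
    have := h0 i j k l hi hj hk hl
    rw [mul_assoc, hkl] at this
    have := LinearMap.congr_fun this v
    simpa [hST, hi, hj, hk, hl] using this) i hi
  refine LinearMap.ext fun v => ?_
  have h2 := congrArg Subtype.val (LinearMap.congr_fun h1 ⟨f v, v, rfl⟩)
  rw [hST i hi, hST 0 (by omega)] at h2
  simpa [sub_eq_zero] using h2

/-- If braid families with `N - 2` generators are constant up to about half the dimension,
then some `T 0 - μ` is not injective, and the generators far from `T 0` agree on its range. -/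
theorem exists_eigenvalue_constant_on_range [IsAlgClosed K] [Nontrivial V]
    (h : IsBraidFamily N T) (hN : 6 ≤ N) {d : ℕ} (hd : ConstantUpTo.{u} K (N - 2) d)
    (hdim : finrank K V ≤ 2 * d + 1) :
    ∃ μ : K, (∃ v, v ≠ 0 ∧ T 0 v = μ • v) ∧
      ∀ i, 2 ≤ i → i < N → (T i - T 2) * (T 0 - algebraMap K (End K V) μ) = 0 := by
  have hS := h.drop_two
  set S : ℕ → End K V := fun i => T (i + 2) with hSdef
  set P : Set (Submodule K V) := {p | IsStable (N - 2) S p ∧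
    ∀ i, i < N - 2 → ∀ v, S i v - S 0 v ∈ p} with hP
  set R := sInf P with hR
  have hRst : IsStable (N - 2) S R := fun i hi v hv => by
    rw [hR, Submodule.mem_sInf] at hv ⊢
    exact fun p hp => hp.1 i hi v (hv p hp)
  have hRsub : ∀ i, i < N - 2 → ∀ v, S i v - S 0 v ∈ R := fun i hi v => by
    rw [hR, Submodule.mem_sInf]
    exact fun p hp => hp.2 i hi v
  have hcomm : ∀ i, i < N - 2 → ∀ v, T 0 (S i v) = S i (T 0 v) := fun i hi v =>
    LinearMap.congr_fun (h.comm 0 (i + 2) (by omega) (by omega)) v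
  have hRT : ∀ v ∈ R, T 0 v ∈ R := by
    have : R ≤ R.comap (T 0) := sInf_le ⟨fun i hi v hv => by
      rw [Submodule.mem_comap] at hv ⊢
      rw [hcomm i hi]
      exact hRst i hi _ hv, fun i hi v => by
      rw [Submodule.mem_comap, map_sub, hcomm i hi, hcomm 0 (by omega)]
      exact hRsub i hi _⟩
    exact this
  have key : ∃ μ : K, (∃ v, v ≠ 0 ∧ T 0 v = μ • v) ∧
      ∀ i, i < N - 2 → (S i - S 0) * (T 0 - algebraMap K (End K V) μ) = 0 := by
    by_cases hbot : R = ⊥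
    · obtain ⟨μ, hμ⟩ := End.exists_eigenvalue (T 0)
      obtain ⟨v, hv⟩ := hμ.exists_hasEigenvector
      refine ⟨μ, ⟨v, hv.2, hv.apply_eq_smul⟩, fun i hi => LinearMap.ext fun x => ?_⟩
      have := hRsub i hi ((T 0 - algebraMap K (End K V) μ) x)
      rw [hbot, Submodule.mem_bot] at this
      exact this
    have : Nontrivial R := Submodule.nontrivial_iff_ne_bot.2 hbot
    obtain ⟨μ, hμ⟩ := End.exists_eigenvalue ((T 0).restrict hRT)
    obtain ⟨v, hv⟩ := hμ.exists_hasEigenvector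
    have hv1 : T 0 v = μ • (v : V) := congrArg Subtype.val hv.apply_eq_smul
    have hv2 : (v : V) ≠ 0 := fun h0 => hv.2 (Subtype.ext h0)
    set A := T 0 - algebraMap K (End K V) μ with hA
    have hAv : A v = 0 := by simp [hA, hv1]
    have hAc : ∀ i, i < N - 2 → A * S i = S i * A := fun i hi => by
      rw [hA, sub_mul, mul_sub, Algebra.commutes]
      congr 1
      exact h.comm 0 (i + 2) (by omega) (by omega)
    refine ⟨μ, ⟨v, hv2, hv1⟩, hS.commute_family_range (by omega) hAc fun i j k l hi hj hk hl => ?_⟩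
    set Q := R.map A with hQ
    have hQst : IsStable (N - 2) S Q := by
      rintro i hi _ ⟨w, hw, rfl⟩
      exact ⟨S i w, hRst i hi w hw, LinearMap.congr_fun (hAc i hi) w⟩
    have hQR : Q ≤ R := by
      rintro _ ⟨w, hw, rfl⟩
      simp only [hA, LinearMap.sub_apply, algebraMap_end_apply]
      exact R.sub_mem (hRT w hw) (R.smul_mem μ hw)
    have hQlt : finrank K Q < finrank K R := by
      have h1 : finrank K Q + finrank K (LinearMap.ker (A.domRestrict R)) = finrank K R := by
        rw [hQ, ← LinearMap.range_domRestrict]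
        exact (A.domRestrict R).finrank_range_add_finrank_ker
      have h2 : 0 < finrank K (LinearMap.ker (A.domRestrict R)) := by
        rw [Module.finrank_pos_iff]
        exact Submodule.nontrivial_iff_ne_bot.2
          ((Submodule.ne_bot_iff _).2 ⟨v, by simpa using hAv, hv.2⟩)
      omega
    have hbig : finrank K Q + d < finrank K R := by
      by_contra hcon
      have h1 : ∀ i, i < N - 2 → ∀ v ∈ R, S i v - S 0 v ∈ Q := fun i hi v hv =>
        hS.sub_mem_of_subquotient hd hRst hQst hQR (by omega) hi hv
      have h2 : R ≤ Q := sInf_le ⟨hQst, fun i hi v =>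
        hS.sub_mem_of_sub_mul_sub (by omega) hQst (fun i j k l hi hj hk hl v => by
          have e1 : (S k - S l) v ∈ R := by
            rw [LinearMap.sub_apply, ← sub_sub_sub_cancel_right _ _ (S 0 v)]
            exact R.sub_mem (hRsub k hk v) (hRsub l hl v)
          rw [LinearMap.sub_apply, ← sub_sub_sub_cancel_right _ _ (S 0 _)]
          exact Q.sub_mem (h1 i hi _ e1) (h1 j hj _ e1)) hi v⟩
      have := Submodule.finrank_mono h2
      omega
    have hQ0 : ∀ i, i < N - 2 → ∀ v ∈ Q, S i v = S 0 v := fun i hi v hv => by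
      have h1 := R.finrank_le
      have := hS.sub_mem_of_subquotient hd hQst (q := ⊥)
        (fun i hi v hv => by rw [Submodule.mem_bot] at hv ⊢; rw [hv, map_zero]) bot_le
        (by rw [finrank_bot]; omega) hi hv
      rwa [Submodule.mem_bot, sub_eq_zero] at this
    refine LinearMap.ext fun x => ?_
    have e1 : (S k - S l) x ∈ R := by
      rw [LinearMap.sub_apply, ← sub_sub_sub_cancel_right _ _ (S 0 x)]
      exact R.sub_mem (hRsub k hk x) (hRsub l hl x)
    have e2 : A ((S k - S l) x) ∈ Q := ⟨_, e1, rfl⟩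
    rw [End.mul_apply, End.mul_apply, LinearMap.sub_apply (S i), hQ0 i hi _ e2, hQ0 j hj _ e2,
      sub_self, LinearMap.zero_apply]
  obtain ⟨μ, hμ, hall⟩ := key
  refine ⟨μ, hμ, fun i hi hiN => ?_⟩
  have := hall (i - 2) (by omega)
  simpa only [hSdef, show i - 2 + 2 = i by omega, zero_add] using this

end Linear

section Unipotent

variable {K : Type*} {V : Type u} [Field K] [AddCommGroup V] [Module K V]
  [FiniteDimensional K V] {N : ℕ} {T : ℕ → End K V}

theorem shift_sub {R : Type*} [Ring R] {s : Rˣ} {a b c : R} (h : s * a = b * s)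
    (hc : s * c = c * s) : s * (a - c) = (b - c) * s := by
  rw [mul_sub, sub_mul, h, hc]

/-- In an irreducible family satisfying the conclusion of `exists_eigenvalue_constant_on_range`,
the operators `T i - μ` attached to far generators annihilate each other. -/
theorem mul_eq_zero_of_constant_on_range (h : IsBraidFamily N T) (hN : 4 ≤ N)
    (hirr : IsIrreducibleFamily N T) {μ : K} {v : V} (hv : v ≠ 0) (hμ : T 0 v = μ • v)
    (h0 : ∀ i, 2 ≤ i → i < N → (T i - T 2) * (T 0 - algebraMap K (End K V) μ) = 0)
    {i j : ℕ} (hij : i + 2 ≤ j) (hj : j < N) :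
    (T i - algebraMap K (End K V) μ) * (T j - algebraMap K (End K V) μ) = 0 := by
  set c := algebraMap K (End K V) μ with hc
  have hcomm : ∀ a : End K V, a * c = c * a := fun a => (Algebra.commutes μ a).symm
  set A : ℕ → End K V := fun i => T i - c with hA
  have hAA : ∀ i j, i + 2 ≤ j → j < N → A i * A j = A j * A i := fun i j hij hj => by
    simp only [hA, mul_sub, sub_mul, hcomm, h.comm i j hij hj]
    abel
  have h2 : ∀ i, 2 ≤ i → i < N → A i * A 0 = A 2 * A 0 := fun i hi hiN => by
    rw [← sub_eq_zero, ← sub_mul]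
    simpa [hA] using h0 i hi hiN
  obtain ⟨s, hs, hss⟩ := h.exists_shift
  have hsA : ∀ i, i + 1 < N → s * A i = A (i + 1) * s := fun i hi =>
    shift_sub (hs i hi) (hcomm _)
  have hs2 : ∀ i, i + 2 < N → (s * s : Units _) * A i = A (i + 2) * (s * s : Units _) :=
    fun i hi => by
      rw [Units.val_mul, mul_assoc, hsA i (by omega), ← mul_assoc, hsA (i + 1) hi, mul_assoc]
  have hs3 : (s * s : Units _) * A (N - 1) = A 0 * (s * s : Units _) :=
    shift_sub (hss (by omega)) (hcomm _)
  have hback : ∀ t i, i + 2 + t + 1 ≤ N → A i * A (N - 1 - t) = A 0 * A (N - 1 - t) := by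
    intro t
    induction t with
    | zero =>
      intro i hi
      rw [← (s * s).mul_right_inj, ← mul_assoc, ← mul_assoc, hs2 i (by omega), hs2 0 (by omega),
        mul_assoc, mul_assoc, Nat.sub_zero, hs3, ← mul_assoc, ← mul_assoc,
        h2 _ (by omega) (by omega)]
    | succ t ih =>
      intro i hi
      have e : N - 1 - (t + 1) + 1 = N - 1 - t := by omega
      rw [← s.mul_right_inj, ← mul_assoc, ← mul_assoc, hsA i (by omega), hsA 0 (by omega),
        mul_assoc, mul_assoc, hsA _ (by omega), e, ← mul_assoc, ← mul_assoc, ih _ (by omega),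
        ih 1 (by omega)]
  have hall : ∀ i j, i + 2 ≤ j → j < N → A i * A j = A 2 * A 0 := fun i j hij hj => by
    have e := hback (N - 1 - j) i (by omega)
    rw [show N - 1 - (N - 1 - j) = j by omega] at e
    rw [e, hAA 0 j (by omega) hj, h2 j (by omega) hj]
  have hTA : ∀ i j, i < N → j < N → i + 1 ≠ j → j + 1 ≠ i → T i * A j = A j * T i :=
    fun i j hi hj h1 h2 => by
      simp only [hA, mul_sub, sub_mul, hcomm, h.comm_of_ne hi hj h1 h2]
  have hB : ∀ k, k < N → T k * (A 2 * A 0) = (A 2 * A 0) * T k := fun k hk => by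
    rcases Nat.lt_or_ge k 2 with hk2 | hk2
    · rw [← hall k (N - 1) (by omega) (by omega), ← mul_assoc,
        hTA k k hk hk (by omega) (by omega), mul_assoc,
        hTA k (N - 1) hk (by omega) (by omega) (by omega), mul_assoc]
    · rw [← h2 k hk2 hk, ← mul_assoc, hTA k k hk hk (by omega) (by omega), mul_assoc,
        hTA k 0 hk (by omega) (by omega) (by omega), mul_assoc]
  change A i * A j = 0
  rw [hall i j hij hj]
  have hker : (A 2 * A 0) v = 0 := by simp [hA, hc, hμ]
  have hst : IsStable N T (LinearMap.range (A 2 * A 0)) := by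
    rintro k hk _ ⟨w, rfl⟩
    exact ⟨T k w, (LinearMap.congr_fun (hB k hk) w).symm⟩
  rcases hirr _ hst with hbot | htop
  · exact LinearMap.range_eq_bot.1 hbot
  · have := (LinearMap.isUnit_iff_ker_eq_bot _).1
      ((LinearMap.isUnit_iff_range_eq_top _).2 htop)
    exact absurd (LinearMap.ker_eq_bot'.1 this v hker) hv

/-- After rescaling, far generators of an irreducible family of small dimension have mutually
annihilating differences with the identity. -/
theorem exists_smul_far_mul_eq_zero [IsAlgClosed K] [Nontrivial V] (h : IsBraidFamily N T)
    (hN : 6 ≤ N) {d : ℕ} (hd : ConstantUpTo.{u} K (N - 2) d) (hdim : finrank K V ≤ 2 * d + 1)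
    (hirr : IsIrreducibleFamily N T) :
    ∃ μ : K, μ ≠ 0 ∧ ∀ i j, i + 2 ≤ j → j < N →
      (μ⁻¹ • T i - 1) * (μ⁻¹ • T j - 1) = 0 := by
  obtain ⟨μ, ⟨v, hv, hμv⟩, h0⟩ := h.exists_eigenvalue_constant_on_range hN hd hdim
  have hμ : μ ≠ 0 := by
    rintro rfl
    rw [zero_smul] at hμv
    exact hv (LinearMap.ker_eq_bot'.1
      ((LinearMap.isUnit_iff_ker_eq_bot _).1 (h.isUnit 0 (by omega))) v hμv)
  refine ⟨μ, hμ, fun i j hij hj => ?_⟩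
  have e : ∀ i, μ⁻¹ • T i - 1 = μ⁻¹ • (T i - algebraMap K (End K V) μ) := fun i => by
    rw [smul_sub, Algebra.algebraMap_eq_smul_one, smul_smul, inv_mul_cancel₀ hμ, one_smul]
  rw [e, e, smul_mul_smul_comm,
    h.mul_eq_zero_of_constant_on_range (by omega) hirr hv hμv h0 hij hj, smul_zero]

theorem finrank_range_of_shift {s : (End K V)ˣ} {f g : End K V} (h : s * f = g * s) :
    finrank K (LinearMap.range f) = finrank K (LinearMap.range g) := by
  have hs := (LinearMap.isUnit_iff_range_eq_top _).1 s.isUnit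
  have hk := (LinearMap.isUnit_iff_ker_eq_bot _).1 s.isUnit
  have h1 : LinearMap.range (s * f : End K V) = (LinearMap.range f).map (s : End K V) :=
    LinearMap.range_comp _ _
  have h2 : LinearMap.range (g * s : End K V) = LinearMap.range g :=
    LinearMap.range_comp_of_range_eq_top _ hs
  rw [← h2, ← h, h1]
  exact (Submodule.equivMapOfInjective _ (LinearMap.ker_eq_bot.1 hk) _).finrank_eq

theorem exists_swap {R : Type*} [Ring R] {T : ℕ → R} (h : IsBraidFamily N T) {i : ℕ}
    (hi : i + 1 < N) : ∃ D : Rˣ, D * T i = T (i + 1) * D ∧ D * T (i + 1) = T i * D := by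
  obtain ⟨D, hD⟩ := ((h.isUnit i (by omega)).mul (h.isUnit (i + 1) hi)).mul (h.isUnit i (by omega))
  refine ⟨D, ?_, ?_⟩
  · conv_rhs => rw [hD, ← mul_assoc, ← mul_assoc, ← h.braid i hi]
    rw [hD]
  · rw [hD, mul_assoc, mul_assoc, ← mul_assoc (T (i + 1)), ← h.braid i hi]

theorem eq_of_mul_eq_zero {R : Type*} [Ring R] {T : ℕ → R} (h : IsBraidFamily N T) {i : ℕ}
    (hi : i + 1 < N) (h0 : (T (i + 1) - 1) * (T i - 1) = 0) : T i = T (i + 1) := by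
  obtain ⟨D, h1, h2⟩ := h.exists_swap hi
  have h3 : (T i - 1) * (T (i + 1) - 1) = 0 := by
    rw [← D.mul_left_inj, zero_mul, mul_assoc, ← shift_sub h1 (by simp), ← mul_assoc,
      ← shift_sub h2 (by simp), mul_assoc, h0, mul_zero]
  refine h.eq_of_commute hi ?_
  have e : ∀ a b : R, a * b = (a - 1) * (b - 1) + (a + b - 1) := fun a b => by noncomm_ring
  rw [e, e (T (i + 1)), h0, h3, add_comm (T i)]

theorem mul_le_finrank (h : IsBraidFamily N T)
    (hfar : ∀ i j, i + 2 ≤ j → j < N → (T i - 1) * (T j - 1) = 0) {k : ℕ} (hk : k + 1 ≤ N) :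
    finrank K (LinearMap.range ((T 1 - 1) * (T 0 - 1))) * k ≤
      finrank K ((Finset.range k).sup fun i => LinearMap.range (T i - 1) : Submodule K V) := by
  obtain ⟨s, hs, -⟩ := h.exists_shift
  have hr : ∀ i, i + 1 < N → finrank K (LinearMap.range ((T (i + 1) - 1) * (T i - 1))) =
      finrank K (LinearMap.range ((T 1 - 1) * (T 0 - 1))) := by
    intro i hi
    induction i with
    | zero => rfl
    | succ i ih =>
      rw [← ih (by omega)]
      refine (finrank_range_of_shift (s := s) ?_).symm
      rw [← mul_assoc, shift_sub (hs _ hi) (by simp), mul_assoc,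
        shift_sub (hs i (by omega)) (by simp), mul_assoc]
  have hfar' : ∀ i j, i + 2 ≤ j → j < N → (T j - 1) * (T i - 1) = 0 := fun i j hij hj => by
    rw [← hfar i j hij hj]
    simp only [mul_sub, sub_mul, h.comm i j hij hj, mul_one, one_mul]
    abel
  induction k with
  | zero => simp
  | succ k ih =>
    set U := (Finset.range k).sup fun i => LinearMap.range (T i - 1) with hU
    have hU' : ((Finset.range (k + 1)).sup fun i => LinearMap.range (T i - 1)) =
        LinearMap.range (T k - 1) ⊔ U := by
      rw [Finset.range_add_one, Finset.sup_insert]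
    rw [hU']
    set W := LinearMap.range (T k - 1) ⊔ U with hW
    have h1 := ((T (k + 1) - 1).domRestrict W).finrank_range_add_finrank_ker
    have h2 : LinearMap.range ((T (k + 1) - 1) * (T k - 1)) ≤
        LinearMap.range ((T (k + 1) - 1).domRestrict W) := by
      rintro _ ⟨x, rfl⟩
      exact ⟨⟨(T k - 1) x, Submodule.mem_sup_left ⟨x, rfl⟩⟩, rfl⟩
    have hUker : U ≤ LinearMap.ker (T (k + 1) - 1) := by
      refine Finset.sup_le fun i hi => ?_
      rintro _ ⟨x, rfl⟩
      rw [Finset.mem_range] at hi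
      exact LinearMap.congr_fun (hfar' i (k + 1) (by omega) (by omega)) x
    have h3 : U.comap W.subtype ≤ LinearMap.ker ((T (k + 1) - 1).domRestrict W) :=
      fun x hx => hUker hx
    have h4 : finrank K (U.comap W.subtype) = finrank K U :=
      (Submodule.comapSubtypeEquivOfLe le_sup_right).finrank_eq
    have h5 := Submodule.finrank_mono h2
    have h6 := Submodule.finrank_mono h3
    rw [hr k (by omega)] at h5
    have := ih (by omega)
    rw [mul_add, mul_one]
    omega

theorem all_eq_of_finrank_le_two (h : IsBraidFamily N T) (hN : 4 ≤ N) (hV : finrank K V ≤ 2) :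
    ∀ j, j < N → T j = T 0 := by
  by_cases hli : ∃ v, LinearIndependent K ![v, T 0 v]
  · obtain ⟨v, hli⟩ := hli
    have hcard := hli.fintype_card_le_finrank
    rw [Fintype.card_fin] at hcard
    have htop := hli.span_eq_top_of_card_eq_finrank (by rw [Fintype.card_fin]; omega)
    rw [Matrix.range_cons, Matrix.range_cons, Matrix.range_empty, Set.union_empty,
      Set.singleton_union] at htop
    have hex : ∀ f : End K V, T 0 * f = f * T 0 → ∃ x y : K, f = x • 1 + y • T 0 := by
      intro f hf
      obtain ⟨x, y, hxy⟩ := Submodule.mem_span_pair.1 (htop ▸ Submodule.mem_top : f v ∈ _)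
      refine ⟨x, y, LinearMap.ext_on htop fun w hw => ?_⟩
      rcases hw with rfl | rfl
      · simp [hxy]
      · have := LinearMap.congr_fun hf v
        simp only [End.mul_apply] at this
        rw [← this, ← hxy]
        simp
    obtain ⟨x, y, h2⟩ := hex (T 2) (h.comm 0 2 (by omega) (by omega))
    obtain ⟨x', y', h3⟩ := hex (T 3) (h.comm 0 3 (by omega) (by omega))
    refine h.all_eq_of_eq (i := 2) (by omega) (h.eq_of_commute (by omega) ?_)
    rw [show 2 + 1 = 3 from rfl, h2, h3]
    simp only [add_mul, mul_add, smul_mul_assoc, mul_smul_comm, one_mul, mul_one, smul_add,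
      smul_smul, mul_comm]
    abel
  · push Not at hli
    obtain ⟨a, ha⟩ := LinearMap.exists_eq_smul_id_of_forall_notLinearIndependent hli
    refine h.all_eq_of_eq (i := 0) (by omega) (h.eq_of_commute (by omega) ?_)
    rw [ha, smul_mul_assoc, mul_smul_comm, one_mul, mul_one]

theorem constantUpTo_of_irreducible {d : ℕ} (hN : 4 ≤ N)
    (hirr : ∀ (W : Type u) [AddCommGroup W] [Module K W] [FiniteDimensional K W] [Nontrivial W]
      (S : ℕ → End K W), finrank K W ≤ d → IsBraidFamily N S → IsIrreducibleFamily N S →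
      ∀ j, j < N → S j = S 0) : ConstantUpTo.{u} K N d := by
  induction d with
  | zero =>
    intro W _ _ _ S hd hS j hj
    have := Module.finrank_zero_iff.1 (Nat.le_zero.1 hd)
    exact Subsingleton.elim _ _
  | succ d ih =>
    have ih' := ih fun W _ _ _ _ S hW => hirr W S (by omega)
    intro W _ _ _ S hd hS j hj
    rcases subsingleton_or_nontrivial W with hW | hW
    · exact Subsingleton.elim _ _
    by_cases hI : IsIrreducibleFamily N S
    · exact hirr W S hd hS hI j hj
    simp only [IsIrreducibleFamily, not_forall, not_or] at hI
    obtain ⟨p, hp, hbot, htop⟩ := hI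
    have hlt := Submodule.finrank_lt htop
    have hpos : 0 < finrank K p := by
      rw [Module.finrank_pos_iff]
      exact Submodule.nontrivial_iff_ne_bot.2 hbot
    have hstb : IsStable N S ⊥ := fun i hi v hv => by
      rw [Submodule.mem_bot] at hv ⊢
      rw [hv, map_zero]
    have hstt : IsStable N S ⊤ := fun _ _ _ _ => Submodule.mem_top
    have h1 : ∀ i, i < N → ∀ v, S i v - S 0 v ∈ p := fun i hi v =>
      hS.sub_mem_of_subquotient ih' hstt hp le_top (by rw [finrank_top]; omega) hi
        Submodule.mem_top
    have h2 : ∀ i, i < N → ∀ v ∈ p, S i v = S 0 v := fun i hi v hv => by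
      have := hS.sub_mem_of_subquotient ih' hp hstb bot_le (by rw [finrank_bot]; omega) hi hv
      rwa [Submodule.mem_bot, sub_eq_zero] at this
    refine hS.all_eq_of_sub_mul_sub hN (fun i j k l hi hj hk hl => LinearMap.ext fun v => ?_) j hj
    have e1 : (S k - S l) v ∈ p := by
      rw [LinearMap.sub_apply, ← sub_sub_sub_cancel_right _ _ (S 0 v)]
      exact p.sub_mem (h1 k hk v) (h1 l hl v)
    rw [End.mul_apply, LinearMap.sub_apply, h2 i hi _ e1, h2 j hj _ e1, sub_self,
      LinearMap.zero_apply]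

/-- Braid families with `N` generators of small dimension are constant. -/
theorem constantUpTo (K : Type*) [Field K] [IsAlgClosed K] (N d : ℕ)
    (hNd : (4 ≤ N ∧ d ≤ 2) ∨ (6 ≤ N ∧ d + 2 ≤ N)) : ConstantUpTo.{u} K N d := by
  induction N using Nat.strong_induction_on generalizing d with
  | _ N ih =>
  rcases hNd with ⟨hN, hd⟩ | ⟨hN, hd⟩
  · intro W _ _ _ S hW hS
    exact hS.all_eq_of_finrank_le_two hN (hW.trans hd)
  · refine constantUpTo_of_irreducible (by omega) fun W _ _ _ _ S hW hS hirr => ?_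
    obtain ⟨μ, hμ, hfar⟩ := hS.exists_smul_far_mul_eq_zero hN
      (ih (N - 2) (by omega) (d / 2) (by omega)) (by omega) hirr
    have hS' := hS.smul (inv_ne_zero hμ)
    have h1 := hS'.mul_le_finrank hfar (k := N - 1) (by omega)
    have h2 := Submodule.finrank_le
      ((Finset.range (N - 1)).sup fun i => LinearMap.range (μ⁻¹ • S i - 1))
    have h3 : finrank K (LinearMap.range ((μ⁻¹ • S 1 - 1) * (μ⁻¹ • S 0 - 1))) = 0 := by
      by_contra hne
      have := Nat.le_mul_of_pos_left (N - 1) (Nat.pos_of_ne_zero hne)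
      omega
    have h4 := hS'.eq_of_mul_eq_zero (i := 0) (by omega)
      (LinearMap.range_eq_bot.1 (Submodule.finrank_eq_zero.1 h3))
    intro j hj
    exact smul_right_injective _ (inv_ne_zero hμ) (hS'.all_eq_of_eq (i := 0) (by omega) h4 j hj)

end Unipotent

end IsBraidFamily

open Module in
/-- An irreducible, nonconstant braid family `T` in which the operators `T i - 1` attached to
far generators annihilate each other. -/
structure IsFarOrthogonal {K V : Type*} [Field K] [AddCommGroup V] [Module K V] (N : ℕ)
    (T : ℕ → End K V) : Prop extends IsBraidFamily N T where
  far : ∀ i j, i + 2 ≤ j → j < N → (T i - 1) * (T j - 1) = 0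
  irreducible : IsBraidFamily.IsIrreducibleFamily N T
  ne : T 0 ≠ T 1

namespace IsFarOrthogonal

open Module LinearMap

variable {K V : Type*} [Field K] [AddCommGroup V] [Module K V] {N : ℕ} {T : ℕ → End K V}

theorem far_apply (h : IsFarOrthogonal N T) {i j : ℕ} (hi : i < N) (hj : j < N)
    (hij : i + 2 ≤ j ∨ j + 2 ≤ i) {v : V} (hv : v ∈ range (T j - 1)) : (T i - 1) v = 0 := by
  obtain ⟨x, rfl⟩ := hv
  refine LinearMap.congr_fun (?_ : (T i - 1) * (T j - 1) = 0) x
  rcases hij with hij | hij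
  · exact h.far i j hij hj
  · rw [← h.far j i hij hi]
    simp only [mul_sub, sub_mul, h.comm j i hij hi, mul_one, one_mul]
    abel

theorem eq_zero_of_forall (h : IsFarOrthogonal N T) (hN : 2 ≤ N) {v : V}
    (hv : ∀ j, j < N → (T j - 1) v = 0) : v = 0 := by
  let p : Submodule K V := ⨅ j : Fin N, ker (T j - 1)
  have hp : ∀ w, w ∈ p ↔ ∀ j, j < N → (T j - 1) w = 0 := fun w => by
    simp only [p, Submodule.mem_iInf, mem_ker]
    exact ⟨fun H j hj => H ⟨j, hj⟩, fun H j => H j j.2⟩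
  have hst : IsBraidFamily.IsStable N T p := fun i hi w hw => by
    have := (hp w).1 hw i hi
    rw [LinearMap.sub_apply, End.one_apply, sub_eq_zero] at this
    rwa [this]
  rcases h.irreducible p hst with hbot | htop
  · rw [← Submodule.mem_bot K, ← hbot, hp]
    exact hv
  · refine absurd (LinearMap.ext fun w => ?_) h.ne
    have hw : w ∈ p := htop ▸ Submodule.mem_top
    exact sub_left_injective (((hp w).1 hw 0 (by omega)).trans ((hp w).1 hw 1 (by omega)).symm)

theorem apply_mem_range (h : IsFarOrthogonal N T) {i j : ℕ} (hi : i < N) (hj : j < N)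
    (hij : i + 1 = j ∨ j + 1 = i) {v : V} (hv : v ∈ range (T i - 1)) (h0 : (T j - 1) v = 0) :
    T i v ∈ range (T j - 1) := by
  have hb : T i * T j * T i = T j * T i * T j := by
    rcases hij with rfl | rfl
    · exact h.braid i hj
    · exact (h.braid j hi).symm
  have hb' : T i * (T i - 1) + (T i - 1) * ((T j - 1) * (T i - 1)) =
      (T j - 1) * (T j + (T i - 1) * (T j - 1)) := by
    have e : T i * (T i - 1) + (T i - 1) * ((T j - 1) * (T i - 1)) -
      (T j - 1) * (T j + (T i - 1) * (T j - 1)) = T i * T j * T i - T j * T i * T j := by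
      noncomm_ring
    rwa [hb, sub_self, sub_eq_zero] at e
  obtain ⟨x, rfl⟩ := hv
  refine ⟨(T j + (T i - 1) * (T j - 1)) x, ?_⟩
  have := LinearMap.congr_fun hb' x
  simp only [End.mul_apply, LinearMap.add_apply, h0, map_zero, add_zero] at this ⊢
  exact this.symm

theorem eq_zero_of_mem_range (h : IsFarOrthogonal N T) (hN : 4 ≤ N) {i j : ℕ} (hij : i + 2 ≤ j)
    (hj : j < N) {v : V} (hi : v ∈ range (T i - 1)) (hv : v ∈ range (T j - 1)) : v = 0 := by
  have hi0 := h.far_apply (i := i) (by omega) hj (by omega) hv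
  have hj0 := h.far_apply hj (j := i) (by omega) (by omega) hi
  have hfix : ∀ {k}, (T k - 1) v = 0 → T k v = v := fun hk => sub_eq_zero.1 hk
  refine h.eq_zero_of_forall (by omega) fun k hk => ?_
  by_cases hki : k = i
  · rwa [hki]
  by_cases hkj : k = j
  · rwa [hkj]
  by_cases hki' : i + 2 ≤ k ∨ k + 2 ≤ i
  · exact h.far_apply hk (by omega) hki'.symm hi
  by_cases hkj' : j + 2 ≤ k ∨ k + 2 ≤ j
  · exact h.far_apply hk (by omega) hkj'.symm hv
  obtain rfl : k = i + 1 := by omega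
  obtain rfl : j = i + 2 := by omega
  by_cases hlt : i + 3 < N
  · have := h.apply_mem_range hj hlt (Or.inl rfl) hv (h.far_apply hlt (j := i) (by omega)
      (by omega) hi)
    rw [hfix hj0] at this
    exact h.far_apply hk hlt (by omega) this
  · have := h.apply_mem_range (i := i) (j := i - 1) (by omega) (by omega) (by omega) hi
      (h.far_apply (by omega) hj (by omega) hv)
    rw [hfix hi0] at this
    exact h.far_apply hk (j := i - 1) (by omega) (by omega) this

theorem finrank_range_mul [FiniteDimensional K V] (f g : End K V) :
    finrank K (range (f * g)) + finrank K (range g ⊓ ker f : Submodule K V) =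
      finrank K (range g) := by
  have h1 := (f.domRestrict (range g)).finrank_range_add_finrank_ker
  rw [range_domRestrict, ← range_comp, ker_domRestrict] at h1
  rw [← h1, ← Submodule.map_comap_subtype, Submodule.finrank_map_subtype_eq]
  rfl

theorem finrank_range_eq [FiniteDimensional K V] (h : IsFarOrthogonal N T) {i : ℕ} (hi : i < N) :
    finrank K (range (T i - 1)) = finrank K (range (T 0 - 1)) := by
  obtain ⟨s, hs, -⟩ := h.exists_shift
  induction i with
  | zero => rfl
  | succ i ih =>
    rw [← ih (by omega)]
    exact (IsBraidFamily.finrank_range_of_shift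
      (IsBraidFamily.shift_sub (hs i hi) (by simp))).symm

theorem iSup_range_eq_top (h : IsFarOrthogonal N T) (hN : 2 ≤ N) :
    (⨆ i : Fin N, range (T i - 1)) = ⊤ := by
  have hst : IsBraidFamily.IsStable N T (⨆ i : Fin N, range (T i - 1)) := fun i hi v hv => by
    rw [← sub_add_cancel (T i v) v]
    exact add_mem (Submodule.mem_iSup_of_mem ⟨i, hi⟩ ⟨v, rfl⟩) hv
  refine (h.irreducible _ hst).resolve_left fun hbot => h.ne ?_
  have h0 : ∀ i, i < N → T i - 1 = 0 := fun i hi => by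
    rw [← range_eq_bot, ← le_bot_iff, ← hbot]
    exact le_iSup (fun i : Fin N => range (T i - 1)) ⟨i, hi⟩
  exact sub_left_injective ((h0 0 (by omega)).trans (h0 1 (by omega)).symm)

theorem two_le_finrank_range [FiniteDimensional K V] (h : IsFarOrthogonal N T) (hN : 2 ≤ N)
    (hV : N < finrank K V) : 2 ≤ finrank K (range (T 0 - 1)) := by
  have h1 : finrank K (⨆ i : Fin N, range (T i - 1) : Submodule K V) ≤
      ∑ i : Fin N, finrank K (range (T i - 1)) := by
    rw [← Finset.sup_univ_eq_iSup]
    induction (Finset.univ : Finset (Fin N)) using Finset.induction_on with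
    | empty => simp
    | insert a t ha ih =>
      rw [Finset.sup_insert, Finset.sum_insert ha]
      exact (Submodule.finrank_add_le_finrank_add_finrank _ _).trans (by omega)
  rw [h.iSup_range_eq_top hN, finrank_top, Finset.sum_congr rfl fun i _ => h.finrank_range_eq i.2,
    Finset.sum_const, Finset.card_univ, Fintype.card_fin, smul_eq_mul] at h1
  by_contra hlt
  have : N * finrank K (range (T 0 - 1)) ≤ N * 1 := Nat.mul_le_mul_left _ (by omega)
  omega

/-- In dimension `N + 1` the operators `T i - 1` have rank two, and one finds vectors in the
range of one of them that are killed by a neighbour. -/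
theorem finrank_range_eq_two [FiniteDimensional K V] (h : IsFarOrthogonal N T) (hN : 4 ≤ N)
    (hV : finrank K V = N + 1) :
    finrank K (range (T 0 - 1)) = 2 ∧ ∃ w ∈ range (T 1 - 1), w ≠ 0 ∧ (T 0 - 1) w = 0 := by
  obtain ⟨s, hs, -⟩ := h.exists_shift
  have hs1 : ∀ i, i + 1 < N → s * (T i - 1) = (T (i + 1) - 1) * s := fun i hi =>
    IsBraidFamily.shift_sub (hs i hi) (by simp)
  have hone : finrank K (range ((T 1 - 1) * (T 0 - 1))) ≤ 1 := by
    have h1 := h.mul_le_finrank h.far (k := N - 1) (by omega)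
    have h2 := Submodule.finrank_le
      ((Finset.range (N - 1)).sup fun i => range (T i - 1) : Submodule K V)
    by_contra hlt
    have : 2 * (N - 1) ≤ finrank K (range ((T 1 - 1) * (T 0 - 1))) * (N - 1) :=
      Nat.mul_le_mul_right _ (by omega)
    omega
  have h01 : finrank K (range ((T 1 - 1) * (T 0 - 1))) =
      finrank K (range ((T 0 - 1) * (T 1 - 1))) := by
    obtain ⟨D, hD, hD'⟩ := h.exists_swap (i := 0) (by omega)
    refine IsBraidFamily.finrank_range_of_shift (s := D) ?_
    rw [← mul_assoc, IsBraidFamily.shift_sub hD' (by simp), mul_assoc,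
      IsBraidFamily.shift_sub hD (by simp), mul_assoc]
  have h12 : finrank K (range ((T 1 - 1) * (T 0 - 1))) =
      finrank K (range ((T 2 - 1) * (T 1 - 1))) := by
    refine IsBraidFamily.finrank_range_of_shift (s := s) ?_
    rw [← mul_assoc, hs1 1 (by omega), mul_assoc, hs1 0 (by omega), mul_assoc]
  have e0 := finrank_range_mul (T 0 - 1) (T 1 - 1)
  have e2 := finrank_range_mul (T 2 - 1) (T 1 - 1)
  have er := h.finrank_range_eq (i := 1) (by omega)
  have hr := h.two_le_finrank_range (by omega) (by omega)
  have hinf : (range (T 1 - 1) ⊓ ker (T 0 - 1)) ⊓ (range (T 1 - 1) ⊓ ker (T 2 - 1)) = ⊥ := by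
    rw [Submodule.eq_bot_iff]
    rintro v ⟨⟨hv, hv0⟩, -, hv2⟩
    have h1 := h.apply_mem_range (i := 1) (j := 0) (by omega) (by omega) (by omega) hv hv0
    have h2 := h.apply_mem_range (i := 1) (j := 2) (by omega) (by omega) (by omega) hv hv2
    have h3 := h.eq_zero_of_mem_range hN (i := 0) (j := 2) le_rfl (by omega) h1 h2
    exact ((End.isUnit_iff _).1 (h.isUnit 1 (by omega))).1 (h3.trans (map_zero _).symm)
  have hsup := Submodule.finrank_sup_add_finrank_inf_eq
    (range (T 1 - 1) ⊓ ker (T 0 - 1)) (range (T 1 - 1) ⊓ ker (T 2 - 1))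
  rw [hinf, finrank_bot] at hsup
  have hle := Submodule.finrank_mono
    (sup_le inf_le_left inf_le_left : (range (T 1 - 1) ⊓ ker (T 0 - 1)) ⊔
      (range (T 1 - 1) ⊓ ker (T 2 - 1)) ≤ range (T 1 - 1))
  refine ⟨by omega, ?_⟩
  have hpos : 0 < finrank K (range (T 1 - 1) ⊓ ker (T 0 - 1) : Submodule K V) := by omega
  rw [Module.finrank_pos_iff, Submodule.nontrivial_iff_ne_bot, Submodule.ne_bot_iff] at hpos
  obtain ⟨w, hw, hw0⟩ := hpos
  exact ⟨w, hw.1, hw0, hw.2⟩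

section Basis

variable [FiniteDimensional K V]

theorem exists_shift_vector (h : IsFarOrthogonal N T) (hN : 4 ≤ N) (hV : finrank K V = N + 1) :
    ∃ (s : (End K V)ˣ) (e : ℕ → V), (∀ i, i + 1 < N → s * T i = T (i + 1) * s) ∧
      (∀ i, e (i + 1) = (s : End K V) (e i)) ∧ e 0 ≠ 0 ∧ e 1 ∈ range (T 0 - 1) ∧
      ∀ i, i < N → e i ∈ range (T i - 1) := by
  obtain ⟨s, hs, -⟩ := h.exists_shift
  obtain ⟨-, w, hw, hw0, hw1⟩ := h.finrank_range_eq_two hN hV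
  have hs1 : ∀ i, i + 1 < N → s * (T i - 1) = (T (i + 1) - 1) * s := fun i hi =>
    IsBraidFamily.shift_sub (hs i hi) (by simp)
  have hinv : ∀ v, (s : End K V) (((s⁻¹ : (End K V)ˣ) : End K V) v) = v := fun v => by
    rw [← End.mul_apply, Units.mul_inv, End.one_apply]
  have hsr : ∀ i, i + 1 < N → ∀ v, v ∈ range (T i - 1) →
      (s : End K V) v ∈ range (T (i + 1) - 1) := by
    rintro i hi _ ⟨x, rfl⟩
    exact ⟨(s : End K V) x, (LinearMap.congr_fun (hs1 i hi) x).symm⟩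
  have hT1 : T 1 w ∈ range (T 1 - 1) := by
    rw [← sub_add_cancel (T 1 w) w]
    exact add_mem ⟨w, rfl⟩ hw
  refine ⟨s, fun i => ((s : End K V) ^ i) (((s⁻¹ : (End K V)ˣ) : End K V) (T 1 w)), hs,
    fun i => ?_, ?_, ?_, ?_⟩
  · beta_reduce
    rw [pow_succ', End.mul_apply]
  · intro h0
    beta_reduce at h0
    rw [pow_zero, End.one_apply] at h0
    have h1 := hinv (T 1 w)
    rw [h0, map_zero] at h1
    exact hw0 (((End.isUnit_iff _).1 (h.isUnit 1 (by omega))).1 (h1.symm.trans (map_zero _).symm))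
  · beta_reduce
    rw [pow_one, hinv]
    exact h.apply_mem_range (i := 1) (j := 0) (by omega) (by omega) (by omega) hw hw1
  · intro i hi
    induction i with
    | zero =>
      beta_reduce
      rw [pow_zero, End.one_apply]
      obtain ⟨x, hx⟩ := hT1
      refine ⟨((s⁻¹ : (End K V)ˣ) : End K V) x, ?_⟩
      have e1 := LinearMap.congr_fun (hs1 0 (by omega)) (((s⁻¹ : (End K V)ˣ) : End K V) x)
      rw [End.mul_apply, End.mul_apply, hinv, zero_add, hx] at e1
      rw [← e1, ← End.mul_apply (s⁻¹ : (End K V)ˣ).1 s.1, Units.inv_mul, End.one_apply]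
    | succ i ih =>
      beta_reduce
      rw [pow_succ', End.mul_apply]
      exact hsr i hi _ (ih (by omega))

/-- In dimension `N + 1` there is a basis in which each `T i` acts by one and the same
`2 × 2` block on the basis vectors `i` and `i + 1`, and fixes the others. -/
theorem exists_block_basis (h : IsFarOrthogonal N T) (hN : 4 ≤ N) (hV : finrank K V = N + 1) :
    ∃ (e : ℕ → V) (a b c d : K), LinearIndependent K (fun i : Fin (N + 1) => e i) ∧
      (∀ i, i < N → T i (e i) = a • e i + c • e (i + 1)) ∧
      (∀ i, i < N → T i (e (i + 1)) = b • e i + d • e (i + 1)) ∧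
      (∀ i j, i < N → j ≤ N → j ≠ i → j ≠ i + 1 → T i (e j) = e j) ∧
      (a - 1) * (d - 1) ≠ b * c := by
  obtain ⟨s, e, hs, hes, he0, he1, her⟩ := h.exists_shift_vector hN hV
  have hs1 : ∀ i, i + 1 < N → s * (T i - 1) = (T (i + 1) - 1) * s := fun i hi =>
    IsBraidFamily.shift_sub (hs i hi) (by simp)
  have hinv : ∀ v, (s : End K V) (((s⁻¹ : (End K V)ˣ) : End K V) v) = v := fun v => by
    rw [← End.mul_apply, Units.mul_inv, End.one_apply]
  have hsinj : ∀ v, (s : End K V) v = 0 → v = 0 := fun v hv =>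
    ((End.isUnit_iff _).1 s.isUnit).1 (hv.trans (map_zero _).symm)
  have hne : ∀ i, e i ≠ 0 := fun i => by
    induction i with
    | zero => exact he0
    | succ i ih => rw [hes]; exact fun h0 => ih (hsinj _ h0)
  have her' : ∀ i, i < N → e (i + 1) ∈ range (T i - 1) := fun i hi => by
    induction i with
    | zero => exact he1
    | succ i ih =>
      obtain ⟨x, hx⟩ := ih (by omega)
      refine ⟨(s : End K V) x, ?_⟩
      rw [hes, ← hx]
      exact (LinearMap.congr_fun (hs1 i hi) x).symm
  have hkill₁ : ∀ i, i + 1 < N → (T (i + 1) - 1) (e i) = 0 := fun i hi => by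
    induction i with
    | zero =>
      apply hsinj
      have e1 := LinearMap.congr_fun (hs1 1 (by omega)) (e 0)
      rw [End.mul_apply, End.mul_apply, ← hes] at e1
      rw [zero_add, e1]
      exact h.far_apply (by omega) (j := 0) (by omega) (by omega) he1
    | succ i ih =>
      have e1 := LinearMap.congr_fun (hs1 (i + 1) hi) (e i)
      rw [End.mul_apply, End.mul_apply, ← hes, ih (by omega), map_zero] at e1
      exact e1.symm
  have hkill₂ : ∀ i, i + 1 < N → (T i - 1) (e (i + 2)) = 0 := fun i hi => by
    induction i with
    | zero => exact h.far_apply (by omega) (j := 2) (by omega) (by omega) (her 2 (by omega))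
    | succ i ih =>
      have e1 := LinearMap.congr_fun (hs1 i (by omega)) (e (i + 2))
      rw [End.mul_apply, End.mul_apply, ← hes, ih (by omega), map_zero] at e1
      exact e1.symm
  have hkill : ∀ i j, i < N → j ≤ N → j ≠ i → j ≠ i + 1 → (T i - 1) (e j) = 0 := by
    intro i j hi hj h1 h2
    by_cases hji : j + 1 = i
    · subst hji
      exact hkill₁ j hi
    by_cases hij : j = i + 2
    · subst hij
      exact hkill₂ i (by omega)
    by_cases hlt : j < i
    · exact h.far_apply hi (j := j) (by omega) (by omega) (her j (by omega))
    · obtain ⟨k, rfl⟩ : ∃ k, j = k + 1 := ⟨j - 1, by omega⟩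
      exact h.far_apply hi (j := k) (by omega) (by omega) (her' k (by omega))
  have hli : LinearIndependent K ![e 0, e 1] := by
    rw [LinearIndependent.pair_iff' he0]
    intro c hc
    have hc0 : c ≠ 0 := fun h0 => hne 1 (by rw [← hc, h0, zero_smul])
    have h2 : e 2 = c • e 1 := by
      rw [hes 1]
      conv_lhs => rw [← hc, map_smul, ← hes]
    have h3 : e 1 ∈ range (T 2 - 1) := by
      have := her 2 (by omega)
      rw [h2] at this
      exact ((range (T 2 - 1)).smul_mem_iff hc0).1 this
    exact hne 1 (h.eq_zero_of_mem_range hN le_rfl (by omega) he1 h3)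
  have h2 := (h.finrank_range_eq_two hN hV).1
  have hspan : Submodule.span K {e 0, e 1} = range (T 0 - 1) := by
    refine Submodule.eq_of_le_of_finrank_eq (Submodule.span_le.2 ?_) ?_
    · rintro x (rfl | rfl)
      exacts [her 0 (by omega), he1]
    · have := finrank_span_eq_card hli
      rw [Matrix.range_cons, Matrix.range_cons, Matrix.range_empty, Set.union_empty,
        Set.singleton_union, Fintype.card_fin] at this
      rw [this, h2]
  have hpair : ∀ x, ∃ p q : K, (T 0 - 1) x = p • e 0 + q • e 1 := fun x => by
    have : (T 0 - 1) x ∈ Submodule.span K {e 0, e 1} := hspan ▸ ⟨x, rfl⟩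
    obtain ⟨p, q, hpq⟩ := Submodule.mem_span_pair.1 this
    exact ⟨p, q, hpq.symm⟩
  have hpair' : ∀ i, i < N → ∀ x, (T i - 1) x ∈ Submodule.span K {e i, e (i + 1)} := by
    intro i hi
    induction i with
    | zero =>
      intro x
      rw [hspan]
      exact ⟨x, rfl⟩
    | succ i ih =>
      intro x
      obtain ⟨p, q, hpq⟩ := Submodule.mem_span_pair.1
        (ih (by omega) (((s⁻¹ : (End K V)ˣ) : End K V) x))
      have e1 := LinearMap.congr_fun (hs1 i hi) (((s⁻¹ : (End K V)ˣ) : End K V) x)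
      rw [End.mul_apply, End.mul_apply, hinv, ← hpq, map_add, map_smul, map_smul, ← hes,
        ← hes] at e1
      exact Submodule.mem_span_pair.2 ⟨p, q, e1⟩
  have htop : ⊤ ≤ Submodule.span K (Set.range fun i : Fin (N + 1) => e i) := by
    rw [← h.iSup_range_eq_top (by omega)]
    refine iSup_le fun i => ?_
    rintro _ ⟨x, rfl⟩
    refine Submodule.span_mono ?_ (hpair' i i.2 x)
    rintro _ (rfl | rfl)
    exacts [⟨⟨i, by omega⟩, rfl⟩, ⟨⟨i + 1, by omega⟩, rfl⟩]
  have hlin := linearIndependent_of_top_le_span_of_card_eq_finrank htop (by simp [hV])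
  obtain ⟨p, c, hpc⟩ := hpair (e 0)
  obtain ⟨b, q, hbq⟩ := hpair (e 1)
  have hT0 : ∀ i, i < N → (T i - 1) (e i) = p • e i + c • e (i + 1) := fun i hi => by
    induction i with
    | zero => exact hpc
    | succ i ih =>
      have e1 := LinearMap.congr_fun (hs1 i hi) (e i)
      rw [End.mul_apply, End.mul_apply, ← hes, ih (by omega), map_add, map_smul, map_smul, ← hes,
        ← hes] at e1
      exact e1.symm
  have hT1 : ∀ i, i < N → (T i - 1) (e (i + 1)) = b • e i + q • e (i + 1) := fun i hi => by
    induction i with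
    | zero => exact hbq
    | succ i ih =>
      have e1 := LinearMap.congr_fun (hs1 i hi) (e (i + 1))
      rw [End.mul_apply, End.mul_apply, ← hes, ih (by omega), map_add, map_smul, map_smul, ← hes,
        ← hes] at e1
      exact e1.symm
  refine ⟨e, p + 1, b, c, q + 1, hlin, fun i hi => ?_, fun i hi => ?_,
    fun i j hi hj h1 h2 => ?_, ?_⟩
  · rw [← sub_add_cancel (T i (e i)) (e i), add_smul, one_smul, add_right_comm]
    exact congrArg (· + e i) (hT0 i hi)
  · rw [← sub_add_cancel (T i (e (i + 1))) (e (i + 1)), add_smul, one_smul, ← add_assoc]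
    exact congrArg (· + e (i + 1)) (hT1 i hi)
  · exact sub_eq_zero.1 (hkill i j hi hj h1 h2)
  · rw [add_sub_cancel_right, add_sub_cancel_right]
    intro hdet
    have hrange : range (T 0 - 1) = Submodule.span K {(T 0 - 1) (e 0), (T 0 - 1) (e 1)} := by
      rw [range_eq_map, ← top_le_iff.1 htop, Submodule.map_span, ← Set.range_comp]
      refine le_antisymm (Submodule.span_le.2 ?_) (Submodule.span_mono ?_)
      · rintro _ ⟨i, rfl⟩
        by_cases h0 : (i : ℕ) = 0
        · exact Submodule.subset_span (Or.inl (by simp [h0]))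
        by_cases h1 : (i : ℕ) = 1
        · exact Submodule.subset_span (Or.inr (by simp [h1]))
        · have := hkill 0 i (by omega) (by omega) h0 h1
          rw [Function.comp_apply, this]
          exact Submodule.zero_mem _
      · rintro _ (rfl | rfl)
        exacts [⟨0, rfl⟩, ⟨⟨1, by omega⟩, rfl⟩]
    have hli' : LinearIndependent K ![(T 0 - 1) (e 0), (T 0 - 1) (e 1)] := by
      rw [linearIndependent_iff_card_eq_finrank_span, Fintype.card_fin, Set.finrank,
        Matrix.range_cons, Matrix.range_cons, Matrix.range_empty, Set.union_empty,
        Set.singleton_union, ← hrange, h2]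
    rw [LinearIndependent.pair_iff, hpc, hbq] at hli'
    have z1 := hli' q (-c) (by
      have : q • (p • e 0 + c • e 1) + -c • (b • e 0 + q • e 1) = (p * q - b * c) • e 0 := by
        module
      rw [this, hdet, sub_self, zero_smul])
    have z2 := hli' b (-p) (by
      have : b • (p • e 0 + c • e 1) + -p • (b • e 0 + q • e 1) = (b * c - p * q) • e 1 := by
        module
      rw [this, hdet, sub_self, zero_smul])
    have z3 := hli' 1 0 (by rw [neg_eq_zero.1 z1.2, neg_eq_zero.1 z2.2]; simp)
    exact one_ne_zero z3.1

/-- In dimension `N + 1` the family is a specialization of the standard representation. -/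
theorem exists_standard_basis (h : IsFarOrthogonal N T) (hN : 4 ≤ N) (hV : finrank K V = N + 1) :
    ∃ (u : K) (f : ℕ → V), u ≠ 0 ∧ u ≠ 1 ∧
      LinearIndependent K (fun i : Fin (N + 1) => f i) ∧
      (∀ i, i < N → T i (f i) = f (i + 1)) ∧ (∀ i, i < N → T i (f (i + 1)) = u • f i) ∧
      (∀ i j, i < N → j ≤ N → j ≠ i → j ≠ i + 1 → T i (f j) = f j) := by
  obtain ⟨e, a, b, c, d, hlin, h1, h2, h3, hdet⟩ := h.exists_block_basis hN hV
  have hindep : ∀ x y z : K, x • e 0 + y • e 1 + z • e 2 = 0 → x = 0 ∧ y = 0 ∧ z = 0 := by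
    intro x y z hxyz
    have h3 := hlin.comp (Fin.castLE (by omega : 3 ≤ N + 1)) (Fin.castLE_injective _)
    have := Fintype.linearIndependent_iff.1 h3 ![x, y, z] (by
      simpa [Fin.sum_univ_three] using hxyz)
    exact ⟨this 0, this 1, this 2⟩
  have hinj : ∀ v, T 0 v = 0 → v = 0 := fun v hv =>
    ((End.isUnit_iff _).1 (h.isUnit 0 (by omega))).1 (hv.trans (map_zero _).symm)
  have t00 := h1 0 (by omega)
  have t01 := h2 0 (by omega)
  have t02 := h3 0 2 (by omega) (by omega) (by omega) (by omega)
  have t10 := h3 1 0 (by omega) (by omega) (by omega) (by omega)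
  have t11 := h1 1 (by omega)
  have t12 := h2 1 (by omega)
  simp only [zero_add, Nat.reduceAdd] at t00 t01 t11 t12
  have hb := h.braid 0 (by omega)
  have b0 := LinearMap.congr_fun hb (e 0)
  have b2 := LinearMap.congr_fun hb (e 2)
  simp only [End.mul_apply, zero_add, t00, t01, t02, t10, t11, t12, map_add, map_smul,
    smul_add] at b0 b2
  obtain ⟨q1, q2, -⟩ := hindep (a * a + a * b * c - a) (a * c * d) 0 (by
    rw [← sub_eq_zero] at b0
    rw [← b0]
    module)
  obtain ⟨-, q3, q4⟩ := hindep 0 (a * b * d) (d * d + b * c * d - d) (by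
    rw [← sub_eq_zero, ← neg_eq_zero] at b2
    rw [← b2]
    module)
  have hT : a * d ≠ b * c := fun had => by
    have z1 : d • e 0 - c • e 1 = 0 := hinj _ (by
      rw [map_sub, map_smul, map_smul, t00, t01]
      have : d • (a • e 0 + c • e 1) - c • (b • e 0 + d • e 1) = (a * d - b * c) • e 0 := by
        module
      rw [this, had, sub_self, zero_smul])
    have z2 : b • e 0 - a • e 1 = 0 := hinj _ (by
      rw [map_sub, map_smul, map_smul, t00, t01]
      have : b • (a • e 0 + c • e 1) - a • (b • e 0 + d • e 1) = -(a * d - b * c) • e 1 := by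
        module
      rw [this, had, sub_self, neg_zero, zero_smul])
    obtain ⟨-, y1, -⟩ := hindep d (-c) 0 (by rw [← z1]; module)
    obtain ⟨-, y2, -⟩ := hindep b (-a) 0 (by rw [← z2]; module)
    have z3 := hinj (e 0) (by rw [t00, neg_eq_zero.1 y1, neg_eq_zero.1 y2]; simp)
    exact one_ne_zero (hindep 1 0 0 (by rw [z3]; simp)).1
  obtain ⟨ha, hd, hbc⟩ : a = 0 ∧ d = 0 ∧ b * c ≠ 0 := by
    have hbc : b * c ≠ 0 := fun hbc => by
      have had : a * d ≠ 0 := hbc ▸ hT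
      have ha : a = 1 := by
        have : a * (a - 1) = 0 := by linear_combination q1 - a * hbc
        exact sub_eq_zero.1 ((mul_eq_zero.1 this).resolve_left (left_ne_zero_of_mul had))
      exact hdet (by rw [ha, hbc]; ring)
    have had : a * d = 0 := by
      have : c * (a * d) = 0 := by linear_combination q2
      exact (mul_eq_zero.1 this).resolve_left (right_ne_zero_of_mul hbc)
    by_cases ha : a = 0
    · refine ⟨ha, ?_, hbc⟩
      by_contra hd
      have : d + b * c - 1 = 0 := by
        refine (mul_eq_zero.1 (?_ : d * (d + b * c - 1) = 0)).resolve_left hd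
        linear_combination q4
      exact hdet (by rw [ha]; linear_combination -this)
    · have hd := (mul_eq_zero.1 had).resolve_left ha
      have : a + b * c - 1 = 0 := by
        refine (mul_eq_zero.1 (?_ : a * (a + b * c - 1) = 0)).resolve_left ha
        linear_combination q1
      exact absurd (by rw [hd]; linear_combination -this) hdet
  subst ha hd
  have hc : c ≠ 0 := right_ne_zero_of_mul hbc
  refine ⟨b * c, fun i => c ^ i • e i, hbc, fun h1 => hdet (by rw [h1]; ring), ?_, fun i hi => ?_,
    fun i hi => ?_, fun i j hi hj hji hji' => ?_⟩
  · exact hlin.units_smul fun i : Fin (N + 1) => Units.mk0 (c ^ (i : ℕ)) (pow_ne_zero _ hc)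
  · change T i (c ^ i • e i) = c ^ (i + 1) • e (i + 1)
    rw [map_smul, h1 i hi, zero_smul, zero_add, smul_smul, pow_succ]
  · change T i (c ^ (i + 1) • e (i + 1)) = (b * c) • c ^ i • e i
    rw [map_smul, h2 i hi, zero_smul, add_zero, smul_smul, smul_smul]
    ring_nf
  · rw [map_smul, h3 i j hi hj hji hji']

end Basis

end IsFarOrthogonal

open Module in
theorem IsBraidFamily.finrank_le_one_of_irreducible_of_eq {K V : Type*} [Field K] [IsAlgClosed K]
    [AddCommGroup V] [Module K V] [FiniteDimensional K V] [Nontrivial V] {N : ℕ} {T : ℕ → End K V}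
    (hirr : IsIrreducibleFamily N T) (heq : ∀ j, j < N → T j = T 0) : finrank K V ≤ 1 := by
  obtain ⟨μ, hμ⟩ := End.exists_eigenvalue (T 0)
  obtain ⟨v, hv⟩ := hμ.exists_hasEigenvector
  have hst : IsStable N T (Submodule.span K {v}) := fun i hi w hw => by
    obtain ⟨a, rfl⟩ := Submodule.mem_span_singleton.1 hw
    rw [heq i hi, map_smul, hv.apply_eq_smul]
    exact Submodule.smul_mem _ _ (Submodule.smul_mem _ _ (Submodule.mem_span_singleton_self v))
  rcases hirr _ hst with hbot | htop
  · exact absurd (Submodule.span_singleton_eq_bot.1 hbot) hv.2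
  · rw [← finrank_top K V, ← htop]
    simpa using finrank_span_le_card (R := K) ({v} : Set V)

theorem stdGen_col_left {N : ℕ} (u : ℂ) {i : ℕ} (k : Fin (N + 1)) (hk : (k : ℕ) = i)
    (j : Fin (N + 1)) : stdGen (N + 1) u (i + 1) j k = if (j : ℕ) = i + 1 then 1 else 0 := by
  simp only [stdGen, Matrix.of_apply, Fin.ext_iff]
  grind

theorem stdGen_col_right {N : ℕ} (u : ℂ) {i : ℕ} (k : Fin (N + 1)) (hk : (k : ℕ) = i + 1)
    (j : Fin (N + 1)) : stdGen (N + 1) u (i + 1) j k = if (j : ℕ) = i then u else 0 := by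
  simp only [stdGen, Matrix.of_apply, Fin.ext_iff]
  grind

theorem stdGen_col_of_ne {N : ℕ} (u : ℂ) {i : ℕ} (k : Fin (N + 1)) (hk : (k : ℕ) ≠ i)
    (hk' : (k : ℕ) ≠ i + 1) (j : Fin (N + 1)) :
    stdGen (N + 1) u (i + 1) j k = if (j : ℕ) = k then 1 else 0 := by
  simp only [stdGen, Matrix.of_apply, Fin.ext_iff]
  grind

/-- The matrix with columns `f 0, …, f N` intertwines `A` with `stdGen` when `A` acts on the
vectors `f j` as `stdGen` acts on the standard basis. -/
theorem mul_eq_mul_stdGen {N : ℕ} {u : ℂ} {f : ℕ → Fin (N + 1) → ℂ} {i : ℕ} (hi : i < N)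
    {A : Matrix (Fin (N + 1)) (Fin (N + 1)) ℂ} (h1 : A.mulVec (f i) = f (i + 1))
    (h2 : A.mulVec (f (i + 1)) = u • f i)
    (h3 : ∀ j, j ≤ N → j ≠ i → j ≠ i + 1 → A.mulVec (f j) = f j) :
    A * Matrix.of (fun k j : Fin (N + 1) => f j k) =
      Matrix.of (fun k j : Fin (N + 1) => f j k) * stdGen (N + 1) u (i + 1) := by
  have hsum : ∀ (m : ℕ) (hm : m < N + 1) (c : ℂ) (r : Fin (N + 1)),
      ∑ j : Fin (N + 1), f j r * (if (j : ℕ) = m then c else 0) = f m r * c := by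
    intro m hm c r
    rw [Finset.sum_eq_single (⟨m, hm⟩ : Fin (N + 1))]
    · simp
    · intro b _ hb
      rw [if_neg (fun h => hb (Fin.ext h)), mul_zero]
    · simp
  ext r k
  have hL : (A * Matrix.of (fun k j : Fin (N + 1) => f j k)) r k = A.mulVec (f k) r := rfl
  rw [hL, Matrix.mul_apply]
  simp only [Matrix.of_apply]
  by_cases hk : (k : ℕ) = i
  · simp only [stdGen_col_left u k hk, hsum (i + 1) (by omega), hk, h1, mul_one]
  by_cases hk' : (k : ℕ) = i + 1
  · simp only [stdGen_col_right u k hk', hsum i (by omega), hk', h2, Pi.smul_apply, smul_eq_mul,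
      mul_comm]
  · simp only [stdGen_col_of_ne u k hk hk', hsum k k.2, h3 k (by omega) hk hk', mul_one]

theorem BraidRels.isBraidFamily {N r : ℕ} {T : ℕ → Matrix (Fin r) (Fin r) ℂ}
    (hbr : BraidRels (N + 1) T) (hunit : ∀ i, 1 ≤ i → i ≤ N → IsUnit (T i)) :
    IsBraidFamily N (fun i => Matrix.toLinAlgEquiv' (T (i + 1))) where
  isUnit i hi := (hunit (i + 1) (by omega) hi).map Matrix.toLinAlgEquiv'
  braid i hi := by simp only [← map_mul, hbr.1 (i + 1) (by omega) (by omega)]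
  comm i j hij hj := by
    simp only [← map_mul, hbr.2 (i + 1) (j + 1) (by omega) (by omega) (by omega)]

/-- Every irreducible `n`-dimensional representation of `B_n` with `n ≥ 9` is the tensor
product of a one-dimensional representation and a specialization of the standard
representation at some `u ≠ 0, 1`. -/
theorem dimension_n_classification (n : ℕ) (hn : 9 ≤ n)
    (T : ℕ → Matrix (Fin n) (Fin n) ℂ)
    (hunit : ∀ i, 1 ≤ i → i ≤ n - 1 → IsUnit (T i))
    (hbr : BraidRels n T)
    (hirr : BraidIrreducible n T) :
    ∃ y : ℂ, y ≠ 0 ∧ ∃ u : ℂ, u ≠ 0 ∧ u ≠ 1 ∧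
      ∃ P : Matrix (Fin n) (Fin n) ℂ, IsUnit P ∧
        ∀ i, 1 ≤ i → i ≤ n - 1 → T i = y • (P * stdGen n u i * P⁻¹) := by
  obtain ⟨N, rfl⟩ : ∃ N, n = N + 1 := ⟨n - 1, by omega⟩
  rw [Nat.add_sub_cancel] at hunit ⊢
  have h := hbr.isBraidFamily hunit
  have hdim : Module.finrank ℂ (Fin (N + 1) → ℂ) = N + 1 := by simp
  have hirr' : IsBraidFamily.IsIrreducibleFamily N
      (fun i => Matrix.toLinAlgEquiv' (T (i + 1))) := fun p hp => hirr p fun i hi hi' v hv => by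
    have := hp (i - 1) (by omega) v hv
    beta_reduce at this
    rwa [Nat.sub_add_cancel hi] at this
  obtain ⟨μ, hμ, hfar⟩ := h.exists_smul_far_mul_eq_zero (by omega)
    (IsBraidFamily.constantUpTo ℂ (N - 2) ((N + 1) / 2) (Or.inr ⟨by omega, by omega⟩))
    (by rw [hdim]; omega) hirr'
  have hμ' := inv_ne_zero hμ
  have hirr'' : IsBraidFamily.IsIrreducibleFamily N
      (fun i => μ⁻¹ • Matrix.toLinAlgEquiv' (T (i + 1))) := fun p hp => hirr' p fun i hi v hv =>
    (p.smul_mem_iff hμ').1 (hp i hi v hv)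
  have hs := h.smul hμ'
  have hF : IsFarOrthogonal N (fun i => μ⁻¹ • Matrix.toLinAlgEquiv' (T (i + 1))) :=
    { hs with
      far := hfar
      irreducible := hirr''
      ne := fun heq => by
        have := IsBraidFamily.finrank_le_one_of_irreducible_of_eq hirr''
          (hs.all_eq_of_eq (i := 0) (by omega) heq)
        omega }
  obtain ⟨u, f, hu0, hu1, hf, h1, h2, h3⟩ := hF.exists_standard_basis (by omega) hdim
  have hP : IsUnit (Matrix.of fun k j : Fin (N + 1) => f j k) :=
    Matrix.linearIndependent_cols_iff_isUnit.1 hf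
  refine ⟨μ, hμ, u, hu0, hu1, _, hP, fun i hi hi' => ?_⟩
  obtain ⟨i, rfl⟩ : ∃ j, i = j + 1 := ⟨i - 1, by omega⟩
  have hmul : (μ⁻¹ • T (i + 1)) * Matrix.of (fun k j : Fin (N + 1) => f j k) =
      Matrix.of (fun k j : Fin (N + 1) => f j k) * stdGen (N + 1) u (i + 1) :=
    mul_eq_mul_stdGen hi'
      ((Matrix.smul_mulVec _ _ _).trans (h1 i hi'))
      ((Matrix.smul_mulVec _ _ _).trans (h2 i hi'))
      fun j hj hji hji' => (Matrix.smul_mulVec _ _ _).trans (h3 i j hi' hj hji hji')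
  rw [← hmul, Matrix.mul_nonsing_inv_cancel_right _ _ ((Matrix.isUnit_iff_isUnit_det _).1 hP),
    smul_inv_smul₀ hμ]
end

section
/- Let n and r be natural numbers with 2 ≤ r ≤ n−3. Then there is no irreducible representation of the braid group B_n of dimension r; that is, if T_1, …, T_{n−1} ∈ GL_r(ℂ) satisfy the braid relations and r ≤ n−3, then either r ≤ 1 or the representation is reducible (there is a subspace of ℂ^r other than 0 and ℂ^r invariant under all T_i). -/
theorem exists_smul_eq_of_finrank_le_one {V : Type*} [AddCommGroup V] [Module ℂ V]
    [FiniteDimensional ℂ V] {W : Submodule ℂ V} (hW : Module.finrank ℂ W ≤ 1) {u w : V}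
    (hu : u ∈ W) (hu0 : u ≠ 0) (hw : w ∈ W) : ∃ c : ℂ, w = c • u := by
  obtain ⟨v, hv⟩ := finrank_le_one_iff.1 hW
  obtain ⟨a, ha⟩ := hv ⟨u, hu⟩
  obtain ⟨b, hb⟩ := hv ⟨w, hw⟩
  have ha' : a • (v : V) = u := congrArg Subtype.val ha
  have hb' : b • (v : V) = w := congrArg Subtype.val hb
  have ha0 : a ≠ 0 := by
    rintro rfl
    exact hu0 (by rw [← ha', zero_smul])
  exact ⟨b * a⁻¹, by rw [← ha', ← hb', smul_smul, inv_mul_cancel_right₀ ha0]⟩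

/-- If `ker N` is at most a line, the endomorphisms killed by `N` on both sides form at most a
line. -/
theorem exists_eq_smul_of_mul_eq_zero {V : Type*} [AddCommGroup V] [Module ℂ V]
    [FiniteDimensional ℂ V] {N U Z : Module.End ℂ V}
    (hN : Module.finrank ℂ (LinearMap.ker N) ≤ 1) (hU : U ≠ 0) (hNU : N * U = 0)
    (hUN : U * N = 0) (hNZ : N * Z = 0) (hZN : Z * N = 0) : ∃ c : ℂ, Z = c • U := by
  obtain ⟨v, hv⟩ : ∃ v, U v ≠ 0 := by
    by_contra! h
    exact hU (LinearMap.ext h)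
  have hker (Y : Module.End ℂ V) (hY : N * Y = 0) (x : V) : Y x ∈ LinearMap.ker N :=
    LinearMap.mem_ker.2 (LinearMap.congr_fun hY x)
  have hle : LinearMap.range N ≤ LinearMap.ker U := by
    rintro _ ⟨x, rfl⟩
    exact LinearMap.mem_ker.2 (LinearMap.congr_fun hUN x)
  have hlt : Module.finrank ℂ (LinearMap.ker U) < Module.finrank ℂ V :=
    Submodule.finrank_lt fun h => hv (LinearMap.mem_ker.1 (h ▸ Submodule.mem_top))
  have hrk := LinearMap.finrank_range_add_finrank_ker N
  have heq : LinearMap.range N = LinearMap.ker U :=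
    Submodule.eq_of_le_of_finrank_le hle (by omega)
  obtain ⟨c, hc⟩ := exists_smul_eq_of_finrank_le_one hN (hker U hNU v) hv (hker Z hNZ v)
  refine ⟨c, LinearMap.ext fun x => ?_⟩
  obtain ⟨a, ha⟩ := exists_smul_eq_of_finrank_le_one hN (hker U hNU v) hv (hker U hNU x)
  have hx : x - a • v ∈ LinearMap.range N := by
    rw [heq, LinearMap.mem_ker, map_sub, map_smul, ha, sub_self]
  obtain ⟨y, hy⟩ := hx
  have hZ : Z (x - a • v) = 0 := by
    rw [← hy]
    exact LinearMap.congr_fun hZN y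
  rw [map_sub, map_smul, sub_eq_zero] at hZ
  rw [hZ, hc, LinearMap.smul_apply, ha, smul_comm]

open Polynomial in
/-- If all eigenspaces of `A` have dimension at most one, everything commuting with `A` is a
polynomial in `A`. -/
theorem exists_eq_aeval_of_commute_of_finrank_ker_le_one {V : Type*} [AddCommGroup V] [Module ℂ V]
    [FiniteDimensional ℂ V] {A X : Module.End ℂ V}
    (hA : ∀ c : ℂ, Module.finrank ℂ (LinearMap.ker (A - algebraMap ℂ _ c)) ≤ 1)
    (hX : A * X = X * A) : ∃ p : ℂ[X], X = aeval A p := by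
  have hm : minpoly ℂ A ≠ 0 := minpoly.ne_zero (Algebra.IsIntegral.isIntegral A)
  have hXc (q : ℂ[X]) : Commute (aeval A q) X := by
    have hle : Algebra.adjoin ℂ {A} ≤ Subalgebra.centralizer ℂ {X} :=
      Algebra.adjoin_le (Set.singleton_subset_iff.2
        (Subalgebra.mem_centralizer_iff ℂ |>.2 fun Y hY => by rw [Set.mem_singleton_iff.1 hY, hX]))
    exact ((Subalgebra.mem_centralizer_iff ℂ).1 (hle (aeval_mem_adjoin_singleton ℂ A)) X rfl).symm
  have key : ∀ (d : ℕ) (s q : ℂ[X]), s.natDegree = d → q * s = minpoly ℂ A →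
      ∃ p : ℂ[X], X * aeval A q = aeval A p * aeval A q := by
    intro d
    induction d with
    | zero =>
      intro s q hs h
      obtain ⟨c, rfl⟩ := natDegree_eq_zero.1 hs
      have hc : c ≠ 0 := by
        rintro rfl
        exact hm (by simp [← h])
      have h0 : aeval A (q * C c) = 0 := h ▸ minpoly.aeval ℂ A
      rw [mul_comm, ← smul_eq_C_mul, map_smul, smul_eq_zero_iff_right hc] at h0
      exact ⟨0, by simp [h0]⟩
    | succ d ih =>
      intro s q hs h
      obtain ⟨l, hl⟩ := IsAlgClosed.exists_root s
        (by rw [degree_eq_natDegree (by rintro rfl; simp at hs), hs]; exact_mod_cast d.succ_ne_zero)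
      obtain ⟨t, rfl⟩ := dvd_iff_isRoot.2 hl
      have ht0 : t ≠ 0 := by
        rintro rfl
        simp at hs
      have hq0 : q ≠ 0 := by
        rintro rfl
        exact hm (by simp [← h])
      have htd : t.natDegree = d := by
        rw [natDegree_mul (X_sub_C_ne_zero l) ht0, natDegree_X_sub_C] at hs
        omega
      obtain ⟨p, hp⟩ := ih t (q * (Polynomial.X - C l)) htd (by rw [← h, mul_assoc])
      have hlin : aeval A (Polynomial.X - C l) = A - algebraMap ℂ _ l := by simp
      have hU : aeval A (q * t) ≠ 0 := by
        intro h0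
        have hdvd := natDegree_le_of_dvd (minpoly.dvd ℂ A h0) (mul_ne_zero hq0 ht0)
        rw [← h, natDegree_mul hq0 (mul_ne_zero (X_sub_C_ne_zero l) ht0), hs,
          natDegree_mul hq0 ht0] at hdvd
        omega
      have hz : aeval A (q * t * (Polynomial.X - C l)) = 0 := by
        rw [mul_assoc, mul_comm t, h, minpoly.aeval]
      have hZ : ((X - aeval A p) * aeval A q) * aeval A (Polynomial.X - C l) = 0 := by
        rw [mul_assoc, ← map_mul, sub_mul, hp, sub_self]
      have hZcomm : Commute (aeval A (Polynomial.X - C l)) ((X - aeval A p) * aeval A q) :=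
        ((hXc _).sub_right ((Commute.all _ _).map (aeval A))).mul_right
          ((Commute.all _ _).map (aeval A))
      obtain ⟨c, hc⟩ := exists_eq_smul_of_mul_eq_zero (hA l) hU
        (by rw [← hlin, ← map_mul, mul_comm, hz])
        (by rw [← hlin, ← map_mul, hz])
        (by rw [← hlin, hZcomm.eq, hZ]) (by rw [← hlin, hZ])
      refine ⟨p + c • t, ?_⟩
      rw [sub_mul, sub_eq_iff_eq_add] at hc
      rw [hc, map_add, add_mul, add_comm, map_smul, smul_mul_assoc, ← map_mul, ← map_mul,
        mul_comm t]
  obtain ⟨p, hp⟩ := key _ (minpoly ℂ A) 1 rfl (one_mul _)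
  exact ⟨p, by simpa using hp⟩

/-- Two invertible commuting elements satisfying the braid relation are equal. -/
theorem eq_of_commute_of_braid {M : Type*} [Monoid M] {a b : M} (ha : IsUnit a) (hb : IsUnit b)
    (hab : a * b = b * a) (h : a * b * a = b * a * b) : a = b := by
  rw [hab] at h
  exact (hb.mul ha).mul_left_cancel h

/-- The elements `T 0, …, T (m - 1)` are invertible and satisfy the braid relations. -/
structure IsBraidFamily_s2 {M : Type*} [Monoid M] (m : ℕ) (T : ℕ → M) : Prop where
  isUnit : ∀ i < m, IsUnit (T i)
  braid : ∀ i, i + 1 < m → T i * T (i + 1) * T i = T (i + 1) * T i * T (i + 1)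
  comm : ∀ i j, i + 2 ≤ j → j < m → T i * T j = T j * T i

namespace IsBraidFamily_s2

variable {M : Type*} [Monoid M] {m : ℕ} {T : ℕ → M}

theorem eq_succ_of_comm (h : IsBraidFamily_s2 m T) {i : ℕ} (hi : i + 1 < m)
    (hc : T i * T (i + 1) = T (i + 1) * T i) : T i = T (i + 1) :=
  eq_of_commute_of_braid (h.isUnit _ (by omega)) (h.isUnit _ hi) hc (h.braid i hi)

theorem succ_eq_of_eq (h : IsBraidFamily_s2 m T) {i : ℕ} (hi : i + 2 < m) (he : T i = T (i + 1)) :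
    T (i + 1) = T (i + 2) :=
  h.eq_succ_of_comm hi (by rw [← he]; exact h.comm _ _ le_rfl hi)

theorem eq_of_succ_eq (h : IsBraidFamily_s2 m T) {i : ℕ} (hi : i + 2 < m)
    (he : T (i + 1) = T (i + 2)) : T i = T (i + 1) :=
  h.eq_succ_of_comm (by omega) (by rw [he]; exact h.comm _ _ le_rfl hi)

/-- If two consecutive elements agree, all elements agree. -/
theorem eq_zero_of_eq_succ (h : IsBraidFamily_s2 m T) {k : ℕ} (hk : k + 1 < m)
    (he : T k = T (k + 1)) {i : ℕ} (hi : i < m) : T i = T 0 := by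
  have h0 : T 0 = T 1 := by
    induction k with
    | zero => exact he
    | succ k ih => exact ih (by omega) (h.eq_of_succ_eq hk he)
  have hs : ∀ j, j + 1 < m → T j = T (j + 1) := by
    intro j
    induction j with
    | zero => exact fun _ => h0
    | succ j ih => exact fun hj => h.succ_eq_of_eq hj (ih (by omega))
  induction i with
  | zero => rfl
  | succ i ih => rw [← hs i hi, ih (by omega)]

/-- If two distant elements agree, all elements agree. -/
theorem exists_eq_succ_of_eq (h : IsBraidFamily_s2 m T) (hm : 4 ≤ m) {i j : ℕ} (hij : i + 2 ≤ j)
    (hj : j < m) (he : T i = T j) : ∃ k, k + 1 < m ∧ T k = T (k + 1) := by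
  rcases Nat.lt_or_ge (i + 2) j with hlt | hge
  · exact ⟨i, by omega, h.eq_succ_of_comm (by omega)
      (by rw [he]; exact (h.comm (i + 1) j (by omega) hj).symm)⟩
  · rcases Nat.lt_or_ge (j + 1) m with hjm | hjm
    · exact ⟨j, hjm, h.eq_succ_of_comm hjm (by rw [← he]; exact h.comm i (j + 1) (by omega) hjm)⟩
    · obtain ⟨i, rfl⟩ : ∃ i', i = i' + 1 := ⟨i - 1, by omega⟩
      exact ⟨i, by omega, h.eq_succ_of_comm (by omega)
        (by rw [he]; exact h.comm i j (by omega) hj)⟩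

end IsBraidFamily_s2

/-- `A` is `c` plus the rank-one endomorphism `x ↦ f x • v`, with `f v = t`. -/
structure IsRankOnePert {V : Type*} [AddCommGroup V] [Module ℂ V] (c t : ℂ) (A : Module.End ℂ V)
    (v : V) (f : V →ₗ[ℂ] ℂ) : Prop where
  ne_zero : v ≠ 0
  apply_self : f v = t
  apply : ∀ x, A x = c • x + f x • v

namespace IsRankOnePert

variable {V : Type*} [AddCommGroup V] [Module ℂ V] {c t : ℂ} {A B : Module.End ℂ V} {v w : V}
  {f g : V →ₗ[ℂ] ℂ}

theorem conj (h : IsRankOnePert c t A v f) {S : Module.End ℂ V} (hS : IsUnit S)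
    (hB : B * S = S * A) : ∃ w g, IsRankOnePert c t B w g := by
  obtain ⟨u, rfl⟩ := hS
  have hinv (x : V) : (↑u⁻¹ : Module.End ℂ V) ((u : Module.End ℂ V) x) = x :=
    LinearMap.congr_fun u.inv_mul x
  have hinv' (x : V) : (u : Module.End ℂ V) ((↑u⁻¹ : Module.End ℂ V) x) = x :=
    LinearMap.congr_fun u.mul_inv x
  refine ⟨(u : Module.End ℂ V) v, f ∘ₗ (↑u⁻¹ : Module.End ℂ V), fun h0 => h.ne_zero ?_, ?_,
    fun x => ?_⟩
  · rw [← hinv v, h0, map_zero]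
  · rw [LinearMap.comp_apply, hinv, h.apply_self]
  · have := LinearMap.congr_fun hB ((↑u⁻¹ : Module.End ℂ V) x)
    rw [Module.End.mul_apply, Module.End.mul_apply, hinv', h.apply, map_add, map_smul, map_smul,
      hinv'] at this
    exact this

theorem eq_or_apply_mul_apply_ne_zero (hA : IsRankOnePert c t A v f) (hB : IsRankOnePert c t B w g)
    (hc : c ≠ 0) (hu : IsUnit A) (h : A * B * A = B * A * B) :
    A = B ∨ f w * g v ≠ 0 := by
  by_cases hs : f w * g v = 0
  swap
  · exact Or.inr hs
  left
  have hct : c + t ≠ 0 := by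
    intro h0
    have hv : A v = 0 := by rw [hA.apply, hA.apply_self, ← add_smul, h0, zero_smul]
    obtain ⟨u, rfl⟩ := hu
    have := LinearMap.congr_fun u.inv_mul v
    rw [Module.End.mul_apply, hv, map_zero] at this
    exact hA.ne_zero this.symm
  have hrel (x : V) : (c * (c + t)) • (f x • v) = (c * (c + t)) • (g x • w) := by
    have hx := LinearMap.congr_fun h x
    simp only [Module.End.mul_apply, hA.apply, hB.apply, map_add, map_smul, hA.apply_self,
      hB.apply_self, smul_eq_mul] at hx
    rw [← sub_eq_zero] at hx ⊢
    rw [← hx]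
    match_scalars
    · linear_combination -f x * hs
    · linear_combination g x * hs
    · ring
  refine LinearMap.ext fun x => ?_
  rw [hA.apply, hB.apply, smul_right_injective V (mul_ne_zero hc hct) (hrel x)]

theorem eq_of_commute (hA : IsRankOnePert c t A v f) (hB : IsRankOnePert c t B w g) (hf : f ≠ 0)
    (h : A * B = B * A) (hgv : g v ≠ 0) : A = B := by
  have hrel (x : V) : (g v * f x) • w = (f w * g x) • v := by
    have hx := LinearMap.congr_fun h x
    simp only [Module.End.mul_apply, hA.apply, hB.apply, map_add, map_smul, smul_eq_mul] at hx
    rw [← sub_eq_zero] at hx ⊢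
    rw [← neg_zero, ← hx]
    module
  obtain ⟨x, hx⟩ : ∃ x, f x ≠ 0 := by
    by_contra! h0
    exact hf (LinearMap.ext h0)
  obtain ⟨a, rfl⟩ : ∃ a : ℂ, w = a • v := by
    refine ⟨(g v * f x)⁻¹ * (f w * g x), ?_⟩
    rw [mul_smul, ← hrel x, smul_smul, inv_mul_cancel₀ (mul_ne_zero hgv hx), one_smul]
  have ha : a ≠ 0 := by
    rintro rfl
    exact hB.ne_zero (zero_smul _ _)
  have ht : t = a * g v := by rw [← hB.apply_self, map_smul, smul_eq_mul]
  refine LinearMap.ext fun y => ?_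
  have hy := hrel y
  rw [smul_smul, map_smul, hA.apply_self, smul_eq_mul] at hy
  have hy' := smul_left_injective ℂ hA.ne_zero hy
  have hfg : f y = g y * a := by
    apply mul_left_cancel₀ (mul_ne_zero ha hgv)
    beta_reduce at hy'
    rw [ht] at hy'
    linear_combination hy'
  rw [hA.apply, hB.apply, hfg, smul_smul]

end IsRankOnePert

theorem exists_isRankOnePert {V : Type*} [AddCommGroup V] [Module ℂ V] [FiniteDimensional ℂ V]
    {A : Module.End ℂ V} {c : ℂ}
    (h : Module.finrank ℂ (LinearMap.ker (A - algebraMap ℂ _ c)) + 1 = Module.finrank ℂ V) :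
    ∃ t v f, IsRankOnePert c t A v f := by
  have hrk := LinearMap.finrank_range_add_finrank_ker (A - algebraMap ℂ _ c)
  obtain ⟨⟨v, hv⟩, hv0, hspan⟩ := finrank_eq_one_iff'.1
    (show Module.finrank ℂ (LinearMap.range (A - algebraMap ℂ _ c)) = 1 by omega)
  have hv0' : v ≠ 0 := fun h0 => hv0 (Subtype.ext h0)
  have hex (x : V) : ∃ a : ℂ, a • v = (A - algebraMap ℂ _ c) x := by
    obtain ⟨a, ha⟩ := hspan ⟨_, LinearMap.mem_range_self (A - algebraMap ℂ _ c) x⟩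
    exact ⟨a, congrArg Subtype.val ha⟩
  choose f hf using hex
  have hinj := smul_left_injective ℂ hv0'
  let F : V →ₗ[ℂ] ℂ :=
    { toFun := f
      map_add' := fun x y => hinj (by simp only [add_smul, hf, map_add])
      map_smul' := fun a x => hinj (by
        simp only [smul_eq_mul, mul_smul, hf, map_smul, RingHom.id_apply]) }
  refine ⟨F v, v, F, hv0', rfl, fun x => ?_⟩
  rw [show F x • v = _ from hf x]
  simp [Module.algebraMap_end_apply]

/-- A family of functionals and vectors with a triangular pairing is linearly independent. -/
theorem card_le_finrank_of_triangular {V : Type*} [AddCommGroup V] [Module ℂ V]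
    [FiniteDimensional ℂ V] (k : ℕ) (v : ℕ → V) (f : ℕ → V →ₗ[ℂ] ℂ)
    (hd : ∀ i < k, f i (v i) ≠ 0) (hz : ∀ i j, i < j → j < k → f j (v i) = 0) :
    k ≤ Module.finrank ℂ V := by
  let M : Matrix (Fin k) (Fin k) ℂ := Matrix.of fun i j => f j (v i)
  have hM : M.det ≠ 0 := by
    rw [Matrix.det_of_isLowerTriangular M fun i j hij => hz _ _ hij j.2]
    exact Finset.prod_ne_zero_iff.2 fun i _ => hd i i.2
  have hli : LinearIndependent ℂ fun i : Fin k => v i :=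
    LinearIndependent.of_comp (LinearMap.pi fun j : Fin k => f j)
      (Matrix.linearIndependent_rows_of_det_ne_zero hM)
  simpa using hli.fintype_card_le_finrank

theorem IsBraidFamily_s2.exists_eq_succ_of_isRankOnePert {V : Type*} [AddCommGroup V] [Module ℂ V]
    [FiniteDimensional ℂ V] {m : ℕ} {T : ℕ → Module.End ℂ V} (h : IsBraidFamily_s2 m T)
    (hm : 4 ≤ m) (hr : Module.finrank ℂ V + 2 ≤ m) {c t : ℂ} (hc : c ≠ 0) {v : V}
    {f : V →ₗ[ℂ] ℂ} (h0 : IsRankOnePert c t (T 0) v f) : ∃ k, k + 1 < m ∧ T k = T (k + 1) := by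
  by_contra! hne
  have hex : ∀ i, i < m → ∃ w g, IsRankOnePert c t (T i) w g := by
    intro i
    induction i with
    | zero => exact fun _ => ⟨v, f, h0⟩
    | succ i ih =>
      intro hi
      obtain ⟨w, g, hwg⟩ := ih (by omega)
      refine hwg.conj ((h.isUnit i (by omega)).mul (h.isUnit (i + 1) hi)) ?_
      rw [← mul_assoc, ← h.braid i hi, mul_assoc]
  have hex' (i : ℕ) : ∃ w g, i < m → IsRankOnePert c t (T i) w g := by
    by_cases hi : i < m
    · obtain ⟨w, g, hwg⟩ := hex i hi
      exact ⟨w, g, fun _ => hwg⟩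
    · exact ⟨0, 0, fun hi' => absurd hi' hi⟩
  choose w g hwg using hex'
  have hadj (i : ℕ) (hi : i + 1 < m) : g i (w (i + 1)) * g (i + 1) (w i) ≠ 0 :=
    ((hwg i (by omega)).eq_or_apply_mul_apply_ne_zero (hwg (i + 1) hi) hc (h.isUnit i (by omega))
      (h.braid i hi)).resolve_left (hne i hi)
  have hfar (i j : ℕ) (hij : i + 2 ≤ j) (hj : j < m) : g j (w i) = 0 := by
    by_contra hgw
    have hgi : g i ≠ 0 := by
      intro h0
      exact hadj i (by omega) (by rw [h0, LinearMap.zero_apply, zero_mul])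
    obtain ⟨k, hk, hk'⟩ := h.exists_eq_succ_of_eq hm hij hj
      ((hwg i (by omega)).eq_of_commute (hwg j hj) hgi (h.comm i j hij hj) hgw)
    exact hne k hk hk'
  have := card_le_finrank_of_triangular (m - 1) w (fun j => g (j + 1))
    (fun i hi => right_ne_zero_of_mul (hadj i (by omega)))
    (fun i j hij hj => hfar i (j + 1) (by omega) (by omega))
  omega

theorem IsBraidFamily_s2.of_injective {U V : Type*} [AddCommGroup U] [Module ℂ U]
    [FiniteDimensional ℂ U] [AddCommGroup V] [Module ℂ V] [FiniteDimensional ℂ V] {m : ℕ}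
    {T : ℕ → Module.End ℂ V} {S : ℕ → Module.End ℂ U} (h : IsBraidFamily_s2 m T) {φ : U →ₗ[ℂ] V}
    (hφ : Function.Injective φ) (hS : ∀ i < m, ∀ x, φ (S i x) = T i (φ x)) :
    IsBraidFamily_s2 m S where
  isUnit i hi := by
    have hT := h.isUnit i hi
    rw [LinearMap.isUnit_iff_ker_eq_bot, LinearMap.ker_eq_bot] at hT ⊢
    exact fun x y hxy => hφ (hT (by rw [← hS i hi, ← hS i hi, hxy]))
  braid i hi := LinearMap.ext fun x => hφ (by
    have := LinearMap.congr_fun (h.braid i hi) (φ x)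
    simpa only [Module.End.mul_apply, hS i (by omega), hS (i + 1) hi] using this)
  comm i j hij hj := LinearMap.ext fun x => hφ (by
    have := LinearMap.congr_fun (h.comm i j hij hj) (φ x)
    simpa only [Module.End.mul_apply, hS i (by omega), hS j hj] using this)

theorem IsBraidFamily_s2.of_surjective {U V : Type*} [AddCommGroup U] [Module ℂ U]
    [FiniteDimensional ℂ U] [AddCommGroup V] [Module ℂ V] [FiniteDimensional ℂ V] {m : ℕ}
    {T : ℕ → Module.End ℂ V} {S : ℕ → Module.End ℂ U} (h : IsBraidFamily_s2 m T) {φ : V →ₗ[ℂ] U}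
    (hφ : Function.Surjective φ) (hS : ∀ i < m, ∀ x, S i (φ x) = φ (T i x)) :
    IsBraidFamily_s2 m S where
  isUnit i hi := by
    have hT := h.isUnit i hi
    rw [LinearMap.isUnit_iff_range_eq_top, LinearMap.range_eq_top] at hT ⊢
    intro y
    obtain ⟨y, rfl⟩ := hφ y
    obtain ⟨x, rfl⟩ := hT y
    exact ⟨φ x, hS i hi x⟩
  braid i hi := LinearMap.ext fun y => by
    obtain ⟨x, rfl⟩ := hφ y
    have := congrArg φ (LinearMap.congr_fun (h.braid i hi) x)
    simpa only [Module.End.mul_apply, hS i (by omega), hS (i + 1) hi] using this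
  comm i j hij hj := LinearMap.ext fun y => by
    obtain ⟨x, rfl⟩ := hφ y
    have := congrArg φ (LinearMap.congr_fun (h.comm i j hij hj) x)
    simpa only [Module.End.mul_apply, hS i (by omega), hS j hj] using this

/-- If the differences `b - a` and `d - a` multiply to zero and `d` commutes with `a` and `b`, then
`a` and `b` commute. -/
theorem mul_comm_of_sub_mul_sub_eq_zero {R : Type*} [Ring R] {a b d : R}
    (h₁ : (b - a) * (d - a) = 0) (h₂ : (d - a) * (b - a) = 0) (had : a * d = d * a)
    (hbd : b * d = d * b) : a * b = b * a := by
  have h : (b - a) * d = d * (b - a) := by rw [sub_mul, mul_sub, had, hbd]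
  have h₃ : (b - a) * a = a * (b - a) := by
    rw [mul_sub, sub_eq_zero] at h₁
    rw [sub_mul, sub_eq_zero] at h₂
    rw [← h₁, h, h₂]
  rw [sub_mul, mul_sub, sub_left_inj] at h₃
  exact h₃.symm

/-- In dimension at most `m - 2`, a braid family of length `m` has two equal consecutive
elements. -/
theorem IsBraidFamily_s2.exists_eq_succ (r : ℕ) : ∀ (m : ℕ) (V : Type) [AddCommGroup V] [Module ℂ V]
    [FiniteDimensional ℂ V] (T : ℕ → Module.End ℂ V), IsBraidFamily_s2 m T →
    Module.finrank ℂ V = r → r + 2 ≤ m → ∃ k, k + 1 < m ∧ T k = T (k + 1) := by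
  induction r using Nat.strong_induction_on with
  | _ r ih =>
  intro m V _ _ _ T h hr hm
  rcases Nat.eq_zero_or_pos r with rfl | hpos
  · have := Module.finrank_zero_iff.1 hr
    exact ⟨0, by omega, Subsingleton.elim _ _⟩
  have hnt : Nontrivial V := Module.nontrivial_of_finrank_pos (R := ℂ) (by omega)
  have hle (c : ℂ) := Submodule.finrank_le (LinearMap.ker (T 0 - algebraMap ℂ _ c))
  by_cases hfull : ∃ c : ℂ, Module.finrank ℂ (LinearMap.ker (T 0 - algebraMap ℂ _ c)) = r
  · obtain ⟨c, hc⟩ := hfull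
    have h0 : T 0 = algebraMap ℂ _ c := sub_eq_zero.1
      (LinearMap.ker_eq_top.1 (Submodule.eq_top_of_finrank_eq (hc.trans hr.symm)))
    exact ⟨0, by omega, h.eq_succ_of_comm (by omega) (by rw [h0]; exact Algebra.commutes _ _)⟩
  have hr2 : 2 ≤ r := by
    obtain ⟨c, hc⟩ := Module.End.exists_eigenvalue (T 0)
    have hne : LinearMap.ker (T 0 - algebraMap ℂ _ c) ≠ ⊥ := by
      rw [Algebra.algebraMap_eq_smul_one, ← Module.End.eigenspace_def]
      exact hc
    have := Submodule.one_le_finrank_iff.2 hne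
    have := hle c
    have : Module.finrank ℂ (LinearMap.ker (T 0 - algebraMap ℂ _ c)) ≠ r :=
      fun h => hfull ⟨c, h⟩
    omega
  by_cases hone : ∃ c : ℂ, Module.finrank ℂ (LinearMap.ker (T 0 - algebraMap ℂ _ c)) + 1 = r
  · obtain ⟨c, hc⟩ := hone
    obtain ⟨t, v, f, hA⟩ := exists_isRankOnePert (hc.trans hr.symm)
    refine h.exists_eq_succ_of_isRankOnePert (by omega) (by omega) ?_ hA
    rintro rfl
    have hu := h.isUnit 0 (by omega)
    rw [LinearMap.isUnit_iff_ker_eq_bot] at hu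
    rw [map_zero, sub_zero, hu, finrank_bot] at hc
    omega
  by_cases hsmall : ∀ c : ℂ, Module.finrank ℂ (LinearMap.ker (T 0 - algebraMap ℂ _ c)) ≤ 1
  · obtain ⟨p, hp⟩ := exists_eq_aeval_of_commute_of_finrank_ker_le_one hsmall
      (h.comm 0 2 le_rfl (by omega))
    obtain ⟨q, hq⟩ := exists_eq_aeval_of_commute_of_finrank_ker_le_one hsmall
      (h.comm 0 3 (by omega) (by omega))
    refine ⟨2, by omega, h.eq_succ_of_comm (by omega) ?_⟩
    rw [hp, show T (2 + 1) = _ from hq, ← map_mul, ← map_mul, mul_comm]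
  push Not at hsmall
  obtain ⟨c, hc⟩ := hsmall
  have hlec := hle c
  set W := LinearMap.ker (T 0 - algebraMap ℂ _ c) with hWdef
  have hc1 : Module.finrank ℂ W ≠ r := fun h => hfull ⟨c, h⟩
  have hc2 : Module.finrank ℂ W + 1 ≠ r := fun h => hone ⟨c, h⟩
  have hW (i : ℕ) (hi : i < m - 2) : ∀ x ∈ W, T (i + 2) x ∈ W := by
    intro x hx
    have hcomm : (T 0 - algebraMap ℂ _ c) * T (i + 2) = T (i + 2) * (T 0 - algebraMap ℂ _ c) := by
      rw [sub_mul, mul_sub, h.comm 0 (i + 2) (by omega) (by omega), Algebra.commutes]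
    rw [hWdef, LinearMap.mem_ker] at hx ⊢
    have := LinearMap.congr_fun hcomm x
    rwa [Module.End.mul_apply, Module.End.mul_apply, hx, map_zero] at this
  have hT : IsBraidFamily_s2 (m - 2) fun i => T (i + 2) :=
    ⟨fun i hi => h.isUnit _ (by omega), fun i hi => h.braid (i + 2) (by omega),
      fun i j hij hj => h.comm _ _ (by omega) (by omega)⟩
  have hrestr : ∃ S : ℕ → Module.End ℂ W, ∀ i < m - 2, ∀ x : W, (S i x : V) = T (i + 2) x :=
    ⟨fun i => if hi : i < m - 2 then (T (i + 2)).restrict (hW i hi) else 0, fun i hi x => by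
      simp [hi]⟩
  have hquot : ∃ S : ℕ → Module.End ℂ (V ⧸ W),
      ∀ i < m - 2, ∀ x : V, S i (W.mkQ x) = W.mkQ (T (i + 2) x) :=
    ⟨fun i => if hi : i < m - 2 then W.mapQ W (T (i + 2)) (hW i hi) else 0, fun i hi x => by
      simp [hi]⟩
  obtain ⟨S, hS⟩ := hrestr
  obtain ⟨Q, hQ⟩ := hquot
  have hSb : IsBraidFamily_s2 (m - 2) S := hT.of_injective W.injective_subtype hS
  have hQb : IsBraidFamily_s2 (m - 2) Q := hT.of_surjective W.mkQ_surjective hQ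
  obtain ⟨k, hk, hSk⟩ := ih _ (by omega) (m - 2) W S hSb rfl (by omega)
  have hWq := W.finrank_quotient_add_finrank
  obtain ⟨l, hl, hQl⟩ := ih _ (by omega) (m - 2) (V ⧸ W) Q hQb rfl (by omega)
  have hkill (i : ℕ) (hi : i < m - 2) (x : V) (hx : x ∈ W) : (T (i + 2) - T 2) x = 0 := by
    rw [LinearMap.sub_apply, ← hS i hi ⟨x, hx⟩, ← hS 0 (by omega) ⟨x, hx⟩,
      hSb.eq_zero_of_eq_succ hk hSk hi, sub_self]
  have hmem (i : ℕ) (hi : i < m - 2) (x : V) : (T (i + 2) - T 2) x ∈ W := by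
    rw [← W.ker_mkQ, LinearMap.mem_ker, LinearMap.sub_apply, map_sub, ← hQ i hi,
      ← hQ 0 (by omega), hQb.eq_zero_of_eq_succ hl hQl hi, sub_self]
  have hprod (i j : ℕ) (hi : i < m - 2) (hj : j < m - 2) :
      (T (i + 2) - T 2) * (T (j + 2) - T 2) = 0 :=
    LinearMap.ext fun x => hkill i hi _ (hmem j hj x)
  exact ⟨2, by omega, h.eq_succ_of_comm (by omega)
    (mul_comm_of_sub_mul_sub_eq_zero (hprod 1 3 (by omega) (by omega))
      (hprod 3 1 (by omega) (by omega)) (h.comm 2 5 (by omega) (by omega))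
      (h.comm 3 5 (by omega) (by omega)))⟩

/-- There is no irreducible representation of `B_n` of dimension `r` with
`2 ≤ r ≤ n - 3`: any such representation has a proper nonzero invariant subspace. -/
theorem no_irreducible_of_dim_le_sub_three (n r : ℕ) (hr : 2 ≤ r) (hrn : r ≤ n - 3)
    (T : ℕ → Matrix (Fin r) (Fin r) ℂ)
    (hunit : ∀ i, 1 ≤ i → i ≤ n - 1 → IsUnit (T i))
    (hbr : BraidRels n T) :
    ∃ p : Submodule ℂ (Fin r → ℂ), BraidInvariant n T p ∧ p ≠ ⊥ ∧ p ≠ ⊤ := by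
  have h : IsBraidFamily_s2 (n - 1) fun i => Matrix.toLin' (T (i + 1)) :=
    { isUnit := fun i hi =>
        (hunit (i + 1) (by omega) (by omega)).map (Matrix.toLinAlgEquiv' (R := ℂ))
      braid := fun i hi => by
        simp only [Module.End.mul_eq_comp, ← Matrix.toLin'_mul]
        rw [hbr.1 (i + 1) (by omega) (by omega)]
      comm := fun i j hij hj => by
        simp only [Module.End.mul_eq_comp, ← Matrix.toLin'_mul]
        rw [hbr.2 (i + 1) (j + 1) (by omega) (by omega) (by omega)] }
  obtain ⟨k, hk, hTk⟩ := IsBraidFamily_s2.exists_eq_succ r (n - 1) (Fin r → ℂ) _ h (by simp) (by omega)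
  have : NeZero r := ⟨by omega⟩
  obtain ⟨c, hc⟩ := Module.End.exists_eigenvalue (Matrix.toLin' (T 1))
  obtain ⟨v, hv⟩ := hc.exists_hasEigenvector
  refine ⟨Submodule.span ℂ {v}, fun i hi hi' x hx => ?_, ?_, fun htop => ?_⟩
  · obtain ⟨i, rfl⟩ : ∃ j, i = j + 1 := ⟨i - 1, by omega⟩
    obtain ⟨a, rfl⟩ := Submodule.mem_span_singleton.1 hx
    have hi0 : Matrix.toLin' (T (i + 1)) = Matrix.toLin' (T 1) :=
      h.eq_zero_of_eq_succ hk hTk (by omega)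
    rw [← Matrix.toLin'_apply, hi0, map_smul, hv.apply_eq_smul]
    exact Submodule.smul_mem _ _ (Submodule.smul_mem _ _ (Submodule.mem_span_singleton_self v))
  · rw [Ne, Submodule.span_singleton_eq_bot]
    exact hv.2
  · have h1 := finrank_span_singleton (K := ℂ) hv.2
    rw [htop, finrank_top, Module.finrank_fin_fun] at h1
    omega
end

section
/- Let n ≥ 6 and let T_1, …, T_{n−1} ∈ GL_r(ℂ) be invertible matrices satisfying the braid relations. Let λ ∈ ℂ be an eigenvalue of T_{n−1}, let f(X) be the minimal polynomial of T_{n−1}, and set m(X) = f(X)/(X−λ). Let d = rank(m(T_{n−1})) (this d equals the number of Jordan blocks of T_{n−1} for the eigenvalue λ of maximal size). If d ≤ n−5, then there exists a nonzero vector w ∈ ℂ^r that is a simultaneous eigenvector of T_1, …, T_{n−3} and of T_{n−1}; equivalently, the restriction of the representation to B_{n−2} × ⟨σ_{n−1}⟩ has a one-dimensional invariant subspace. -/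
open Module in
/-- An endomorphism all of whose eigenspaces are at most one-dimensional has a commutative
centralizer. -/
theorem commute_of_finrank_eigenspace_le_one {K V : Type*} [Field K] [IsAlgClosed K]
    [AddCommGroup V] [Module K V] [FiniteDimensional K V] {A B C : End K V}
    (hA : ∀ μ, finrank K (End.eigenspace A μ) ≤ 1) (hB : Commute A B) (hC : Commute A C) :
    Commute B C := by
  obtain ⟨v, hv⟩ : ∃ v, ∀ μ : End.Eigenvalues A,
      v ∉ LinearMap.range (A - (μ : K) • 1) := by
    by_contra! h
    obtain ⟨μ, hμ⟩ := Subspace.exists_eq_top_of_iUnion_eq_univ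
      (p := fun μ : End.Eigenvalues A ↦ LinearMap.range (A - (μ : K) • 1))
      (Set.eq_univ_of_forall fun v ↦ Set.mem_iUnion.2 (h v))
    have hker := LinearMap.ker_eq_bot_iff_range_eq_top.2 hμ
    exact μ.2 (End.eigenspace_def.trans hker)
  let U : Submodule K V :=
    LinearMap.range ((LinearMap.applyₗ v : End K V →ₗ[K] V) ∘ₗ (Polynomial.aeval A).toLinearMap)
  have hUA : U ≤ U.comap A := by
    rintro _ ⟨p, rfl⟩
    exact ⟨Polynomial.X * p, by simp⟩
  have hvU : v ∈ U := ⟨1, by simp⟩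
  have hU : U = ⊤ := by
    by_contra hne
    have : Nontrivial (V ⧸ U) := Submodule.Quotient.nontrivial_iff.2 hne
    obtain ⟨μ, hμ⟩ := End.exists_eigenvalue (U.mapQ U A hUA)
    let R := LinearMap.range (A - (μ : K) • 1)
    have hsup : R ⊔ U ≠ ⊤ := by
      intro htop
      have hrange : LinearMap.range (U.mapQ U A hUA - μ • 1) = ⊤ := by
        rw [LinearMap.range_eq_top]
        intro y
        obtain ⟨y, rfl⟩ := U.mkQ_surjective y
        obtain ⟨_, ⟨x, rfl⟩, u, hu, rfl⟩ := Submodule.mem_sup.1 (htop ▸ Submodule.mem_top (x := y))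
        refine ⟨U.mkQ x, ?_⟩
        have : U.mkQ u = 0 := by simpa using hu
        rw [map_add, this]
        simp
      rw [← LinearMap.ker_eq_bot_iff_range_eq_top] at hrange
      exact hμ (End.eigenspace_def.trans hrange)
    have hdim := LinearMap.finrank_range_add_finrank_ker (A - (μ : K) • 1)
    have hker : finrank K (LinearMap.ker (A - (μ : K) • 1)) ≤ 1 := by
      rw [← End.eigenspace_def]; exact hA μ
    have hlt := Submodule.finrank_lt hsup
    have hRU : R = R ⊔ U := Submodule.eq_of_le_of_finrank_le le_sup_left (by
      change finrank K (R ⊔ U : Submodule K V) ≤ finrank K R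
      change finrank K R + _ = _ at hdim
      omega)
    have hvR : v ∈ R := hRU ▸ Submodule.mem_sup_right hvU
    have hev : A.HasEigenvalue μ := by
      intro hbot
      have hbot' : LinearMap.ker (A - (μ : K) • 1) = ⊥ := by
        exact End.eigenspace_def.symm.trans hbot
      refine hsup (top_le_iff.1 (le_trans ?_ le_sup_left))
      exact (LinearMap.ker_eq_bot_iff_range_eq_top.1 hbot').ge
    exact hv ⟨μ, hev⟩ hvR
  have hgen (x : V) : ∃ p : Polynomial K, Polynomial.aeval A p v = x := by
    have hx : x ∈ U := hU ▸ Submodule.mem_top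
    exact hx
  have hpoly {D : End K V} (hD : Commute A D) (p : Polynomial K) (x : V) :
      D (Polynomial.aeval A p x) = Polynomial.aeval A p (D x) := by
    have : Commute D (Polynomial.aeval A p) :=
      Algebra.commute_of_mem_adjoin_singleton_of_commute
        (Polynomial.aeval_mem_adjoin_singleton K A) hD.symm
    exact congr($this x)
  obtain ⟨p, hp⟩ := hgen (B v)
  obtain ⟨q, hq⟩ := hgen (C v)
  refine LinearMap.ext fun x ↦ ?_
  obtain ⟨s, rfl⟩ := hgen x
  have hcomm : B (C v) = C (B v) := by
    rw [← hq, ← hp, hpoly hB, hpoly hC, ← hp, ← hq, ← Module.End.mul_apply, ← map_mul, mul_comm,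
      map_mul, Module.End.mul_apply]
  simp only [Module.End.mul_apply, hpoly hB, hpoly hC, hcomm]

/-- Invertible elements `S 1, …, S k` satisfying the braid relations. -/
structure IsBraidFamily_s3 {M : Type*} [Monoid M] (k : ℕ) (S : ℕ → M) : Prop where
  isUnit : ∀ i, 1 ≤ i → i ≤ k → IsUnit (S i)
  braid : ∀ i, 1 ≤ i → i + 1 ≤ k → S i * S (i + 1) * S i = S (i + 1) * S i * S (i + 1)
  commute : ∀ i j, 1 ≤ i → i + 2 ≤ j → j ≤ k → Commute (S i) (S j)

namespace IsBraidFamily_s3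

section Monoid

variable {M : Type*} [Monoid M] {k : ℕ} {S : ℕ → M}

theorem eq_succ_of_commute (hS : IsBraidFamily_s3 k S) {i : ℕ} (h1 : 1 ≤ i) (hk : i + 1 ≤ k)
    (h : Commute (S i) (S (i + 1))) : S i = S (i + 1) := by
  have hb := hS.braid i h1 hk
  rw [h.eq, mul_assoc, mul_assoc] at hb
  exact (hS.isUnit i h1 (by omega)).mul_left_cancel
    ((hS.isUnit (i + 1) (by omega) hk).mul_left_cancel hb)

/-- If two consecutive elements commute, then all elements are equal. -/
theorem eq_of_commute_succ (hS : IsBraidFamily_s3 k S) {i : ℕ} (h1 : 1 ≤ i) (hk : i + 1 ≤ k)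
    (h : Commute (S i) (S (i + 1))) {j : ℕ} (hj1 : 1 ≤ j) (hjk : j ≤ k) : S j = S 1 := by
  have hup : ∀ m, i ≤ m → m + 1 ≤ k → S m = S (m + 1) := by
    intro m hm
    induction m, hm using Nat.le_induction with
    | base => exact fun _ ↦ hS.eq_succ_of_commute h1 hk h
    | succ m hm ih =>
      intro hmk
      refine hS.eq_succ_of_commute (by omega) hmk ?_
      rw [← ih (by omega)]
      exact hS.commute m (m + 1 + 1) (by omega) (by omega) hmk
  have hdown : ∀ m, m ≤ i → 1 ≤ m → S m = S (m + 1) := by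
    intro m hm
    induction hm using Nat.decreasingInduction with
    | self => exact fun _ ↦ hup i le_rfl hk
    | of_succ m hm ih =>
      intro hm1
      refine hS.eq_succ_of_commute hm1 (by omega) ?_
      rw [ih (by omega)]
      exact hS.commute m (m + 1 + 1) hm1 (by omega) (by omega)
  induction j, hj1 using Nat.le_induction with
  | base => rfl
  | succ j hj ih =>
    rw [← ih (by omega)]
    rcases le_total j i with hji | hij
    · exact (hdown j hji hj).symm
    · exact (hup j hij hjk).symm

end Monoid

end IsBraidFamily_s3

section RankOne

variable {K V : Type*} [Field K] [AddCommGroup V] [Module K V]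

/-- Rank one perturbations `a`, `b` of the same scalar which satisfy the braid relation commute
if the range of `b - c` lies in the kernel of `a - c`. -/
theorem commute_of_braid_of_rank_one {a b : Module.End K V} (ha : IsUnit a) (hb : IsUnit b)
    (hab : a * b * a = b * a * b) {c : K} (hc : c ≠ 0) {v w : V} {φ ψ : Module.Dual K V}
    (hv : v ≠ 0) (hw : w ≠ 0) (hax : ∀ x, a x = c • x + φ x • v)
    (hbx : ∀ x, b x = c • x + ψ x • w) (hφw : φ w = 0) : Commute a b := by
  have key (x : V) : (c * (c + φ v) * φ x) • v = (c * (c + ψ w) * ψ x) • w := by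
    have h := congr($hab x)
    simp only [Module.End.mul_apply, hax, hbx, map_add, map_smul, smul_eq_mul, hφw] at h
    linear_combination (norm := module) h
  have hψw : c + ψ w ≠ 0 := by
    intro h0
    refine hw (((Module.End.isUnit_iff b).1 hb).1 ?_)
    rw [hbx, ← add_smul, h0, zero_smul, map_zero]
  have hφv : c + φ v ≠ 0 := by
    intro h0
    refine hv (((Module.End.isUnit_iff a).1 ha).1 ?_)
    rw [hax, ← add_smul, h0, zero_smul, map_zero]
  have hww : ψ w = 0 := by
    have h := key w
    simp only [hφw, mul_zero, zero_smul] at h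
    simpa [hc, hψw, hw] using h.symm
  have hz (x : V) : φ x * ψ v = 0 := by
    have h := congrArg ψ (key x)
    simpa [hww, hc, hφv] using h
  refine LinearMap.ext fun x ↦ ?_
  simp only [Module.End.mul_apply, hax, hbx, map_add, map_smul, smul_eq_mul, hφw, add_smul,
    smul_add, mul_smul]
  linear_combination (norm := module) -congr($(hz x) • w)

theorem linearIndependent_of_dual_triangular {ι : Type*} [LinearOrder ι] [Fintype ι]
    {v : ι → V} {φ : ι → Module.Dual K V} (hdiag : ∀ i, φ i (v i) ≠ 0)
    (hlt : ∀ i j, i < j → φ i (v j) = 0) : LinearIndependent K v := by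
  rw [Fintype.linearIndependent_iff]
  intro g hg i
  induction i using WellFoundedLT.induction with
  | ind i ih =>
    have h := congrArg (φ i) hg
    rw [map_sum, map_zero, Finset.sum_eq_single i] at h
    · simpa [hdiag i] using h
    · intro j _ hji
      rcases lt_or_gt_of_ne hji with hj | hj
      · simp [ih j hj]
      · simp [hlt i j hj]
    · simp

/-- If two commuting rank one perturbations of the same scalar fail to be orthogonal,
then they commute with the same endomorphisms. -/
theorem commute_iff_commute_of_rank_one {a b x : Module.End K V} (hab : Commute a b) {c : K}
    {v w : V} {φ ψ : Module.Dual K V} (hv : v ≠ 0) (hψ : ψ ≠ 0)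
    (hax : ∀ x, a x = c • x + φ x • v) (hbx : ∀ x, b x = c • x + ψ x • w) (hφw : φ w ≠ 0) :
    Commute x a ↔ Commute x b := by
  have key (y : V) : (ψ y * φ w) • v = (φ y * ψ v) • w := by
    have h := congr($hab y)
    simp only [Module.End.mul_apply, hax, hbx, map_add, map_smul, smul_eq_mul] at h
    linear_combination (norm := module) h
  obtain ⟨y, hy⟩ : ∃ y, ψ y ≠ 0 := by
    by_contra! h
    exact hψ (LinearMap.ext h)
  have hne : φ y * ψ v ≠ 0 := by
    intro h0
    have h := key y
    simp [h0, hy, hφw, hv] at h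
  have hψv : ψ v ≠ 0 := right_ne_zero_of_mul hne
  have hw : w ≠ 0 := by
    rintro rfl
    simp at hφw
  set t := (φ y * ψ v)⁻¹ * (ψ y * φ w) with ht
  have hwv : w = t • v := by
    rw [ht, mul_smul, key y, smul_smul, inv_mul_cancel₀ hne, one_smul]
  have ht0 : t ≠ 0 := by
    intro h0
    exact hw (by rw [hwv, h0, zero_smul])
  have hφψ (z : V) : ψ z * φ w = φ z * ψ v * t := by
    have h := key z
    rw [hwv, smul_smul, ← hwv] at h
    exact smul_left_injective K hv h
  set s := t * (ψ v * t / φ w) with hs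
  have hs0 : s ≠ 0 := mul_ne_zero ht0 (div_ne_zero (mul_ne_zero hψv ht0) hφw)
  have hb : b - c • 1 = s • (a - c • 1) := by
    refine LinearMap.ext fun z ↦ ?_
    have hψz : ψ z = φ z * ψ v * t / φ w := by
      rw [eq_div_iff hφw, hφψ]
    simp only [LinearMap.smul_apply, LinearMap.sub_apply, Module.End.one_apply, hax, hbx, hψz, hs]
    rw [add_sub_cancel_left, add_sub_cancel_left, smul_smul, hwv, smul_smul, ← hwv]
    ring_nf
  have hc : Commute x (c • (1 : Module.End K V)) := (Commute.one_right x).smul_right c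
  have hshift (y : Module.End K V) : Commute x (y - c • 1) ↔ Commute x y :=
    ⟨fun h ↦ by simpa using h.add_right hc, fun h ↦ h.sub_right hc⟩
  rw [← hshift a, ← hshift b, hb]
  exact (Commute.smul_right_iff₀ hs0).symm

/-- Braid generators which are rank one perturbations of the same scalar have commuting
neighbours in small dimension. -/
theorem IsBraidFamily_s3.exists_commute_succ_of_rank_one [FiniteDimensional K V] {k : ℕ}
    {S : ℕ → Module.End K V} (hS : IsBraidFamily_s3 k S) (hk : 4 ≤ k)
    (hdim : Module.finrank K V + 2 ≤ k) {c : K} (hc : c ≠ 0) {v : ℕ → V}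
    {φ : ℕ → Module.Dual K V} (hv : ∀ i, 1 ≤ i → i ≤ k → v i ≠ 0)
    (hφ : ∀ i, 1 ≤ i → i ≤ k → φ i ≠ 0)
    (hform : ∀ i, 1 ≤ i → i ≤ k → ∀ x, S i x = c • x + φ i x • v i) :
    ∃ i, 1 ≤ i ∧ i + 1 ≤ k ∧ Commute (S i) (S (i + 1)) := by
  by_contra! hcon
  have hadj (i : ℕ) (h1 : 1 ≤ i) (hik : i + 1 ≤ k) : φ i (v (i + 1)) ≠ 0 := fun h0 ↦
    hcon i h1 hik (commute_of_braid_of_rank_one (hS.isUnit i h1 (by omega))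
      (hS.isUnit (i + 1) (by omega) hik) (hS.braid i h1 hik) hc (hv i h1 (by omega))
      (hv (i + 1) (by omega) hik) (hform i h1 (by omega)) (hform (i + 1) (by omega) hik) h0)
  have hfar (i j : ℕ) (h1 : 1 ≤ i) (hij : i + 2 ≤ j) (hjk : j ≤ k) : φ i (v j) = 0 := by
    by_contra h0
    have hcomm := hS.commute i j h1 hij hjk
    have htransfer (l : ℕ) : Commute (S l) (S i) ↔ Commute (S l) (S j) :=
      commute_iff_commute_of_rank_one hcomm (hv i h1 (by omega)) (hφ j (by omega) hjk)
        (hform i h1 (by omega)) (hform j (by omega) hjk) h0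
    rcases Nat.lt_or_ge j k with hj | hj
    · exact hcon j (by omega) hj ((htransfer (j + 1)).1
        (hS.commute i (j + 1) h1 (by omega) hj).symm).symm
    · rcases eq_or_lt_of_le hij with rfl | hlt
      · obtain ⟨l, rfl⟩ : ∃ l, i = l + 1 := ⟨i - 1, by omega⟩
        exact hcon l (by omega) (by omega) ((htransfer l).2
          (hS.commute l (l + 1 + 2) (by omega) (by omega) hjk))
      · obtain ⟨l, rfl⟩ : ∃ l, j = l + 1 := ⟨j - 1, by omega⟩
        exact hcon l (by omega) hjk ((htransfer l).1
          (hS.commute i l h1 (by omega) (by omega)).symm)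
  have hli : LinearIndependent K fun i : Fin (k - 1) ↦ v (i + 2) :=
    linearIndependent_of_dual_triangular (φ := fun i : Fin (k - 1) ↦ φ (i + 1))
      (fun i ↦ hadj (i + 1) (by omega) (by omega))
      (fun i j hij ↦ hfar (i + 1) (j + 2) (by omega) (by have := Fin.lt_def.1 hij; omega)
        (by omega))
  have := hli.fintype_card_le_finrank
  rw [Fintype.card_fin] at this
  omega

end RankOne

/-- Endomorphisms which act in the same way on an invariant subspace and on the quotient by it,
and two of which commute with the third, commute with each other. -/
theorem Module.End.commute_of_commute_of_agree {K V : Type*} [Field K] [AddCommGroup V]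
    [Module K V] {a b c : Module.End K V} (W : Submodule K V) (hab : Commute a b)
    (hac : Commute a c) (hbW : ∀ x ∈ W, b x = a x) (hcW : ∀ x ∈ W, c x = a x)
    (hb : ∀ x, b x - a x ∈ W) (hc : ∀ x, c x - a x ∈ W) : Commute b c := by
  have h1 : (b - a) * (c - a) = 0 := LinearMap.ext fun x ↦ by
    simpa [sub_eq_zero] using hbW _ (hc x)
  have h2 : (c - a) * (b - a) = 0 := LinearMap.ext fun x ↦ by
    simpa [sub_eq_zero] using hcW _ (hb x)
  have hab' := hab.eq
  have hac' := hac.eq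
  change b * c = c * b
  linear_combination (norm := noncomm_ring) h1 - h2 + hac' - hab'

section SmallDimension

universe u v

variable {K : Type u} [Field K]

open Module in
/-- If `S 1` has an eigenspace of dimension and codimension at least two,
then two consecutive braid generators commute, given the small dimension theorem for
smaller braid groups. -/
theorem IsBraidFamily_s3.exists_commute_succ_of_eigenspace {V : Type v} [AddCommGroup V] [Module K V]
    [FiniteDimensional K V] {k : ℕ} {S : ℕ → End K V} (hS : IsBraidFamily_s3 k S)
    (hdim : finrank K V + 2 ≤ k)
    (ih : ∀ (W : Type v) [AddCommGroup W] [Module K W] [FiniteDimensional K W] (R : ℕ → End K W),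
      IsBraidFamily_s3 (k - 2) R → finrank K W + 2 ≤ k - 2 → ∀ j, 1 ≤ j → j ≤ k - 2 → R j = R 1)
    {μ : K} (h2 : 2 ≤ finrank K (End.eigenspace (S 1) μ))
    (h2' : finrank K (End.eigenspace (S 1) μ) + 2 ≤ finrank K V) :
    ∃ i, 1 ≤ i ∧ i + 1 ≤ k ∧ Commute (S i) (S (i + 1)) := by
  set W := End.eigenspace (S 1) μ with hW
  have hinv (j : ℕ) (h1 : 1 ≤ j) (hj : j ≤ k - 2) (x : V) (hx : x ∈ W) : S (j + 2) x ∈ W := by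
    rw [hW, End.mem_eigenspace_iff] at hx ⊢
    have h := congr($(hS.commute 1 (j + 2) le_rfl (by omega) (by omega)) x)
    simpa [hx] using h
  have hR (j : ℕ) : ∃ R : End K W, 1 ≤ j → j ≤ k - 2 → ∀ x : W, (R x : V) = S (j + 2) x := by
    by_cases h : 1 ≤ j ∧ j ≤ k - 2
    · exact ⟨(S (j + 2)).restrict (hinv j h.1 h.2), fun _ _ _ ↦ rfl⟩
    · exact ⟨0, fun h1 h2 ↦ absurd ⟨h1, h2⟩ h⟩
  have hQ (j : ℕ) : ∃ Q : End K (V ⧸ W), 1 ≤ j → j ≤ k - 2 →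
      ∀ x : V, Q (W.mkQ x) = W.mkQ (S (j + 2) x) := by
    by_cases h : 1 ≤ j ∧ j ≤ k - 2
    · exact ⟨W.mapQ W (S (j + 2)) (hinv j h.1 h.2), fun _ _ _ ↦ rfl⟩
    · exact ⟨0, fun h1 h2 ↦ absurd ⟨h1, h2⟩ h⟩
  choose R hR using hR
  choose Q hQ using hQ
  have hRS : IsBraidFamily_s3 (k - 2) R := by
    refine ⟨fun i h1 hi ↦ ?_, fun i h1 hi ↦ ?_, fun i j h1 hij hj ↦ ?_⟩
    · rw [LinearMap.isUnit_iff_ker_eq_bot, LinearMap.ker_eq_bot]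
      intro x y hxy
      refine Subtype.ext
        (((End.isUnit_iff _).1 (hS.isUnit (i + 2) (by omega) (by omega))).1 ?_)
      rw [← hR i h1 hi, ← hR i h1 hi, hxy]
    · refine LinearMap.ext fun x ↦ Subtype.ext ?_
      simp only [End.mul_apply, hR i h1 (by omega), hR (i + 1) (by omega) hi]
      exact congr($(hS.braid (i + 2) (by omega) (by omega)) x)
    · refine LinearMap.ext fun x ↦ Subtype.ext ?_
      simp only [End.mul_apply, hR i h1 (by omega), hR j (by omega) hj]
      exact congr($(hS.commute (i + 2) (j + 2) (by omega) (by omega) (by omega)) x)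
  have hQS : IsBraidFamily_s3 (k - 2) Q := by
    refine ⟨fun i h1 hi ↦ ?_, fun i h1 hi ↦ ?_, fun i j h1 hij hj ↦ ?_⟩
    · rw [LinearMap.isUnit_iff_range_eq_top, LinearMap.range_eq_top]
      intro y
      obtain ⟨y, rfl⟩ := W.mkQ_surjective y
      obtain ⟨x, rfl⟩ := ((End.isUnit_iff _).1 (hS.isUnit (i + 2) (by omega) (by omega))).2 y
      exact ⟨W.mkQ x, hQ i h1 hi x⟩
    · refine LinearMap.ext fun x ↦ ?_
      obtain ⟨x, rfl⟩ := W.mkQ_surjective x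
      simp only [End.mul_apply, hQ i h1 (by omega), hQ (i + 1) (by omega) hi]
      exact congr(W.mkQ ($(hS.braid (i + 2) (by omega) (by omega)) x))
    · refine LinearMap.ext fun x ↦ ?_
      obtain ⟨x, rfl⟩ := W.mkQ_surjective x
      simp only [End.mul_apply, hQ i h1 (by omega), hQ j (by omega) hj]
      exact congr(W.mkQ ($(hS.commute (i + 2) (j + 2) (by omega) (by omega) (by omega)) x))
  have hquot := W.finrank_quotient_add_finrank
  have hReq := ih W R hRS (by omega)
  have hQeq := ih (V ⧸ W) Q hQS (by omega)
  have hWeq (j : ℕ) (h1 : 1 ≤ j) (hj : j ≤ k - 2) (x : V) (hx : x ∈ W) :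
      S (j + 2) x = S 3 x := by
    rw [← hR j h1 hj ⟨x, hx⟩, ← hR 1 le_rfl (by omega) ⟨x, hx⟩, hReq j h1 hj]
  have hVeq (j : ℕ) (h1 : 1 ≤ j) (hj : j ≤ k - 2) (x : V) : S (j + 2) x - S 3 x ∈ W := by
    rw [← Submodule.ker_mkQ W, LinearMap.mem_ker, map_sub, sub_eq_zero, ← hQ j h1 hj,
      ← hQ 1 le_rfl (by omega), hQeq j h1 hj]
  exact ⟨5, by omega, by omega, End.commute_of_commute_of_agree W
    (hS.commute 3 5 (by omega) (by omega) (by omega))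
    (hS.commute 3 6 (by omega) (by omega) (by omega))
    (hWeq 3 (by omega) (by omega)) (hWeq 4 (by omega) (by omega))
    (hVeq 3 (by omega) (by omega)) (hVeq 4 (by omega) (by omega))⟩

open Module in
theorem exists_rank_one_form {V : Type*} [AddCommGroup V] [Module K V]
    [FiniteDimensional K V] {A : End K V} {μ : K}
    (h : finrank K (End.eigenspace A μ) + 1 = finrank K V) :
    ∃ (v : V) (φ : Dual K V), v ≠ 0 ∧ φ ≠ 0 ∧ ∀ x, A x = μ • x + φ x • v := by
  rw [End.eigenspace_def] at h
  have hrk := LinearMap.finrank_range_add_finrank_ker (A - μ • 1)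
  have h1 : finrank K (LinearMap.range (A - μ • 1)) = 1 := by omega
  obtain ⟨e⟩ :=
    FiniteDimensional.nonempty_linearEquiv_of_finrank_eq (h1.trans (finrank_self K).symm)
  have hform (x : V) : A x - μ • x = e ((A - μ • 1).rangeRestrict x) • (e.symm 1 : V) := by
    rw [← Submodule.coe_smul, ← map_smul, smul_eq_mul, mul_one, e.symm_apply_apply]
    rfl
  refine ⟨e.symm 1, e.toLinearMap ∘ₗ (A - μ • 1).rangeRestrict, by simp, ?_, fun x ↦ ?_⟩
  · intro h0
    obtain ⟨x, hx⟩ := (A - μ • 1).surjective_rangeRestrict (e.symm 1)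
    simpa [hx] using congr($h0 x)
  · rw [← sub_eq_iff_eq_add', hform]
    rfl

open Module in
/-- All braid generators are rank one perturbations of the same scalar as soon as the first is. -/
theorem IsBraidFamily_s3.exists_rank_one_form {V : Type*} [AddCommGroup V] [Module K V]
    [FiniteDimensional K V] {k : ℕ} {S : ℕ → End K V} (hS : IsBraidFamily_s3 k S) {μ : K}
    (h : finrank K (End.eigenspace (S 1) μ) + 1 = finrank K V) {i : ℕ} (hi1 : 1 ≤ i)
    (hik : i ≤ k) :
    ∃ (v : V) (φ : Dual K V), v ≠ 0 ∧ φ ≠ 0 ∧ ∀ x, S i x = μ • x + φ x • v := by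
  induction i, hi1 using Nat.le_induction with
  | base => exact _root_.exists_rank_one_form h
  | succ i hi ih =>
    obtain ⟨v, φ, hv, hφ, hx⟩ := ih (by omega)
    have hu := (hS.isUnit i hi (by omega)).mul (hS.isUnit (i + 1) (by omega) hik)
    let e := LinearEquiv.ofBijective (S i * S (i + 1)) ((End.isUnit_iff _).1 hu)
    have hconj (x : V) : S (i + 1) (e x) = e (S i x) :=
      congr($((hS.braid i hi hik).symm) x)
    refine ⟨e v, φ ∘ₗ e.symm.toLinearMap, by simpa using hv, ?_, fun x ↦ ?_⟩
    · intro h0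
      refine hφ (LinearMap.ext fun x ↦ ?_)
      simpa using congr($h0 (e x))
    · obtain ⟨x, rfl⟩ := e.surjective x
      rw [hconj, hx]
      simp

open Module in
/-- A representation of the braid group on `k + 1` strands of dimension at most `k - 2` is
constant on the generators. -/
theorem IsBraidFamily_s3.eq_of_finrank_add_two_le [IsAlgClosed K] (k : ℕ) :
    ∀ (V : Type v) [AddCommGroup V] [Module K V] [FiniteDimensional K V] (S : ℕ → End K V), IsBraidFamily_s3 k S →
    finrank K V + 2 ≤ k → ∀ j, 1 ≤ j → j ≤ k → S j = S 1 := by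
  induction k using Nat.strong_induction_on with
  | h k ih =>
  intro V _ _ _ S hS hdim j hj1 hjk
  suffices h : ∃ i, 1 ≤ i ∧ i + 1 ≤ k ∧ Commute (S i) (S (i + 1)) by
    obtain ⟨i, h1, hik, hcomm⟩ := h
    exact hS.eq_of_commute_succ h1 hik hcomm hj1 hjk
  rcases Nat.lt_or_ge (finrank K V) 2 with hd | hd
  · exact ⟨1, le_rfl, by omega, commute_of_finrank_eigenspace_le_one (A := 1)
      (fun μ ↦ (Submodule.finrank_le _).trans (by omega)) (Commute.one_left _)
      (Commute.one_left _)⟩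
  by_cases hall : ∀ μ, finrank K (End.eigenspace (S 1) μ) ≤ 1
  · exact ⟨3, by omega, by omega, commute_of_finrank_eigenspace_le_one hall
      (hS.commute 1 3 le_rfl (by omega) (by omega)) (hS.commute 1 4 le_rfl (by omega) (by omega))⟩
  push Not at hall
  obtain ⟨μ, hμ⟩ := hall
  have hle := Submodule.finrank_le (End.eigenspace (S 1) μ)
  rcases Nat.lt_or_ge (finrank K V) (finrank K (End.eigenspace (S 1) μ) + 2) with hlt | hge
  · rcases hle.eq_or_lt with heq | hlt'
    · have htop := Submodule.eq_top_of_finrank_eq heq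
      refine ⟨1, le_rfl, by omega, LinearMap.ext fun x ↦ ?_⟩
      have hx (x : V) : S 1 x = μ • x :=
        End.mem_eigenspace_iff.1 (htop ▸ Submodule.mem_top)
      simp [hx]
    · have hform (i : ℕ) : ∃ (v : V) (φ : Dual K V), 1 ≤ i → i ≤ k →
          v ≠ 0 ∧ φ ≠ 0 ∧ ∀ x, S i x = μ • x + φ x • v := by
        by_cases h : 1 ≤ i ∧ i ≤ k
        · obtain ⟨v, φ, hvφ⟩ := hS.exists_rank_one_form (μ := μ) (by omega) h.1 h.2
          exact ⟨v, φ, fun _ _ ↦ hvφ⟩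
        · exact ⟨0, 0, fun h1 h2 ↦ absurd ⟨h1, h2⟩ h⟩
      choose v φ hvφ using hform
      have hμ0 : μ ≠ 0 := by
        rintro rfl
        have hbot : End.eigenspace (S 1) 0 = ⊥ := by
          rw [End.eigenspace_zero]
          exact (LinearMap.isUnit_iff_ker_eq_bot _).1 (hS.isUnit 1 le_rfl (by omega))
        rw [hbot, finrank_bot] at hμ
        omega
      exact hS.exists_commute_succ_of_rank_one (by omega) hdim hμ0 (fun i h1 hi ↦ (hvφ i h1 hi).1)
        (fun i h1 hi ↦ (hvφ i h1 hi).2.1) (fun i h1 hi ↦ (hvφ i h1 hi).2.2)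
  · exact hS.exists_commute_succ_of_eigenspace hdim (ih (k - 2) (by omega)) hμ hge

end SmallDimension

/-- If `λ` is an eigenvalue of `T (n-1)`, `f` its minimal polynomial,
`m = f / (X - λ)`, and `d = rank (m(T (n-1))) ≤ n - 5`, then the restriction of the
representation to `B_{n-2} × ⟨σ_{n-1}⟩` has a one-dimensional invariant subspace,
i.e. there is a common eigenvector of `T 1, …, T (n-3)` and `T (n-1)`. -/
theorem common_eigenvector_of_small_block_multiplicity (n r : ℕ) (hn : 6 ≤ n)
    (T : ℕ → Matrix (Fin r) (Fin r) ℂ)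
    (hunit : ∀ i, 1 ≤ i → i ≤ n - 1 → IsUnit (T i))
    (hbr : BraidRels n T)
    (lam : ℂ)
    (hlam : ∃ w : Fin r → ℂ, w ≠ 0 ∧ (T (n - 1)).mulVec w = lam • w)
    (hd : ((Polynomial.aeval (T (n - 1)))
        (minpoly ℂ (T (n - 1)) /ₘ (Polynomial.X - Polynomial.C lam))).rank ≤ n - 5) :
    ∃ w : Fin r → ℂ, w ≠ 0 ∧
      (∀ i, 1 ≤ i → i ≤ n - 3 → ∃ c : ℂ, (T i).mulVec w = c • w) ∧
      ∃ c : ℂ, (T (n - 1)).mulVec w = c • w := by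
  obtain ⟨hbraid, hcomm⟩ := hbr
  set A := T (n - 1) with hA
  set M := Polynomial.aeval A (minpoly ℂ A /ₘ (Polynomial.X - Polynomial.C lam)) with hM
  have hroot : (minpoly ℂ A).IsRoot lam := by
    obtain ⟨w, hw, hAw⟩ := hlam
    rw [← Matrix.minpoly_toLin']
    exact Module.End.isRoot_of_hasEigenvalue (Module.End.hasEigenvalue_of_hasEigenvector
      ⟨Module.End.mem_eigenspace_iff.2 (by simpa using hAw), hw⟩)
  have hmul := Polynomial.mul_divByMonic_eq_iff_isRoot.2 hroot
  have hAM : A * M = lam • M := by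
    have h := congrArg (Polynomial.aeval A) hmul
    rw [minpoly.aeval, map_mul, ← hM, map_sub, Polynomial.aeval_X, Polynomial.aeval_C, sub_mul,
      sub_eq_zero, ← Algebra.smul_def] at h
    exact h
  have hM0 : M ≠ 0 := by
    intro h0
    have hmin : minpoly ℂ A ≠ 0 := minpoly.ne_zero (Matrix.isIntegral A)
    have hlt := Polynomial.degree_divByMonic_lt (minpoly ℂ A) (Polynomial.X - Polynomial.C lam) hmin
      (by simp)
    refine (minpoly.degree_le_of_ne_zero ℂ A ?_ h0).not_gt hlt
    intro hz
    rw [hz, mul_zero] at hmul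
    exact hmin hmul.symm
  have hTM (i : ℕ) (h1 : 1 ≤ i) (hi : i ≤ n - 3) : Commute (T i) M :=
    (Algebra.commute_of_mem_adjoin_singleton_of_commute
      (Polynomial.aeval_mem_adjoin_singleton ℂ A)
      (hcomm i (n - 1) h1 (by omega) le_rfl))
  set W := LinearMap.range M.mulVecLin with hW
  have hinv (i : ℕ) (h1 : 1 ≤ i) (hi : i ≤ n - 3) (x : Fin r → ℂ) (hx : x ∈ W) :
      (T i).mulVecLin x ∈ W := by
    obtain ⟨y, rfl⟩ := hx
    refine ⟨(T i).mulVecLin y, ?_⟩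
    simp only [Matrix.mulVecLin_apply, Matrix.mulVec_mulVec, (hTM i h1 hi).eq]
  have hR (i : ℕ) : ∃ R : Module.End ℂ W, 1 ≤ i → i ≤ n - 3 →
      ∀ x : W, (R x : Fin r → ℂ) = (T i).mulVec x := by
    by_cases h : 1 ≤ i ∧ i ≤ n - 3
    · exact ⟨(T i).mulVecLin.restrict (hinv i h.1 h.2), fun _ _ _ ↦ rfl⟩
    · exact ⟨0, fun h1 h2 ↦ absurd ⟨h1, h2⟩ h⟩
  choose R hR using hR
  have hRS : IsBraidFamily_s3 (n - 3) R := by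
    refine ⟨fun i h1 hi ↦ ?_, fun i h1 hi ↦ ?_, fun i j h1 hij hj ↦ ?_⟩
    · rw [LinearMap.isUnit_iff_ker_eq_bot, LinearMap.ker_eq_bot]
      intro x y hxy
      refine Subtype.ext (Matrix.mulVec_injective_of_isUnit (hunit i h1 (by omega)) ?_)
      rw [← hR i h1 hi, ← hR i h1 hi, hxy]
    · refine LinearMap.ext fun x ↦ Subtype.ext ?_
      simp only [Module.End.mul_apply, hR i h1 (by omega), hR (i + 1) (by omega) hi,
        Matrix.mulVec_mulVec, ← mul_assoc, hbraid i h1 (by omega)]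
    · refine LinearMap.ext fun x ↦ Subtype.ext ?_
      simp only [Module.End.mul_apply, hR i h1 (by omega), hR j (by omega) hj,
        Matrix.mulVec_mulVec, hcomm i j h1 hij (by omega)]
  have hdim : Module.finrank ℂ W ≤ n - 5 := hd
  have hconst := IsBraidFamily_s3.eq_of_finrank_add_two_le (n - 3) W R hRS (by omega)
  have hWbot : W ≠ ⊥ := by
    intro h0
    rw [hW, LinearMap.range_eq_bot] at h0
    exact hM0 (Matrix.toLin'.injective (h0.trans (map_zero _).symm))
  have : Nontrivial W := Submodule.nontrivial_iff_ne_bot.2 hWbot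
  obtain ⟨c, hc⟩ := Module.End.exists_eigenvalue (R 1)
  obtain ⟨w, hw⟩ := hc.exists_hasEigenvector
  refine ⟨w, fun h ↦ hw.2 (Subtype.ext h), fun i h1 hi ↦ ⟨c, ?_⟩, lam, ?_⟩
  · rw [← hR i h1 hi, hconst i h1 hi, hw.apply_eq_smul]
    rfl
  · obtain ⟨y, hy⟩ := w.2
    rw [← hy, Matrix.mulVecLin_apply, Matrix.mulVec_mulVec, hAM, Matrix.smul_mulVec]
end

section
/- Let n ≥ 9 and let T_1, …, T_{n−1} ∈ GL_n(ℂ) be invertible matrices satisfying the braid relations, such that the representation they define is irreducible. Then there exists y ∈ ℂ with y ≠ 0 such that rank(T_1 − y·I_n) = 2; equivalently, the representation is the tensor product of the one-dimensional representation χ(y) sending each generator to y and a representation of corank 2 (namely the one given by the matrices y⁻¹T_i, which again satisfy the braid relations). -/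
open Module

/-- Invertible operators `T 0, …, T (m-1)` satisfying the braid relations of `B_{m+1}`. -/
structure IsBraid {V : Type} [AddCommGroup V] [Module ℂ V] {m : ℕ} (T : Fin m → End ℂ V) :
    Prop where
  inj : ∀ i, Function.Injective (T i)
  braid : ∀ i j : Fin m, (i : ℕ) + 1 = j → T i * T j * T i = T j * T i * T j
  comm : ∀ i j : Fin m, (i : ℕ) + 2 ≤ j → Commute (T i) (T j)

namespace IsBraid

section Basic

variable {V : Type} [AddCommGroup V] [Module ℂ V] {m : ℕ} {T : Fin m → End ℂ V}

theorem mul_left_cancel {A X Y : End ℂ V} (hA : Function.Injective A)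
    (h : A * X = A * Y) : X = Y := by
  ext v
  exact hA (by simpa using congrArg (fun f : End ℂ V => f v) h)

theorem mul_right_cancel [FiniteDimensional ℂ V] {A X Y : End ℂ V}
    (hA : Function.Injective A) (h : X * A = Y * A) : X = Y := by
  ext v
  obtain ⟨w, rfl⟩ := LinearMap.surjective_of_injective hA v
  simpa using congrArg (fun f : End ℂ V => f w) h

theorem eq_of_commute_of_braid {A B : End ℂ V} (hA : Function.Injective A)
    (hB : Function.Injective B) (hc : Commute A B) (h : A * B * A = B * A * B) : A = B := by
  have h1 : A * B = B * B := by
    apply mul_left_cancel hA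
    calc A * (A * B) = A * B * A := by rw [mul_assoc, hc.eq]
      _ = B * A * B := h
      _ = A * (B * B) := by rw [← hc.eq, mul_assoc]
  exact (mul_left_cancel hB (h1.symm.trans hc.eq)).symm

theorem eq_of_commute (hT : IsBraid T) {i j : Fin m} (hij : (i : ℕ) + 1 = j)
    (hc : Commute (T i) (T j)) : T i = T j :=
  eq_of_commute_of_braid (hT.inj i) (hT.inj j) hc (hT.braid i j hij)

/-- If two neighbouring generators agree then all generators agree. -/
theorem all_eq (hT : IsBraid T) {a b : Fin m} (hab : (a : ℕ) + 1 = b) (h : T a = T b)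
    (i j : Fin m) : T i = T j := by
  have up : ∀ k (hk : k + 2 < m), T ⟨k, by omega⟩ = T ⟨k + 1, by omega⟩ →
      T ⟨k + 1, by omega⟩ = T ⟨k + 2, hk⟩ := fun k hk e =>
    hT.eq_of_commute rfl (e ▸ hT.comm ⟨k, by omega⟩ ⟨k + 2, hk⟩ le_rfl)
  have down : ∀ k (hk : k + 2 < m), T ⟨k + 1, by omega⟩ = T ⟨k + 2, hk⟩ →
      T ⟨k, by omega⟩ = T ⟨k + 1, by omega⟩ := fun k hk e =>
    hT.eq_of_commute rfl (e ▸ hT.comm ⟨k, by omega⟩ ⟨k + 2, hk⟩ le_rfl)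
  have zero : ∀ k (hk : k + 1 < m), T ⟨k, by omega⟩ = T ⟨k + 1, hk⟩ →
      T ⟨0, by omega⟩ = T ⟨1, by omega⟩ := by
    intro k
    induction k with
    | zero => exact fun _ e => e
    | succ k ih => exact fun hk e => ih (by omega) (down k hk e)
  obtain ⟨a, ha⟩ := a
  obtain ⟨b, hb⟩ := b
  simp only at hab
  subst hab
  have h0 := zero a hb h
  have step : ∀ k (hk : k + 1 < m), T ⟨k, by omega⟩ = T ⟨k + 1, hk⟩ := by
    intro k
    induction k with
    | zero => exact fun _ => h0
    | succ k ih => exact fun hk => up k hk (ih (by omega))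
  have base : ∀ k (hk : k < m), T ⟨k, hk⟩ = T ⟨0, by omega⟩ := by
    intro k
    induction k with
    | zero => exact fun _ => rfl
    | succ k ih => exact fun hk => (step k hk).symm.trans (ih (by omega))
  exact (base i i.2).trans (base j j.2).symm

/-- If two distant generators agree then all generators agree. -/
theorem all_eq_of_far (hT : IsBraid T) (hm : 4 ≤ m) {a b : Fin m} (hab : (a : ℕ) + 2 ≤ b)
    (h : T a = T b) (i j : Fin m) : T i = T j := by
  by_cases hb : (b : ℕ) + 1 < m
  · have hc := hT.comm a ⟨b + 1, hb⟩ (by simp only; omega)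
    rw [h] at hc
    exact hT.all_eq (a := b) (b := ⟨b + 1, hb⟩) rfl (hT.eq_of_commute rfl hc) i j
  by_cases ha : (a : ℕ) = 0
  · have hc := hT.comm ⟨a + 1, by omega⟩ b (by simp only; omega)
    rw [← h] at hc
    exact hT.all_eq (a := a) (b := ⟨a + 1, by omega⟩) rfl (hT.eq_of_commute rfl hc.symm) i j
  · have hc := hT.comm ⟨a - 1, by omega⟩ b (by simp only; omega)
    rw [← h] at hc
    have e : (a : ℕ) - 1 + 1 = a := by omega
    exact hT.all_eq (a := ⟨a - 1, by omega⟩) (b := a) e (hT.eq_of_commute e hc) i j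

theorem rev (hT : IsBraid T) : IsBraid (fun i => T i.rev) where
  inj i := hT.inj _
  braid i j hij := (hT.braid j.rev i.rev (by simp only [Fin.val_rev]; omega)).symm
  comm i j hij := (hT.comm j.rev i.rev (by simp only [Fin.val_rev]; omega)).symm

/-- The generators commuting with `T 0`. -/
theorem tail {m : ℕ} {T : Fin (m + 2) → End ℂ V} (hT : IsBraid T) :
    IsBraid (fun i : Fin m => T (i.natAdd 2 |>.cast (add_comm 2 m))) where
  inj i := hT.inj _
  braid i j hij := hT.braid _ _ (by simp; omega)
  comm i j hij := hT.comm _ _ (by simp; omega)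

theorem restrict (hT : IsBraid T) {p : Submodule ℂ V} (hp : ∀ i, ∀ v ∈ p, T i v ∈ p) :
    IsBraid (fun i => (T i).restrict (hp i)) where
  inj i := fun v w h => Subtype.ext (hT.inj i (congrArg Subtype.val h))
  braid i j hij := by
    ext v
    simpa using congrArg (fun f : End ℂ V => f v) (hT.braid i j hij)
  comm i j hij := by
    ext v
    simpa using congrArg (fun f : End ℂ V => f v) (hT.comm i j hij).eq

end Basic

section Extension

variable {V : Type} [AddCommGroup V] [Module ℂ V]

theorem braid_sub {A B x : End ℂ V} (hx : x = A - B) (h : A * B * A = B * A * B)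
    (h0 : x * A * x = 0) : A * x * A = x * A * A + A * A * x := by
  obtain rfl : B = A - x := by rw [hx]; abel
  have : A * x * A - (x * A * A + A * A * x) + x * A * x =
      (A - x) * A * (A - x) - A * (A - x) * A := by noncomm_ring
  rw [h0, add_zero, ← h, sub_self] at this
  exact sub_eq_zero.mp this

/-- If three operators satisfying the braid relations of `B_4` agree both on the kernel and on the
range of an operator `P` commuting with them, then the outer two of them agree. -/
theorem eq_of_agree {A B C P : End ℂ V} (hA : Function.Injective A)
    (hAB : A * B * A = B * A * B) (hBC : B * C * B = C * B * C) (hAC : Commute A C)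
    (pA : Commute A P) (pB : Commute B P) (pC : Commute C P)
    (bP : (A - B) * P = 0) (cP : (B - C) * P = 0)
    (bK : ∀ v, P v = 0 → (A - B) v = 0) (cK : ∀ v, P v = 0 → (B - C) v = 0) : A = C := by
  obtain ⟨b, hb⟩ : ∃ b, b = A - B := ⟨_, rfl⟩
  obtain ⟨c, hc⟩ : ∃ c, c = B - C := ⟨_, rfl⟩
  rw [← hb] at bP bK
  rw [← hc] at cP cK
  have pb : Commute b P := hb ▸ pA.sub_left pB
  have pc : Commute c P := hc ▸ pB.sub_left pC
  have key : ∀ x : End ℂ V, (∀ v, P v = 0 → x v = 0) → ∀ X : End ℂ V, Commute X P →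
      ∀ z : End ℂ V, Commute z P → z * P = 0 → x * X * z = 0 := by
    intro x hx X hX z hz hzP
    ext v
    apply hx
    have : P * (X * z) = 0 := by rw [← mul_assoc, ← hX.eq, mul_assoc, ← hz.eq, hzP, mul_zero]
    exact congrArg (fun f : End ℂ V => f v) this
  have bc : b * c = 0 := by simpa using key b bK 1 (Commute.one_left _) c pc cP
  have cb : c * b = 0 := by simpa using key c cK 1 (Commute.one_left _) b pb bP
  have bAc := key b bK A pA c pc cP
  have cAb := key c cK A pA b pb bP
  have eB : B = A - b := by rw [hb]; abel
  have e1 := braid_sub hb hAB (key b bK A pA b pb bP)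
  have e2 := braid_sub hc hBC (key c cK B pB c pc cP)
  have hBc : B * c = A * c := by rw [eB, sub_mul, bc, sub_zero]
  have hcB : c * B = c * A := by rw [eB, mul_sub, cb, sub_zero]
  have hcAB : c * A * B = c * A * A := by rw [eB, mul_sub, cAb, sub_zero]
  have hBAc : B * (A * c) = A * A * c := by rw [eB, sub_mul, ← mul_assoc b, bAc, sub_zero, mul_assoc]
  rw [hBc, mul_assoc A c B, hcB, hcAB, mul_assoc B B c, hBc, hBAc, ← mul_assoc] at e2
  have comm : b * A + c * A = A * b + A * c := by
    have h : b + c = A - C := by rw [hb, hc]; abel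
    rw [← add_mul, ← mul_add, h, sub_mul, mul_sub, hAC.eq]
  have e3 : A * (b * A + c * A) = (b * A + c * A) * A + A * (A * b + A * c) := by
    rw [mul_add, ← mul_assoc, ← mul_assoc, e1, e2]
    noncomm_ring
  rw [comm] at e3
  have e4 : (A * b + A * c) * A = A * (A * b + A * c) := by
    rw [← mul_add, mul_assoc, add_mul, comm, mul_add A b c]
  have e5 : A * (A * (b + c)) = A * (A * 0) := by
    rw [e4, left_eq_add] at e3
    rw [mul_add A b c, e3, mul_zero, mul_zero]
  have e6 := mul_left_cancel hA (mul_left_cancel hA e5)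
  rw [hb, hc, sub_add_sub_cancel] at e6
  exact sub_eq_zero.mp e6

end Extension

section Jump

/-- All representations of `B_{m+1}` of dimension less than `D` have equal generators. -/
def Rigid (m D : ℕ) : Prop :=
  ∀ (W : Type) [AddCommGroup W] [Module ℂ W] [FiniteDimensional ℂ W] (T : Fin m → End ℂ W),
    IsBraid T → finrank ℂ W < D → ∀ i j, T i = T j

theorem commute_sub_smul_one {V : Type} [AddCommGroup V] [Module ℂ V] {A S : End ℂ V}
    (h : Commute A S) (y : ℂ) : Commute A (S - y • 1) :=
  h.sub_right ((Commute.one_right A).smul_right y)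

theorem finrank_ker_restrict_le {V : Type} [AddCommGroup V] [Module ℂ V] [FiniteDimensional ℂ V]
    {S : End ℂ V} {p : Submodule ℂ V} (hp : ∀ v ∈ p, S v ∈ p) (z : ℂ) :
    finrank ℂ (LinearMap.ker (S.restrict hp - z • 1)) ≤
      finrank ℂ (LinearMap.ker (S - z • 1)) := by
  have hle : (LinearMap.ker (S.restrict hp - z • 1)).map p.subtype ≤
      LinearMap.ker (S - z • 1) := by
    rintro _ ⟨v, hv, rfl⟩
    have := congrArg Subtype.val (LinearMap.mem_ker.mp hv)
    simpa using this
  rw [← Submodule.finrank_map_subtype_eq]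
  exact Submodule.finrank_mono hle

theorem finrank_ker_pos {V : Type} [AddCommGroup V] [Module ℂ V] [FiniteDimensional ℂ V]
    {S : End ℂ V} {y : ℂ} (hy : S.HasEigenvalue y) :
    0 < finrank ℂ (LinearMap.ker (S - y • 1)) := by
  obtain ⟨v, hv⟩ := hy.exists_hasEigenvector
  have hv' : v ∈ LinearMap.ker (S - y • 1) := by simp [hv.apply_eq_smul]
  have : Nontrivial (LinearMap.ker (S - y • 1)) :=
    ⟨⟨v, hv'⟩, 0, fun h => hv.2 (congrArg Subtype.val h)⟩
  exact finrank_pos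

/-- A representation of `B_{m+1}` commuting with an operator all of whose eigenspaces are small
has equal generators. -/
theorem all_eq_of_centralizer {m D : ℕ} (hm : 4 ≤ m) (hD : Rigid m D) {V : Type}
    [AddCommGroup V] [Module ℂ V] [FiniteDimensional ℂ V] {T : Fin m → End ℂ V}
    (hT : IsBraid T) {S : End ℂ V} (hS : ∀ i, Commute (T i) S)
    (hker : ∀ y : ℂ, finrank ℂ (LinearMap.ker (S - y • 1)) < D) (i j : Fin m) : T i = T j := by
  obtain ⟨d, hd⟩ : ∃ d, finrank ℂ V = d := ⟨_, rfl⟩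
  induction d using Nat.strong_induction_on generalizing V i j with
  | _ d ih =>
  rcases subsingleton_or_nontrivial V with hV | hV
  · ext v
    exact Subsingleton.elim _ _
  obtain ⟨y, hy⟩ := Module.End.exists_eigenvalue S
  obtain ⟨P, hP⟩ : ∃ P, P = S - y • 1 := ⟨_, rfl⟩
  have hTP : ∀ i, Commute (T i) P := fun i => hP ▸ commute_sub_smul_one (hS i) y
  have hSP : Commute S P := hP ▸ commute_sub_smul_one (Commute.refl S) y
  have swap : ∀ {A : End ℂ V}, Commute A P → ∀ v, A (P v) = P (A v) := fun h v =>
    congrArg (fun f : End ℂ V => f v) h.eq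
  have kerT : ∀ i, ∀ v ∈ LinearMap.ker P, T i v ∈ LinearMap.ker P := by
    intro i v hv
    rw [LinearMap.mem_ker] at hv ⊢
    rw [← swap (hTP i), hv, map_zero]
  have ranT : ∀ i, ∀ v ∈ LinearMap.range P, T i v ∈ LinearMap.range P := by
    rintro i _ ⟨v, rfl⟩
    exact ⟨T i v, (swap (hTP i) v).symm⟩
  have ranS : ∀ v ∈ LinearMap.range P, S v ∈ LinearMap.range P := by
    rintro _ ⟨v, rfl⟩
    exact ⟨S v, (swap hSP v).symm⟩
  have onKer : ∀ i j, ∀ v, P v = 0 → (T i - T j) v = 0 := by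
    intro i j v hv
    have h := hD _ _ (hT.restrict kerT) (hP ▸ hker y) i j
    have := congrArg (fun f : End ℂ (LinearMap.ker P) => (f ⟨v, hv⟩ : V)) h
    simpa [sub_eq_zero] using this
  have hlt : finrank ℂ (LinearMap.range P) < d := by
    have h1 := LinearMap.finrank_range_add_finrank_ker P
    have h2 : 0 < finrank ℂ (LinearMap.ker P) := hP ▸ finrank_ker_pos hy
    omega
  have onRange : ∀ i j, (T i - T j) * P = 0 := by
    intro i j
    have h := ih _ hlt (hT.restrict ranT) (S := S.restrict ranS) (fun i => by
        ext v
        simpa using congrArg (fun f : End ℂ V => f v) (hS i).eq) (fun z => by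
        exact lt_of_le_of_lt (finrank_ker_restrict_le ranS z) (hker z)) i j rfl
    ext v
    have := congrArg (fun f : End ℂ (LinearMap.range P) => (f ⟨P v, v, rfl⟩ : V)) h
    simpa [sub_eq_zero] using this
  refine hT.all_eq_of_far hm (a := ⟨0, by omega⟩) (b := ⟨2, by omega⟩) le_rfl ?_ i j
  exact eq_of_agree (hT.inj _) (hT.braid _ ⟨1, by omega⟩ rfl) (hT.braid ⟨1, by omega⟩ _ rfl)
    (hT.comm _ _ le_rfl) (hTP _) (hTP _) (hTP _) (onRange _ _) (onRange _ _) (onKer _ _) (onKer _ _)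

end Jump

section Regular

open Polynomial

theorem aeval_restrict {V : Type} [AddCommGroup V] [Module ℂ V] {S : End ℂ V}
    {p : Submodule ℂ V} (hp : ∀ v ∈ p, S v ∈ p) (r : ℂ[X]) (v : p) :
    (aeval (S.restrict hp) r v : V) = aeval S r v := by
  induction r using Polynomial.induction_on' with
  | add f g hf hg => simp [hf, hg]
  | monomial k a =>
    have : ∀ k : ℕ, (((S.restrict hp) ^ k) v : V) = (S ^ k) v := by
      intro k
      induction k with
      | zero => rfl
      | succ k ih => simp [pow_succ', ih]
    simp [aeval_monomial, Module.algebraMap_end_apply, this]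

/-- Operators commuting with an operator whose eigenspaces are at most one-dimensional are
polynomials in that operator. -/
theorem exists_aeval_eq {V : Type} [AddCommGroup V] [Module ℂ V] [FiniteDimensional ℂ V]
    {S X : End ℂ V} (hX : Commute X S)
    (hker : ∀ y : ℂ, finrank ℂ (LinearMap.ker (S - y • 1)) ≤ 1) :
    ∃ p : Polynomial ℂ, X = aeval S p := by
  obtain ⟨d, hd⟩ : ∃ d, finrank ℂ V = d := ⟨_, rfl⟩
  induction d using Nat.strong_induction_on generalizing V with
  | _ d ih =>
  rcases subsingleton_or_nontrivial V with hV | hV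
  · exact ⟨0, by ext v; exact Subsingleton.elim _ _⟩
  obtain ⟨y, hy⟩ := Module.End.exists_eigenvalue S
  obtain ⟨P, hP⟩ : ∃ P, P = S - y • 1 := ⟨_, rfl⟩
  have hXP : Commute X P := hP ▸ commute_sub_smul_one hX y
  have hSP : Commute S P := hP ▸ commute_sub_smul_one (Commute.refl S) y
  have swap : ∀ {A : End ℂ V}, Commute A P → ∀ v, A (P v) = P (A v) := fun h v =>
    congrArg (fun f : End ℂ V => f v) h.eq
  have ran : ∀ {A : End ℂ V}, Commute A P →
      ∀ v ∈ LinearMap.range P, A v ∈ LinearMap.range P := by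
    rintro A hA _ ⟨v, rfl⟩
    exact ⟨A v, (swap hA v).symm⟩
  have hrk := LinearMap.finrank_range_add_finrank_ker P
  have hlt : finrank ℂ (LinearMap.range P) < d := by
    have h2 : 0 < finrank ℂ (LinearMap.ker P) := hP ▸ finrank_ker_pos hy
    omega
  obtain ⟨r, hr⟩ := ih _ hlt (S := S.restrict (ran hSP)) (X := X.restrict (ran hXP)) (by
        ext v
        simpa using congrArg (fun f : End ℂ V => f v) hX.eq) (fun z => by
        exact (finrank_ker_restrict_le (ran hSP) z).trans (hker z)) rfl
  have hZ : (X - aeval S r) * P = 0 := by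
    ext v
    have := congrArg (fun f : End ℂ (LinearMap.range P) => (f ⟨P v, v, rfl⟩ : V)) hr
    rw [aeval_restrict] at this
    simpa [sub_eq_zero] using this
  have hroot : (minpoly ℂ S).IsRoot y := Module.End.isRoot_of_hasEigenvalue hy
  obtain ⟨q, hq⟩ := dvd_iff_isRoot.mpr hroot
  have hne : minpoly ℂ S ≠ 0 := minpoly.ne_zero (Algebra.IsIntegral.isIntegral S)
  have haX : aeval S (Polynomial.X - C y) = P := by
    rw [hP, map_sub, aeval_X, aeval_C, Algebra.algebraMap_eq_smul_one]
  have hPQ : P * aeval S q = 0 := by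
    rw [← haX, ← map_mul, ← hq, minpoly.aeval]
  have hQP : aeval S q * P = 0 := by
    rw [← haX, ← map_mul, mul_comm, ← hq, minpoly.aeval]
  have hQ : aeval S q ≠ 0 := by
    intro h0
    have hq0 : q ≠ 0 := fun h => hne (by rw [hq, h, mul_zero])
    have h1 := natDegree_le_of_dvd (minpoly.dvd ℂ S h0) hq0
    rw [hq, natDegree_mul (X_sub_C_ne_zero y) hq0, natDegree_X_sub_C] at h1
    omega
  obtain ⟨w, hw⟩ : ∃ w, aeval S q w ≠ 0 := by
    by_contra! h
    exact hQ (LinearMap.ext h)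
  have hcommr : Commute (aeval S r) P := by
    rw [← haX, Commute, SemiconjBy, ← map_mul, ← map_mul, mul_comm]
  have hPZ : P * (X - aeval S r) = 0 := by
    rw [← (hXP.sub_left hcommr).eq, hZ]
  obtain ⟨c, hc⟩ : ∃ c : ℂ, c • aeval S q w = (X - aeval S r) w := by
    have hmem : aeval S q w ∈ LinearMap.ker P := congrArg (fun f : End ℂ V => f w) hPQ
    have hmem' : (X - aeval S r) w ∈ LinearMap.ker P := congrArg (fun f : End ℂ V => f w) hPZ
    obtain ⟨u, hu⟩ := finrank_le_one_iff.mp (hP ▸ hker y)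
    obtain ⟨a, ha⟩ := hu ⟨_, hmem⟩
    obtain ⟨b, hb⟩ := hu ⟨_, hmem'⟩
    have ha' := congrArg Subtype.val ha
    have hb' := congrArg Subtype.val hb
    simp only [Submodule.coe_smul] at ha' hb'
    have ha0 : a ≠ 0 := fun h => hw (by rw [← ha', h, zero_smul])
    refine ⟨b / a, ?_⟩
    rw [← ha', ← hb', smul_smul, div_mul_cancel₀ _ ha0]
  refine ⟨r + C c * q, ?_⟩
  have htop : LinearMap.range P ⊔ Submodule.span ℂ {w} = ⊤ := by
    have hlt' : LinearMap.range P < LinearMap.range P ⊔ Submodule.span ℂ {w} := by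
      refine lt_of_le_of_ne le_sup_left fun h => ?_
      have : w ∈ LinearMap.range P := by
        rw [h]
        exact Submodule.mem_sup_right (Submodule.mem_span_singleton_self w)
      obtain ⟨v, rfl⟩ := this
      exact hw (congrArg (fun f : End ℂ V => f v) hQP)
    have h1 := Submodule.finrank_lt_finrank_of_lt hlt'
    have h2 := Submodule.finrank_le (LinearMap.range P ⊔ Submodule.span ℂ {w})
    have h3 := hP ▸ hker y
    exact Submodule.eq_top_of_finrank_eq (by omega)
  have hzero : X - aeval S r - c • aeval S q = 0 := by
    have hle : LinearMap.range P ⊔ Submodule.span ℂ {w} ≤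
        LinearMap.ker (X - aeval S r - c • aeval S q) := by
      refine sup_le ?_ ?_
      · rintro _ ⟨v, rfl⟩
        have h1 := congrArg (fun f : End ℂ V => f v) hZ
        have h2 := congrArg (fun f : End ℂ V => f v) hQP
        simp only [Module.End.mul_apply, LinearMap.zero_apply] at h1 h2
        rw [LinearMap.mem_ker, LinearMap.sub_apply, h1, LinearMap.smul_apply, h2, smul_zero,
          sub_zero]
      · rw [Submodule.span_singleton_le_iff_mem, LinearMap.mem_ker, LinearMap.sub_apply, ← hc,
          LinearMap.smul_apply, sub_self]
    rw [htop, top_le_iff] at hle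
    exact LinearMap.ker_eq_top.mp hle
  rw [map_add, map_mul, aeval_C, Algebra.algebraMap_eq_smul_one, smul_mul_assoc, one_mul]
  rw [sub_sub] at hzero
  exact sub_eq_zero.mp hzero

theorem commute_of_regular {V : Type} [AddCommGroup V] [Module ℂ V] [FiniteDimensional ℂ V]
    {S X Y : End ℂ V} (hX : Commute X S) (hY : Commute Y S)
    (hker : ∀ y : ℂ, finrank ℂ (LinearMap.ker (S - y • 1)) ≤ 1) : Commute X Y := by
  obtain ⟨p, rfl⟩ := exists_aeval_eq hX hker
  obtain ⟨q, rfl⟩ := exists_aeval_eq hY hker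
  rw [Commute, SemiconjBy, ← map_mul, ← map_mul, mul_comm]

end Regular

section Rank

variable {V : Type} [AddCommGroup V] [Module ℂ V] [FiniteDimensional ℂ V] {m : ℕ}
  {T : Fin m → End ℂ V}

theorem finrank_range_eq_of_conj {g A B : End ℂ V} (hg : Function.Injective g)
    (h : g * A = B * g) :
    finrank ℂ (LinearMap.range A) = finrank ℂ (LinearMap.range B) := by
  have hs := LinearMap.surjective_of_injective hg
  have e : (LinearMap.range A).map g = LinearMap.range B := by
    rw [← LinearMap.range_comp, ← Module.End.mul_eq_comp, h, Module.End.mul_eq_comp,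
      LinearMap.range_comp_of_range_eq_top _ (LinearMap.range_eq_top.mpr hs)]
  rw [← e]
  exact (LinearEquiv.finrank_eq (Submodule.equivMapOfInjective g hg _))

theorem conj {V : Type} [AddCommGroup V] [Module ℂ V] {T : Fin m → End ℂ V} (hT : IsBraid T) {i j : Fin m} (hij : (i : ℕ) + 1 = j) :
    T i * T j * T i = T j * (T i * T j) := by
  rw [hT.braid i j hij, mul_assoc]

theorem conj_sub {V : Type} [AddCommGroup V] [Module ℂ V] {g A B : End ℂ V}
    (h : g * A = B * g) (y : ℂ) : g * (A - y • 1) = (B - y • 1) * g := by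
  rw [mul_sub, sub_mul, h, mul_smul_comm, smul_mul_assoc, mul_one, one_mul]

theorem mul_inj {V : Type} [AddCommGroup V] [Module ℂ V] {A B : End ℂ V}
    (hA : Function.Injective A) (hB : Function.Injective B) : Function.Injective (A * B) :=
  hA.comp hB

/-- A property of operators which passes from each generator to the next one, and which holds for
the first generator, holds for all of them. -/
theorem forall_of_zero {m : ℕ} {p : Fin m → Prop} (hm : 0 < m) (h0 : p ⟨0, hm⟩)
    (step : ∀ i j : Fin m, (i : ℕ) + 1 = j → p i → p j) (i : Fin m) : p i := by
  obtain ⟨i, hi⟩ := i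
  induction i with
  | zero => exact h0
  | succ i ih => exact step ⟨i, by omega⟩ _ rfl (ih (by omega))

theorem finrank_range_eq (hT : IsBraid T) (y : ℂ) (hm : 0 < m) (i : Fin m) :
    finrank ℂ (LinearMap.range (T i - y • 1)) =
      finrank ℂ (LinearMap.range (T ⟨0, hm⟩ - y • 1)) := by
  refine forall_of_zero (p := fun i => finrank ℂ (LinearMap.range (T i - y • 1)) =
      finrank ℂ (LinearMap.range (T ⟨0, hm⟩ - y • 1))) hm rfl (fun i j hij h => ?_) i
  rw [← h]
  exact (finrank_range_eq_of_conj (mul_inj (hT.inj i) (hT.inj j)) (conj_sub (hT.conj hij) y)).symm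

theorem conj_two {V : Type} [AddCommGroup V] [Module ℂ V] {a b c : End ℂ V}
    (hab : a * b * a = b * a * b) (hbc : b * c * b = c * b * c) (hac : a * c = c * a) :
    a * b * c * a = b * (a * b * c) ∧ a * b * c * b = c * (a * b * c) := by
  constructor
  · rw [mul_assoc (a * b), ← hac, ← mul_assoc, hab]
    simp only [mul_assoc]
  · rw [mul_assoc, mul_assoc, ← mul_assoc b, hbc, ← mul_assoc, ← mul_assoc, hac]
    simp only [mul_assoc]

theorem finrank_range_mul_eq (hT : IsBraid T) (y : ℂ) (hm : 1 < m) {i j : Fin m}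
    (hij : (i : ℕ) + 1 = j) :
    finrank ℂ (LinearMap.range ((T j - y • 1) * (T i - y • 1))) =
      finrank ℂ (LinearMap.range ((T ⟨1, hm⟩ - y • 1) * (T ⟨0, by omega⟩ - y • 1))) := by
  obtain ⟨i, hi⟩ := i
  obtain ⟨j, hj⟩ := j
  simp only at hij
  subst hij
  induction i with
  | zero => rfl
  | succ i ih =>
    rw [← ih (by omega) (by omega)]
    have inj := mul_inj (mul_inj (hT.inj ⟨i, by omega⟩) (hT.inj ⟨i + 1, hi⟩))
      (hT.inj ⟨i + 1 + 1, hj⟩)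
    have h01 := hT.braid ⟨i, by omega⟩ ⟨i + 1, hi⟩ rfl
    have h12 := hT.braid ⟨i + 1, hi⟩ ⟨i + 1 + 1, hj⟩ rfl
    have h02 := (hT.comm ⟨i, by omega⟩ ⟨i + 1 + 1, hj⟩ le_rfl).eq
    obtain ⟨ca, cb⟩ := conj_two h01 h12 h02
    symm
    refine finrank_range_eq_of_conj inj ?_
    rw [← mul_assoc, conj_sub cb, mul_assoc, conj_sub ca]
    simp only [mul_assoc]

theorem mul_eq_zero_of_far (hT : IsBraid T) (y : ℂ) (hm : 0 < m)
    (h0 : ∀ j : Fin m, 2 ≤ (j : ℕ) → (T j - y • 1) * (T ⟨0, hm⟩ - y • 1) = 0) (i : Fin m) :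
    ∀ j : Fin m, (i : ℕ) + 2 ≤ j → (T j - y • 1) * (T i - y • 1) = 0 := by
  refine forall_of_zero (p := fun i => ∀ j : Fin m, (i : ℕ) + 2 ≤ j →
    (T j - y • 1) * (T i - y • 1) = 0) hm (fun j hj => h0 j (by simpa using hj))
    (fun i k hik h j hj => ?_) i
  have hc : T i * T k * T j = T j * (T i * T k) := by
    rw [mul_assoc, (hT.comm k j hj).eq, ← mul_assoc, (hT.comm i j (by omega)).eq, mul_assoc]
  apply mul_right_cancel (mul_inj (hT.inj i) (hT.inj k))
  rw [mul_assoc, ← conj_sub (hT.conj hik), ← mul_assoc, ← conj_sub hc, mul_assoc,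
    h j (by omega), mul_zero, zero_mul]

/-- If operators `A 0, …, A (m-1)` at distance at least two annihilate each other, the ambient
dimension is at least `m - 1` times a common lower bound for the ranks of the products of
neighbours. -/
theorem chain_bound {A : Fin m → End ℂ V} {s : ℕ}
    (hz : ∀ i j : Fin m, (i : ℕ) + 2 ≤ j → A j * A i = 0)
    (hs : ∀ i j : Fin m, (i : ℕ) + 1 = j → s ≤ finrank ℂ (LinearMap.range (A j * A i))) :
    (m - 1) * s ≤ finrank ℂ V := by
  let N : ℕ → Submodule ℂ V := fun t => ⨅ j : Fin m, ⨅ _ : t ≤ (j : ℕ), LinearMap.ker (A j)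
  have memN : ∀ t v, v ∈ N t ↔ ∀ j : Fin m, t ≤ (j : ℕ) → A j v = 0 := by
    intro t v
    simp [N, Submodule.mem_iInf]
  have main : ∀ t, t + 1 ≤ m → t * s ≤ finrank ℂ (N (t + 1)) := by
    intro t
    induction t with
    | zero => simp
    | succ t ih =>
      intro ht
      have h1 := ih (by omega)
      have ht' : t + 1 < m := by omega
      let f := (A ⟨t + 1, ht'⟩).domRestrict (N (t + 1 + 1))
      have h2 := LinearMap.finrank_range_add_finrank_ker f
      have h3 : finrank ℂ (N (t + 1)) ≤ finrank ℂ (LinearMap.ker f) := by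
        rw [← Submodule.finrank_map_subtype_eq]
        refine Submodule.finrank_mono fun v hv => ?_
        rw [memN] at hv
        refine ⟨⟨v, (memN _ _).mpr fun j hj => hv j (by omega)⟩, ?_, rfl⟩
        exact hv _ le_rfl
      have h4 : s ≤ finrank ℂ (LinearMap.range f) := by
        refine (hs ⟨t, by omega⟩ ⟨t + 1, ht'⟩ rfl).trans (Submodule.finrank_mono ?_)
        rintro _ ⟨v, rfl⟩
        refine ⟨⟨A ⟨t, by omega⟩ v, (memN _ _).mpr fun j hj => ?_⟩, rfl⟩
        exact congrArg (fun g : End ℂ V => g v) (hz ⟨t, by omega⟩ j hj)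
      rw [add_mul, one_mul]
      omega
  rcases Nat.eq_zero_or_pos m with h | h
  · simp [h]
  · exact (main (m - 1) (by omega)).trans (Submodule.finrank_le _)

theorem exists_sq_eq_smul {V : Type} [AddCommGroup V] [Module ℂ V] [FiniteDimensional ℂ V]
    {A : End ℂ V} (hA : finrank ℂ (LinearMap.range A) ≤ 1) : ∃ t : ℂ, A * A = t • A := by
  obtain ⟨u, hu⟩ := finrank_le_one_iff.mp hA
  obtain ⟨t, ht⟩ := hu ⟨A u, _, rfl⟩
  refine ⟨t, LinearMap.ext fun v => ?_⟩
  obtain ⟨d, hd⟩ := hu ⟨A v, v, rfl⟩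
  have ht' : t • (u : V) = A u := congrArg Subtype.val ht
  have hd' : d • (u : V) = A v := congrArg Subtype.val hd
  rw [Module.End.mul_apply, LinearMap.smul_apply, ← hd', map_smul, ← ht', smul_comm]

theorem braid_expand {V : Type} [AddCommGroup V] [Module ℂ V] {X Y A B : End ℂ V} {y : ℂ}
    (hA : A = X - y • 1) (hB : B = Y - y • 1) (h : X * Y * X = Y * X * Y) :
    A * B * A + y • (A * A) + (y * y) • A = B * A * B + y • (B * B) + (y * y) • B := by
  obtain rfl : X = A + y • 1 := by rw [hA]; abel
  obtain rfl : Y = B + y • 1 := by rw [hB]; abel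
  rw [← sub_eq_zero] at h ⊢
  rw [← h]
  simp only [mul_add, add_mul, smul_mul_assoc, mul_smul_comm, mul_one, one_mul, smul_add, smul_smul]
  module

/-- A representation of `B_{m+1}` in which the generators are perturbations of a scalar by
operators of rank at most one has equal generators when its dimension is at most `m - 2`. -/
theorem all_eq_of_corank_one (hT : IsBraid T) (hm : 4 ≤ m) (hV : finrank ℂ V + 2 ≤ m) {y : ℂ}
    (hy : y ≠ 0) (h1 : finrank ℂ (LinearMap.range (T ⟨0, by omega⟩ - y • 1)) ≤ 1)
    (i j : Fin m) : T i = T j := by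
  by_contra hne
  obtain ⟨A, hA⟩ : ∃ A : Fin m → End ℂ V, ∀ i, A i = T i - y • 1 := ⟨_, fun _ => rfl⟩
  have eq_of : ∀ {i j}, A i = A j → T i = T j := fun h => by
    rw [hA, hA] at h
    exact sub_left_injective h
  have rk : ∀ i, finrank ℂ (LinearMap.range (A i)) ≤ 1 := fun i => by
    rw [hA, hT.finrank_range_eq y (by omega)]
    exact h1
  have cA : ∀ i j : Fin m, (i : ℕ) + 2 ≤ j → Commute (A i) (A j) := fun i j hij => by
    rw [hA, hA]
    exact commute_sub_smul_one (commute_sub_smul_one (hT.comm i j hij).symm y).symm y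
  obtain ⟨t, ht0⟩ := exists_sq_eq_smul (rk ⟨0, by omega⟩)
  have ht : ∀ i, A i * A i = t • A i := by
    refine forall_of_zero (by omega) ht0 fun i j hij h => ?_
    have hg : T i * T j * A i = A j * (T i * T j) := by
      rw [hA, hA]
      exact conj_sub (hT.conj hij) y
    apply mul_right_cancel (mul_inj (hT.inj i) (hT.inj j))
    rw [mul_assoc, ← hg, ← mul_assoc, ← hg, mul_assoc, h, mul_smul_comm, hg, smul_mul_assoc]
  have hz : ∀ i j : Fin m, (i : ℕ) + 2 ≤ j → A j * A i = 0 := by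
    intro i j hij
    by_contra h0
    have hpos : 1 ≤ finrank ℂ (LinearMap.range (A j * A i)) := by
      rw [Nat.one_le_iff_ne_zero, Ne, Submodule.finrank_eq_zero, LinearMap.range_eq_bot]
      exact h0
    have hle1 : LinearMap.range (A j * A i) ≤ LinearMap.range (A j) := LinearMap.range_comp_le_range _ _
    have hle2 : LinearMap.range (A j * A i) ≤ LinearMap.range (A i) := by
      rw [← (cA i j hij).eq]
      exact LinearMap.range_comp_le_range _ _
    have he1 := Submodule.eq_of_le_of_finrank_le hle1 ((rk j).trans hpos)
    have he2 := Submodule.eq_of_le_of_finrank_le hle2 ((rk i).trans hpos)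
    have act : ∀ k l, LinearMap.range (A k) = LinearMap.range (A l) → A l * A k = t • A k := by
      intro k l h
      ext v
      obtain ⟨w, hw⟩ : A k v ∈ LinearMap.range (A l) := h ▸ ⟨v, rfl⟩
      have := congrArg (fun f : End ℂ V => f w) (ht l)
      simpa [hw] using this
    have a1 := act i j (he2.symm.trans he1)
    have a2 := act j i (he1.symm.trans he2)
    rw [(cA i j hij).eq, a1] at a2
    have t0 : t ≠ 0 := by
      rintro rfl
      exact h0 (by rw [a1, zero_smul])
    exact hne (hT.all_eq_of_far hm hij (eq_of (smul_right_injective _ t0 a2)) _ _)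
  have hs : ∀ i j : Fin m, (i : ℕ) + 1 = j → 1 ≤ finrank ℂ (LinearMap.range (A j * A i)) := by
    intro i j hij
    rw [Nat.one_le_iff_ne_zero, Ne, Submodule.finrank_eq_zero, LinearMap.range_eq_bot]
    intro h0
    have e := braid_expand (hA i) (hA j) (hT.braid i j hij)
    rw [mul_assoc (A i), h0, mul_zero, zero_mul, ht, ht, zero_add, zero_add, smul_smul, smul_smul,
      ← add_smul, ← add_smul, ← mul_add] at e
    by_cases hty : t + y = 0
    · have hTA : T i * A i = T i * 0 := by
        have : T i = A i + y • 1 := by rw [hA]; abel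
        rw [this, add_mul, ht, smul_mul_assoc, one_mul, ← add_smul, hty, zero_smul, mul_zero]
      have hAi := mul_left_cancel (hT.inj i) hTA
      have hAall : ∀ k, A k = 0 := by
        intro k
        have hk := hT.finrank_range_eq y (by omega) k
        rw [← hT.finrank_range_eq y (by omega) i, ← hA, ← hA, hAi, LinearMap.range_zero,
          finrank_bot, Submodule.finrank_eq_zero, LinearMap.range_eq_bot] at hk
        exact hk
      exact hne (eq_of ((hAall _).trans (hAall _).symm))
    · exact hne (hT.all_eq hij
        (eq_of (smul_right_injective _ (mul_ne_zero hy hty) e)) _ _)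
  have := chain_bound hz hs
  omega

theorem ne_zero_of_finrank_ker_pos {V : Type} [AddCommGroup V] [Module ℂ V]
    {S : End ℂ V} (hS : Function.Injective S) {y : ℂ}
    (h : 0 < finrank ℂ (LinearMap.ker (S - y • 1))) : y ≠ 0 := by
  rintro rfl
  rw [zero_smul, sub_zero, LinearMap.ker_eq_bot.mpr hS, finrank_bot] at h
  exact h.false

/-- Representations of `B_{m+1}` of dimension at most `m - 2` have equal generators. -/
theorem rigid (m : ℕ) (hm : 4 ≤ m) : Rigid m (m - 1) := by
  induction m using Nat.strong_induction_on with
  | _ m ih =>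
  intro W _ _ _ T hT hd i j
  have hrk := fun y : ℂ => LinearMap.finrank_range_add_finrank_ker (T ⟨0, by omega⟩ - y • 1)
  have done : ∀ y : ℂ, 0 < finrank ℂ (LinearMap.ker (T ⟨0, by omega⟩ - y • 1)) →
      finrank ℂ (LinearMap.range (T ⟨0, by omega⟩ - y • 1)) ≤ 1 → T i = T j := fun y h0 h1 =>
    hT.all_eq_of_corank_one hm (by omega) (ne_zero_of_finrank_ker_pos (hT.inj _) h0) h1 i j
  by_cases h6 : 6 ≤ m
  · by_cases hy : ∀ y : ℂ, finrank ℂ (LinearMap.ker (T ⟨0, by omega⟩ - y • 1)) < m - 3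
    · obtain ⟨m, rfl⟩ : ∃ k, m = k + 2 := ⟨m - 2, by omega⟩
      have h := all_eq_of_centralizer (by omega) (ih m (by omega) (by omega)) hT.tail
        (fun k => (hT.comm ⟨0, by omega⟩ _ (by simp)).symm) (fun y => hy y)
        ⟨0, by omega⟩ ⟨1, by omega⟩
      exact hT.all_eq (by simp) h i j
    · push Not at hy
      obtain ⟨y, hy⟩ := hy
      exact done y (by omega) (by have := hrk y; omega)
  · by_cases hy : ∀ y : ℂ, finrank ℂ (LinearMap.ker (T ⟨0, by omega⟩ - y • 1)) ≤ 1
    · have hc := commute_of_regular (hT.comm ⟨0, by omega⟩ ⟨2, by omega⟩ le_rfl).symm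
        (hT.comm ⟨0, by omega⟩ ⟨3, by omega⟩ (by simp)).symm hy
      exact hT.all_eq (a := ⟨2, by omega⟩) (b := ⟨3, by omega⟩) rfl (hT.eq_of_commute rfl hc) i j
    · push Not at hy
      obtain ⟨y, hy⟩ := hy
      exact done y (by omega) (by have := hrk y; omega)

end Rank
section Main

variable {V : Type} [AddCommGroup V] [Module ℂ V] [FiniteDimensional ℂ V] {m : ℕ}
  {T : Fin m → End ℂ V}

theorem mul_eq_mul_of_finrank_range_lt {D : ℕ} (hD : Rigid m D) (hT : IsBraid T) {P : End ℂ V}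
    (hP : ∀ i, Commute (T i) P) (hr : finrank ℂ (LinearMap.range P) < D) (i j : Fin m) :
    T i * P = T j * P := by
  have ran : ∀ i, ∀ v ∈ LinearMap.range P, T i v ∈ LinearMap.range P := by
    rintro i _ ⟨v, rfl⟩
    exact ⟨T i v, (congrArg (fun f : End ℂ V => f v) (hP i).eq).symm⟩
  have h := hD _ _ (hT.restrict ran) hr i j
  ext v
  exact congrArg (fun f : End ℂ (LinearMap.range P) => (f ⟨P v, v, rfl⟩ : V)) h

theorem mul_eq_mul_of_small (hT : IsBraid T) (hm : 6 ≤ m) {y : ℂ}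
    (hr : finrank ℂ (LinearMap.range (T ⟨0, by omega⟩ - y • 1)) < m - 3) {i j : Fin m}
    (hi : 2 ≤ (i : ℕ)) (hj : 2 ≤ (j : ℕ)) :
    T i * (T ⟨0, by omega⟩ - y • 1) = T j * (T ⟨0, by omega⟩ - y • 1) := by
  obtain ⟨m, rfl⟩ : ∃ k, m = k + 2 := ⟨m - 2, by omega⟩
  have h := mul_eq_mul_of_finrank_range_lt (rigid m (by omega)) hT.tail
    (fun k => commute_sub_smul_one (hT.comm ⟨0, by omega⟩ _ (by simp)).symm y) hr
    ⟨i - 2, by omega⟩ ⟨j - 2, by omega⟩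
  have e : ∀ k : Fin (m + 2), 2 ≤ (k : ℕ) → ∀ hk : (k : ℕ) - 2 < m,
      ((⟨k - 2, hk⟩ : Fin m).natAdd 2).cast (add_comm 2 m) = k := fun k hk _ =>
    Fin.ext (by simp; omega)
  simpa only [e i hi, e j hj] using h

theorem finrank_range_eq_two (hT : IsBraid T) (hm : 8 ≤ m) (hV : finrank ℂ V = m + 1)
    (irr : ∀ p : Submodule ℂ V, (∀ i, ∀ v ∈ p, T i v ∈ p) → p = ⊥ ∨ p = ⊤) :
    ∃ y : ℂ, y ≠ 0 ∧ finrank ℂ (LinearMap.range (T ⟨0, by omega⟩ - y • 1)) = 2 := by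
  have noCommon : ∀ v : V, (∀ i, ∃ c : ℂ, T i v = c • v) → v = 0 := by
    intro v hv
    rcases irr (Submodule.span ℂ {v}) (fun i w hw => by
      obtain ⟨a, rfl⟩ := Submodule.mem_span_singleton.mp hw
      obtain ⟨c, hc⟩ := hv i
      rw [map_smul, hc]
      exact Submodule.smul_mem _ _ (Submodule.smul_mem _ _ (Submodule.mem_span_singleton_self v)))
      with h | h
    · exact Submodule.span_singleton_eq_bot.mp h
    · have h1 := finrank_span_le_card (R := ℂ) ({v} : Set V)
      rw [h, finrank_top, Set.toFinset_singleton, Finset.card_singleton] at h1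
      omega
  have notAll : ¬ ∀ i j, T i = T j := by
    intro h
    have : Nontrivial V := nontrivial_of_finrank_pos (R := ℂ) (by omega)
    obtain ⟨c, hc⟩ := Module.End.exists_eigenvalue (T ⟨0, by omega⟩)
    obtain ⟨v, hv⟩ := hc.exists_hasEigenvector
    exact hv.2 (noCommon v fun i => ⟨c, by rw [h i ⟨0, by omega⟩, hv.apply_eq_smul]⟩)
  obtain ⟨y, hy⟩ : ∃ y : ℂ, m - 3 ≤ finrank ℂ (LinearMap.ker (T ⟨0, by omega⟩ - y • 1)) := by
    by_contra! hy
    obtain ⟨m, rfl⟩ : ∃ k, m = k + 2 := ⟨m - 2, by omega⟩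
    have h := all_eq_of_centralizer (by omega) (rigid m (by omega)) hT.tail
      (fun k => (hT.comm ⟨0, by omega⟩ _ (by simp)).symm) (fun y => hy y)
      ⟨0, by omega⟩ ⟨1, by omega⟩
    exact notAll (hT.all_eq (by simp) h)
  have hy0 : y ≠ 0 := ne_zero_of_finrank_ker_pos (hT.inj ⟨0, by omega⟩)
    (lt_of_lt_of_le (by omega) hy)
  have hr4 : finrank ℂ (LinearMap.range (T ⟨0, by omega⟩ - y • 1)) ≤ 4 := by
    have := LinearMap.finrank_range_add_finrank_ker (T ⟨0, by omega⟩ - y • 1)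
    omega
  refine ⟨y, hy0, ?_⟩
  obtain ⟨A, hA⟩ : ∃ A : Fin m → End ℂ V, ∀ i, A i = T i - y • 1 := ⟨_, fun _ => rfl⟩
  have rk : ∀ i, finrank ℂ (LinearMap.range (A i)) =
      finrank ℂ (LinearMap.range (T ⟨0, by omega⟩ - y • 1)) := fun i => by
    rw [hA, hT.finrank_range_eq y (by omega)]
  have cTA : ∀ i j : Fin m, (i : ℕ) + 2 ≤ j ∨ (j : ℕ) + 2 ≤ i ∨ i = j → Commute (T i) (A j) := by
    intro i j hij
    rw [hA]
    apply commute_sub_smul_one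
    rcases hij with h | h | rfl
    · exact hT.comm i j h
    · exact (hT.comm j i h).symm
    · exact Commute.refl _
  have cA : ∀ i j : Fin m, (i : ℕ) + 2 ≤ j → Commute (A i) (A j) := by
    intro i j hij
    rw [hA i]
    exact (commute_sub_smul_one (cTA i j (Or.inl hij)).symm y).symm
  have low : ∀ i j : Fin m, 2 ≤ (i : ℕ) → 2 ≤ (j : ℕ) →
      A i * A ⟨0, by omega⟩ = A j * A ⟨0, by omega⟩ := by
    intro i j hi hj
    have h := hT.mul_eq_mul_of_small (by omega) (y := y) (by omega) hi hj
    rw [hA, hA, hA, sub_mul, h, ← sub_mul]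
  have high : A ⟨0, by omega⟩ * A ⟨m - 1, by omega⟩ = A ⟨1, by omega⟩ * A ⟨m - 1, by omega⟩ := by
    have e0 : (⟨0, by omega⟩ : Fin m).rev = ⟨m - 1, by omega⟩ := Fin.ext (by simp)
    have h := hT.rev.mul_eq_mul_of_small (by omega) (y := y)
      (by rw [hT.finrank_range_eq y (by omega)]; omega)
      (i := ⟨m - 1, by omega⟩) (j := ⟨m - 2, by omega⟩) (by simp only; omega) (by simp only; omega)
    have e1 : (⟨m - 1, by omega⟩ : Fin m).rev = ⟨0, by omega⟩ := Fin.ext (by simp; omega)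
    have e2 : (⟨m - 2, by omega⟩ : Fin m).rev = ⟨1, by omega⟩ := Fin.ext (by simp; omega)
    rw [e0, e1, e2] at h
    rw [hA, hA, hA, sub_mul, h, ← sub_mul]
  obtain ⟨Q, hQ⟩ : ∃ Q, Q = A ⟨2, by omega⟩ * A ⟨0, by omega⟩ := ⟨_, rfl⟩
  have lowQ : ∀ i : Fin m, 2 ≤ (i : ℕ) → A i * A ⟨0, by omega⟩ = Q := fun i hi =>
    hQ ▸ low i ⟨2, by omega⟩ hi le_rfl
  have cQ : ∀ k, Commute (T k) Q := by
    intro k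
    by_cases h1 : (k : ℕ) = 1
    · have e : Q = A ⟨m - 1, by omega⟩ * A ⟨1, by omega⟩ := by
        rw [← lowQ ⟨m - 1, by omega⟩ (by simp only; omega),
          ← (cA ⟨0, by omega⟩ ⟨m - 1, by omega⟩ (by simp only; omega)).eq, high,
          (cA ⟨1, by omega⟩ ⟨m - 1, by omega⟩ (by simp only; omega)).eq]
      rw [e]
      exact (cTA _ _ (by simp only; omega)).mul_right
        (cTA _ _ (Or.inr (Or.inr (Fin.ext h1))))
    by_cases h0 : (k : ℕ) = 0
    · rw [hQ]
      exact (cTA _ _ (by simp only; omega)).mul_right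
        (cTA _ _ (Or.inr (Or.inr (Fin.ext h0))))
    obtain ⟨j, hj2, hj⟩ : ∃ j : Fin m, 2 ≤ (j : ℕ) ∧ ((k : ℕ) + 2 ≤ j ∨ (j : ℕ) + 2 ≤ k) := by
      by_cases h4 : (k : ℕ) < 4
      · exact ⟨⟨5, by omega⟩, by simp only; omega, by simp only; omega⟩
      · exact ⟨⟨2, by omega⟩, by simp only; omega, by simp only; omega⟩
    rw [← lowQ j hj2]
    exact (cTA k j (by omega)).mul_right (cTA k _ (by simp only; omega))
  have Q0 : Q = 0 := by
    rcases irr (LinearMap.range Q) (fun k => by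
      rintro _ ⟨v, rfl⟩
      exact ⟨T k v, (congrArg (fun f : End ℂ V => f v) (cQ k).eq).symm⟩) with h | h
    · exact LinearMap.range_eq_bot.mp h
    · have hle : LinearMap.range Q ≤ LinearMap.range (A ⟨2, by omega⟩) := by
        rw [hQ]
        exact LinearMap.range_comp_le_range _ _
      have h1 := Submodule.finrank_mono hle
      rw [h, finrank_top, rk] at h1
      omega
  have far : ∀ i j : Fin m, (i : ℕ) + 2 ≤ j → A j * A i = 0 := by
    intro i j hij
    rw [hA, hA]
    refine hT.mul_eq_zero_of_far y (by omega) (fun j hj => ?_) i j hij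
    rw [← hA, ← hA, lowQ j hj, Q0]
  have prod1 : finrank ℂ (LinearMap.range (A ⟨1, by omega⟩ * A ⟨0, by omega⟩)) ≤ 1 := by
    by_contra! h
    have := chain_bound (s := 2) far (fun i j hij => by
      rw [hA, hA, hT.finrank_range_mul_eq y (by omega) hij, ← hA, ← hA]
      exact h)
    omega
  obtain ⟨a, ha⟩ : ∃ a, a = A ⟨0, by omega⟩ := ⟨_, rfl⟩
  obtain ⟨b, hb⟩ : ∃ b, b = A ⟨1, by omega⟩ := ⟨_, rfl⟩
  have hbr := hT.braid ⟨0, by omega⟩ ⟨1, by omega⟩ rfl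
  have prod2 : finrank ℂ (LinearMap.range (a * b)) ≤ 1 := by
    rw [← ha, ← hb] at prod1
    refine le_trans (le_of_eq ?_) prod1
    refine finrank_range_eq_of_conj (mul_inj (mul_inj (hT.inj ⟨0, by omega⟩)
      (hT.inj ⟨1, by omega⟩)) (hT.inj ⟨0, by omega⟩)) ?_
    have g0 := conj_sub (y := y) (show T ⟨0, by omega⟩ * T ⟨1, by omega⟩ * T ⟨0, by omega⟩ *
        T ⟨0, by omega⟩ = T ⟨1, by omega⟩ *
        (T ⟨0, by omega⟩ * T ⟨1, by omega⟩ * T ⟨0, by omega⟩) by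
      rw [hbr]; simp only [mul_assoc] at hbr ⊢; rw [hbr])
    have g1 := conj_sub (y := y) (show T ⟨0, by omega⟩ * T ⟨1, by omega⟩ * T ⟨0, by omega⟩ *
        T ⟨1, by omega⟩ = T ⟨0, by omega⟩ *
        (T ⟨0, by omega⟩ * T ⟨1, by omega⟩ * T ⟨0, by omega⟩) by
      rw [mul_assoc, mul_assoc, hbr]; simp only [mul_assoc])
    rw [← hA, ← hA, ← ha, ← hb] at g0
    rw [← hA, ← hA, ← ha, ← hb] at g1
    rw [← mul_assoc, g0, mul_assoc, g1]
    simp only [mul_assoc]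
  have hTa : T ⟨0, by omega⟩ = a + y • 1 := by rw [ha, hA]; abel
  have kill : ∀ x, (∀ i, A i x = 0) → x = 0 := fun x hx => noCommon x fun i => ⟨y, by
    have := hx i
    rw [hA] at this
    simpa [sub_eq_zero] using this⟩
  have hX : finrank ℂ (LinearMap.range a ⊓ LinearMap.ker b : Submodule ℂ V) ≤ 1 := by
    refine le_trans ?_ prod2
    let f : (LinearMap.range a ⊓ LinearMap.ker b : Submodule ℂ V) →ₗ[ℂ] LinearMap.range (a * b) :=
      LinearMap.restrict (a * T ⟨0, by omega⟩) (fun x hx => by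
        have hbx : b x = 0 := hx.2
        have e := congrArg (fun f : End ℂ V => f x)
          (braid_expand (ha.trans (hA _)) (hb.trans (hA _)) hbr)
        simp only [LinearMap.add_apply, Module.End.mul_apply, LinearMap.smul_apply, hbx, map_zero,
          smul_zero, add_zero] at e
        refine ⟨-(y⁻¹ • a x), ?_⟩
        have e' : a (b (a x)) = -(y • a (a x)) - (y * y) • a x := by
          rw [eq_sub_iff_add_eq, eq_neg_iff_add_eq_zero, ← e]
          abel
        rw [map_neg, map_smul, Module.End.mul_apply, e', Module.End.mul_apply, hTa]
        simp [smul_sub, smul_smul, hy0, add_comm])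
    refine LinearMap.finrank_le_finrank_of_injective (f := f) ?_
    rw [injective_iff_map_eq_zero]
    rintro ⟨x, ⟨u, hu⟩, hx⟩ h0
    have h1 : a (T ⟨0, by omega⟩ x) = 0 := congrArg Subtype.val h0
    have h2 : T ⟨0, by omega⟩ (a x) = 0 := by
      rw [← h1, ha]
      exact congrArg (fun f : End ℂ V => f x) (cTA _ _ (Or.inr (Or.inr rfl))).eq
    have h3 : a x = 0 := hT.inj _ (h2.trans (map_zero _).symm)
    refine Subtype.ext (kill x fun i => ?_)
    by_cases hi0 : (i : ℕ) = 0
    · rw [show i = ⟨0, by omega⟩ from Fin.ext hi0, ← ha, h3]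
    by_cases hi1 : (i : ℕ) = 1
    · rw [show i = ⟨1, by omega⟩ from Fin.ext hi1, ← hb]
      exact hx
    · rw [← hu, ha]
      exact congrArg (fun f : End ℂ V => f u) (far ⟨0, by omega⟩ i (by simp only; omega))
  have hr2 : finrank ℂ (LinearMap.range a) ≤ 2 := by
    let f := b.domRestrict (LinearMap.range a)
    have h1 := LinearMap.finrank_range_add_finrank_ker f
    have h2 : finrank ℂ (LinearMap.range f) ≤ 1 := by
      rw [← ha, ← hb] at prod1
      refine (Submodule.finrank_mono ?_).trans prod1
      rintro _ ⟨⟨_, u, rfl⟩, rfl⟩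
      exact ⟨u, rfl⟩
    have h3 : finrank ℂ (LinearMap.ker f) ≤ 1 := by
      rw [← Submodule.finrank_map_subtype_eq]
      refine (Submodule.finrank_mono ?_).trans hX
      rintro _ ⟨v, hv, rfl⟩
      exact ⟨v.2, hv⟩
    omega
  have hr : m + 1 ≤ m * finrank ℂ (LinearMap.range a) := by
    let f : V →ₗ[ℂ] ((i : Fin m) → LinearMap.range (A i)) :=
      LinearMap.pi fun i => (A i).rangeRestrict
    have hf : Function.Injective f := by
      rw [injective_iff_map_eq_zero]
      exact fun x hx => kill x fun i => congrArg Subtype.val (congrFun hx i)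
    have h1 := LinearMap.finrank_le_finrank_of_injective hf
    rw [Module.finrank_pi_fintype, hV] at h1
    rw [ha, rk]
    simpa [rk] using h1
  rw [← rk ⟨0, by omega⟩, ← ha]
  interval_cases h : finrank ℂ (LinearMap.range a)
  · omega
  · omega
  · rfl

end Main

end IsBraid

/-- For `n ≥ 9`, every `n`-dimensional complex irreducible representation of `B_n`
is the tensor product of a one-dimensional representation `χ(y)` and a representation
of corank 2: there is `y ≠ 0` with `rank (T 1 - y I) = 2`. -/
theorem tensor_product_of_corank_two (n : ℕ) (hn : 9 ≤ n)
    (T : ℕ → Matrix (Fin n) (Fin n) ℂ)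
    (hunit : ∀ i, 1 ≤ i → i ≤ n - 1 → IsUnit (T i))
    (hbr : BraidRels n T)
    (hirr : BraidIrreducible n T) :
    ∃ y : ℂ, y ≠ 0 ∧ (T 1 - y • (1 : Matrix (Fin n) (Fin n) ℂ)).rank = 2 := by
  have hT : IsBraid (fun i : Fin (n - 1) => Matrix.toLin' (T (i + 1))) := by
    refine ⟨fun i => ?_, fun i j hij => ?_, fun i j hij => ?_⟩
    · have h := Matrix.mulVec_injective_of_isUnit (hunit (i + 1) (by omega) (by omega))
      exact h
    · simp only [Module.End.mul_eq_comp, ← Matrix.toLin'_mul, ← hij]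
      rw [hbr.1 (i + 1) (by omega) (by omega)]
    · rw [Commute, SemiconjBy]
      simp only [Module.End.mul_eq_comp, ← Matrix.toLin'_mul]
      rw [hbr.2 (i + 1) (j + 1) (by omega) (by omega) (by omega)]
  obtain ⟨y, hy, h⟩ := hT.finrank_range_eq_two (by omega)
    (by rw [Module.finrank_fin_fun]; omega) (fun p hp => hirr p fun i h1 h2 v hv => by
      have := hp ⟨i - 1, by omega⟩ v hv
      simpa [Nat.sub_add_cancel h1] using this)
  refine ⟨y, hy, ?_⟩
  rw [← h, Matrix.rank, ← Matrix.toLin'_apply', map_sub, map_smul, Matrix.toLin'_one]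
  rfl
end
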